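/- Let q ≥ 5 be either an odd prime or a power of two, and let K_q = ℚ(ζ_q + ζ_q^{-1}) with ring of integers O_q. A classical totally positive definite ternary quadratic form that is universal over O_q exists if and only if q = 5 or q = 8. -/

import Mathlib

open NumberField

/-- The maximal totally real subfield `K_q = ℚ(ζ_q + ζ_q⁻¹)` of the `q`-th cyclotomic field,
realized inside `ℝ` as `ℚ(2 cos(2π/q))`. -/
noncomputable def Kq (q : ℕ) : IntermediateField ℚ ℝ :=
  IntermediateField.adjoin ℚ {2 * Real.cos (2 * Real.pi / q)}

/-- An element `α` of the ring of integers of `K` is totally positive if `σ α > 0`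
for every real embedding `σ : K →+* ℝ`. -/
def TotallyPositive (K : Type*) [Field K] (α : 𝓞 K) : Prop :=
  ∀ σ : K →+* ℝ, 0 < σ (α : K)

/-- Evaluation `vᵀ M v` of the classical quadratic form with Gram matrix `M`. -/
def evalQF {R : Type*} [CommRing R] {n : ℕ} (M : Matrix (Fin n) (Fin n) R)
    (v : Fin n → R) : R :=
  ∑ i, ∑ j, v i * M i j * v j

/-- There exists a classical totally positive definite universal ternary quadratic form
over `𝓞_K`. -/
def ExistsUniversalTernary (K : Type*) [Field K] : Prop :=
  ∃ M : Matrix (Fin 3) (Fin 3) (𝓞 K), M.IsSymm ∧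
    (∀ v : Fin 3 → 𝓞 K, v ≠ 0 → TotallyPositive K (evalQF M v)) ∧
    (∀ α : 𝓞 K, TotallyPositive K α → ∃ v : Fin 3 → 𝓞 K, evalQF M v = α)

/-! ### Double cosines, the elements `2 cos (2πa/q)` and the embeddings of `K_q` -/

/-- The real number `2 cos (2πa/q)`. -/
noncomputable def dcos (q : ℕ) [NeZero q] (a : ZMod q) : ℝ := 2 * (ZMod.stdAddChar a).re

lemma dcos_ofReal {q : ℕ} [NeZero q] (a : ZMod q) :
    ((dcos q a : ℝ) : ℂ) = ZMod.stdAddChar a + ZMod.stdAddChar (-a) := by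
  rw [AddChar.map_neg_eq_conj, Complex.add_conj, dcos]

lemma dcos_zero {q : ℕ} [NeZero q] : dcos q 0 = 2 := by
  simp [dcos]

lemma dcos_neg {q : ℕ} [NeZero q] (a : ZMod q) : dcos q (-a) = dcos q a := by
  have h : ((dcos q (-a) : ℝ) : ℂ) = (dcos q a : ℝ) := by
    rw [dcos_ofReal, dcos_ofReal, neg_neg, add_comm]
  exact_mod_cast h

lemma dcos_mul {q : ℕ} [NeZero q] (a b : ZMod q) :
    dcos q a * dcos q b = dcos q (a + b) + dcos q (a - b) := by
  have h : ((dcos q a * dcos q b : ℝ) : ℂ) = ((dcos q (a + b) + dcos q (a - b) : ℝ) : ℂ) := by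
    push_cast
    simp only [dcos_ofReal, sub_eq_add_neg, neg_add, neg_neg, AddChar.map_add_eq_mul]
    ring
  exact_mod_cast h

lemma dcos_intCast {q : ℕ} [NeZero q] (j : ℤ) :
    dcos q (j : ZMod q) = 2 * Real.cos (2 * Real.pi * j / q) := by
  rw [dcos, ZMod.stdAddChar_coe]
  have : (2 * ↑Real.pi * Complex.I * ↑j / ↑q : ℂ) =
      ((2 * Real.pi * j / q : ℝ) : ℂ) * Complex.I := by push_cast; ring
  rw [this, Complex.exp_ofReal_mul_I_re]

lemma dcos_natCast {q : ℕ} [NeZero q] (j : ℕ) :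
    dcos q (j : ZMod q) = 2 * Real.cos (2 * Real.pi * j / q) := by
  have := dcos_intCast (q := q) (j : ℤ)
  simpa using this

lemma sum_dcos {q : ℕ} [NeZero q] (a : ZMod q) :
    ∑ t, dcos q (t * a) = if a = 0 then 2 * (q : ℝ) else 0 := by
  have h := AddChar.sum_mulShift a (ZMod.isPrimitive_stdAddChar q)
  have h' := congrArg Complex.re h
  simp only [dcos, ← Finset.mul_sum]
  rw [← Complex.re_sum, h']
  split_ifs <;> simp [ZMod.card]

lemma norm_stdAddChar {q : ℕ} [NeZero q] (a : ZMod q) : ‖(ZMod.stdAddChar a : ℂ)‖ = 1 := by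
  rw [ZMod.stdAddChar_apply]; exact Circle.norm_coe _

lemma abs_dcos_le {q : ℕ} [NeZero q] (a : ZMod q) : |dcos q a| ≤ 2 := by
  have := Complex.abs_re_le_norm (ZMod.stdAddChar a : ℂ)
  rw [norm_stdAddChar] at this
  rw [dcos, abs_mul]
  norm_num; linarith

lemma dcos_eq_two {q : ℕ} [NeZero q] {a : ZMod q} (h : dcos q a = 2) : a = 0 := by
  apply ZMod.injective_stdAddChar
  rw [AddChar.map_zero_eq_one]
  have h1 : (ZMod.stdAddChar a : ℂ).re = 1 := by rw [dcos] at h; linarith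
  have h2 := norm_stdAddChar a
  have h3 : (ZMod.stdAddChar a : ℂ).im = 0 := by
    have h4 := Complex.sq_norm (ZMod.stdAddChar a : ℂ)
    rw [Complex.normSq_apply, h1, h2] at h4
    nlinarith
  exact Complex.ext h1 h3

lemma dcos_mem {q : ℕ} [NeZero q] (a : ZMod q) : dcos q a ∈ Kq q := by
  have key : ∀ n : ℕ, dcos q (n : ZMod q) ∈ Kq q ∧ dcos q ((n + 1 : ℕ) : ZMod q) ∈ Kq q := by
    intro n
    induction n with
    | zero =>
      refine ⟨?_, ?_⟩
      · rw [Nat.cast_zero, dcos_zero]; exact ofNat_mem (Kq q) 2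
      · apply IntermediateField.subset_adjoin
        rw [dcos_natCast]; simp
    | succ n ih =>
      refine ⟨ih.2, ?_⟩
      have h1 : dcos q 1 ∈ Kq q := by
        apply IntermediateField.subset_adjoin
        have := dcos_natCast (q := q) 1
        simp at this; simp [this]
      have h := dcos_mul ((n + 1 : ℕ) : ZMod q) 1
      have h2 : dcos q ((n + 1 + 1 : ℕ) : ZMod q) =
          dcos q ((n + 1 : ℕ) : ZMod q) * dcos q 1 - dcos q (n : ZMod q) := by
        rw [h]; push_cast; ring_nf
      rw [h2]
      exact (Kq q).sub_mem ((Kq q).mul_mem ih.2 h1) ih.1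
  have := (key a.val).1
  rwa [ZMod.natCast_zmod_val] at this

lemma isIntegral_stdAddChar {q : ℕ} [NeZero q] (a : ZMod q) :
    IsIntegral ℤ (ZMod.stdAddChar a : ℂ) := by
  refine IsIntegral.of_pow (n := q) (NeZero.pos q) ?_
  rw [← AddChar.map_nsmul_eq_pow]
  simp [isIntegral_one]

lemma isIntegral_dcos {q : ℕ} [NeZero q] (a : ZMod q) : IsIntegral ℤ (dcos q a) := by
  rw [← isIntegral_algebraMap_iff (B := ℂ) (algebraMap ℝ ℂ).injective]
  change IsIntegral ℤ ((dcos q a : ℝ) : ℂ)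
  rw [dcos_ofReal]
  exact (isIntegral_stdAddChar _).add (isIntegral_stdAddChar _)

/-- The algebraic integer `2 cos (2πa/q)` of `K_q`. -/
noncomputable def eta (q : ℕ) [NeZero q] (a : ZMod q) : 𝓞 (Kq q) :=
  ⟨⟨dcos q a, dcos_mem a⟩, by
    have h := isIntegral_dcos a
    rw [mem_integralClosure_iff, ← isIntegral_algebraMap_iff (A := Kq q) (B := ℝ) (algebraMap (Kq q) ℝ).injective]
    exact h⟩

lemma ringOfIntegers_ext_real {q : ℕ} {x y : 𝓞 (Kq q)} (h : ((x : Kq q) : ℝ) = ((y : Kq q) : ℝ)) :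
    x = y :=
  RingOfIntegers.ext (Subtype.ext h)

lemma coe_eta {q : ℕ} [NeZero q] (a : ZMod q) : ((eta q a : Kq q) : ℝ) = dcos q a := rfl

lemma eta_zero {q : ℕ} [NeZero q] : eta q 0 = 2 :=
  ringOfIntegers_ext_real (by rw [coe_eta, dcos_zero]; rfl)

lemma eta_neg {q : ℕ} [NeZero q] (a : ZMod q) : eta q (-a) = eta q a :=
  ringOfIntegers_ext_real (by rw [coe_eta, dcos_neg]; rfl)

lemma eta_mul {q : ℕ} [NeZero q] (a b : ZMod q) :
    eta q a * eta q b = eta q (a + b) + eta q (a - b) :=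
  ringOfIntegers_ext_real (by
    have := dcos_mul a b
    simpa [coe_eta] using this)

lemma eta_sq {q : ℕ} [NeZero q] (a : ZMod q) : eta q a ^ 2 = eta q (2 * a) + 2 := by
  rw [sq, eta_mul, sub_self, eta_zero, two_mul]

lemma isPrimitiveRoot_stdAddChar {q : ℕ} [NeZero q] {s : ZMod q} (hs : IsUnit s) :
    IsPrimitiveRoot (ZMod.stdAddChar s : ℂ) q := by
  constructor
  · rw [← AddChar.map_nsmul_eq_pow]; simp
  · intro l hl
    rw [← AddChar.map_nsmul_eq_pow] at hl
    have h : l • s = 0 := ZMod.injective_stdAddChar (by rw [hl, AddChar.map_zero_eq_one])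
    rw [nsmul_eq_mul] at h
    have h' : (l : ZMod q) = 0 := by
      have := hs.mul_left_eq_zero.1 h
      exact this
    exact (ZMod.natCast_eq_zero_iff l q).1 h'

lemma Kq_hom_eta {q : ℕ} [NeZero q] (σ : Kq q →+* ℝ) {s : ZMod q}
    (h : σ (eta q 1 : Kq q) = dcos q s) (a : ZMod q) : σ (eta q a : Kq q) = dcos q (s * a) := by
  have key : ∀ n : ℕ, σ (eta q (n : ZMod q) : Kq q) = dcos q (s * n) ∧
      σ (eta q ((n + 1 : ℕ) : ZMod q) : Kq q) = dcos q (s * (n + 1 : ℕ)) := by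
    intro n
    induction n with
    | zero =>
      refine ⟨?_, by simpa using h⟩
      rw [Nat.cast_zero, eta_zero, mul_zero, dcos_zero]
      exact map_ofNat σ 2
    | succ n ih =>
      refine ⟨ih.2, ?_⟩
      have e : eta q ((n + 1 + 1 : ℕ) : ZMod q) =
          eta q ((n + 1 : ℕ) : ZMod q) * eta q 1 - eta q (n : ZMod q) := by
        rw [eta_mul]; push_cast; ring_nf
      have d := dcos_mul (s * ((n + 1 : ℕ) : ZMod q)) s
      rw [e]
      simp only [map_sub, map_mul, ih.1, ih.2, h]
      rw [d]; push_cast; ring_nf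
  have := (key a.val).1
  rwa [ZMod.natCast_zmod_val] at this

lemma exists_Kq_hom {q : ℕ} [NeZero q] {s : ZMod q} (hs : IsUnit s) :
    ∃ σ : Kq q →+* ℝ, ∀ a, σ (eta q a : Kq q) = dcos q (s * a) := by
  set z : ℂ := ZMod.stdAddChar (1 : ZMod q) with hz
  set w : ℂ := ZMod.stdAddChar s with hw
  have hzp : IsPrimitiveRoot z q := isPrimitiveRoot_stdAddChar isUnit_one
  have hwp : IsPrimitiveRoot w q := isPrimitiveRoot_stdAddChar hs
  have hmin : minpoly ℚ z = minpoly ℚ w := by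
    rw [← Polynomial.cyclotomic_eq_minpoly_rat hzp (NeZero.pos q),
      ← Polynomial.cyclotomic_eq_minpoly_rat hwp (NeZero.pos q)]
  have hzint : IsIntegral ℚ z := (isIntegral_stdAddChar (1 : ZMod q)).tower_top
  have hwint : IsIntegral ℚ w := (isIntegral_stdAddChar s).tower_top
  have hroot : w ∈ (minpoly ℚ z).aroots ℂ := by
    rw [hmin, Polynomial.mem_aroots]
    exact ⟨minpoly.ne_zero hwint, minpoly.aeval ℚ w⟩
  obtain ⟨φ, hφ⟩ : ∃ φ : IntermediateField.adjoin ℚ {z} →ₐ[ℚ] ℂ,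
      φ (IntermediateField.AdjoinSimple.gen ℚ z) = w :=
    ⟨(IntermediateField.algHomAdjoinIntegralEquiv ℚ hzint).symm ⟨w, hroot⟩,
      IntermediateField.algHomAdjoinIntegralEquiv_symm_apply_gen ℚ hzint ⟨w, hroot⟩⟩
  set g := IntermediateField.AdjoinSimple.gen ℚ z with hg
  have hgz : (g : ℂ) = z := rfl
  have hx : ((g + g⁻¹ : IntermediateField.adjoin ℚ {z}) : ℂ) = ((dcos q 1 : ℝ) : ℂ) := by
    rw [dcos_ofReal, AddChar.map_neg_eq_inv]; simp [hgz, hz]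
  have hφx : φ (g + g⁻¹) = ((dcos q s : ℝ) : ℂ) := by
    rw [dcos_ofReal, AddChar.map_neg_eq_inv]; simp [hφ, hw]
  set η : ℝ := 2 * Real.cos (2 * Real.pi / q) with hη
  have hη1 : η = dcos q 1 := by
    have := dcos_natCast (q := q) 1
    simp at this; rw [this]
  have hηint : IsIntegral ℚ η := by rw [hη1]; exact (isIntegral_dcos 1).tower_top
  have hroot2 : dcos q s ∈ (minpoly ℚ η).aroots ℝ := by
    rw [Polynomial.mem_aroots]
    refine ⟨minpoly.ne_zero hηint, ?_⟩
    have h1 : Polynomial.aeval (g + g⁻¹) (minpoly ℚ η) = 0 := by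
      apply (algebraMap (IntermediateField.adjoin ℚ {z}) ℂ).injective
      rw [← Polynomial.aeval_algebraMap_apply, map_zero]
      change Polynomial.aeval ((g + g⁻¹ : IntermediateField.adjoin ℚ {z}) : ℂ) _ = 0
      rw [hx, ← hη1]
      have := Polynomial.aeval_algebraMap_apply ℂ η (minpoly ℚ η)
      rw [minpoly.aeval, map_zero] at this
      exact this
    have h2 : Polynomial.aeval (φ (g + g⁻¹)) (minpoly ℚ η) = 0 := by
      rw [Polynomial.aeval_algHom_apply, h1, map_zero]
    rw [hφx] at h2
    have := Polynomial.aeval_algebraMap_apply ℂ (dcos q s) (minpoly ℚ η)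
    apply (algebraMap ℝ ℂ).injective
    rw [map_zero, ← this]; exact h2
  let ψ : Kq q →ₐ[ℚ] ℝ := (IntermediateField.algHomAdjoinIntegralEquiv ℚ hηint).symm
    ⟨dcos q s, hroot2⟩
  refine ⟨ψ, Kq_hom_eta _ ?_⟩
  have h := IntermediateField.algHomAdjoinIntegralEquiv_symm_apply_gen ℚ hηint
    ⟨dcos q s, hroot2⟩
  have e : (eta q 1 : Kq q) = IntermediateField.AdjoinSimple.gen ℚ η := Subtype.ext hη1.symm
  rw [e]
  exact h

lemma Kq_hom_eq {q : ℕ} [NeZero q] (σ : Kq q →+* ℝ) :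
    ∃ s : ZMod q, IsUnit s ∧ ∀ a, σ (eta q a : Kq q) = dcos q (s * a) := by
  set x : ℝ := σ (eta q 1 : Kq q) with hx
  obtain ⟨r, hr⟩ := IsAlgClosed.exists_eq_mul_self ((x : ℂ) ^ 2 - 4)
  set z : ℂ := (x + r) / 2 with hz
  have hzq : z * (x - z) = 1 := by
    rw [hz]; linear_combination (1 / 4 : ℂ) * hr
  have hz0 : z ≠ 0 := left_ne_zero_of_mul_eq_one hzq
  have hzi : (x : ℂ) = z + z⁻¹ := by rw [inv_eq_of_mul_eq_one_right hzq]; ring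
  have key : ∀ n : ℕ, ((σ (eta q (n : ZMod q) : Kq q) : ℝ) : ℂ) = z ^ n + (z ^ n)⁻¹ ∧
      ((σ (eta q ((n + 1 : ℕ) : ZMod q) : Kq q) : ℝ) : ℂ) = z ^ (n + 1) + (z ^ (n + 1))⁻¹ := by
    intro n
    induction n with
    | zero =>
      refine ⟨?_, ?_⟩
      · have h2 : σ ((2 : 𝓞 (Kq q)) : Kq q) = 2 := map_ofNat σ 2
        rw [Nat.cast_zero, eta_zero, h2]; norm_num
      · simpa [← hx] using hzi
    | succ n ih =>
      refine ⟨ih.2, ?_⟩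
      have e : eta q ((n + 1 + 1 : ℕ) : ZMod q) =
          eta q ((n + 1 : ℕ) : ZMod q) * eta q 1 - eta q (n : ZMod q) := by
        rw [eta_mul]; push_cast; ring_nf
      rw [e]
      simp only [map_sub, map_mul, Complex.ofReal_sub, Complex.ofReal_mul, ih.1, ih.2, ← hx, hzi]
      field_simp; ring
  have hzq1 : z ^ q = 1 := by
    have h := (key q).1
    rw [ZMod.natCast_self, eta_zero] at h
    have hne : z ^ q ≠ 0 := pow_ne_zero _ hz0
    have h2 : (2 : ℂ) = z ^ q + (z ^ q)⁻¹ := by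
      have h2 : σ ((2 : 𝓞 (Kq q)) : Kq q) = 2 := map_ofNat σ 2
      rw [← h, h2]; norm_num
    field_simp at h2
    have h3 : (z ^ q - 1) ^ 2 = 0 := by linear_combination -h2
    exact sub_eq_zero.1 (pow_eq_zero_iff (two_ne_zero) |>.1 h3)
  obtain ⟨i, -, hi⟩ := (isPrimitiveRoot_stdAddChar (q := q) isUnit_one).eq_pow_of_pow_eq_one hzq1
  have hz1 : (ZMod.stdAddChar (i : ZMod q) : ℂ) = z := by
    rw [← hi, ← AddChar.map_nsmul_eq_pow]; simp
  have hall := Kq_hom_eta σ (s := (i : ZMod q)) (by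
    have : ((σ (eta q 1 : Kq q) : ℝ) : ℂ) = (dcos q (i : ZMod q) : ℝ) := by
      rw [dcos_ofReal, AddChar.map_neg_eq_inv, hz1, ← hx, hzi]
    exact_mod_cast this)
  refine ⟨i, ?_, hall⟩
  apply IsArtinianRing.isUnit_of_mem_nonZeroDivisors
  rw [mem_nonZeroDivisors_iff_right]
  intro a ha
  have h := hall a
  rw [mul_comm, ha, dcos_zero] at h
  have h2 : (eta q a : Kq q) = 2 := by
    apply σ.injective; rw [h]; exact (map_ofNat σ 2).symm
  apply dcos_eq_two
  rw [← coe_eta, h2]; rfl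

/-- The additive span of `1` and the `eta q a`. -/
noncomputable def etaSpan (q : ℕ) [NeZero q] : AddSubgroup (𝓞 (Kq q)) :=
  AddSubgroup.closure (insert 1 (Set.range (eta q)))

lemma one_mem_etaSpan {q : ℕ} [NeZero q] : (1 : 𝓞 (Kq q)) ∈ etaSpan q :=
  AddSubgroup.subset_closure (Set.mem_insert _ _)

lemma eta_mem_etaSpan {q : ℕ} [NeZero q] (a : ZMod q) : eta q a ∈ etaSpan q :=
  AddSubgroup.subset_closure (Set.mem_insert_of_mem _ ⟨a, rfl⟩)

lemma mul_eta_mem_etaSpan {q : ℕ} [NeZero q] {x : 𝓞 (Kq q)} (hx : x ∈ etaSpan q) (a : ZMod q) :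
    x * eta q a ∈ etaSpan q := by
  induction hx using AddSubgroup.closure_induction with
  | mem x hx =>
    rcases hx with rfl | ⟨b, rfl⟩
    · rw [one_mul]; exact eta_mem_etaSpan a
    · rw [eta_mul]; exact add_mem (eta_mem_etaSpan _) (eta_mem_etaSpan _)
  | zero => rw [zero_mul]; exact zero_mem _
  | add x y _ _ hx hy => rw [add_mul]; exact add_mem hx hy
  | neg x _ hx => rw [neg_mul]; exact neg_mem hx

lemma mul_mem_etaSpan {q : ℕ} [NeZero q] {x y : 𝓞 (Kq q)} (hx : x ∈ etaSpan q)
    (hy : y ∈ etaSpan q) : x * y ∈ etaSpan q := by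
  induction hy using AddSubgroup.closure_induction with
  | mem y hy =>
    rcases hy with rfl | ⟨b, rfl⟩
    · rwa [mul_one]
    · exact mul_eta_mem_etaSpan hx b
  | zero => rw [mul_zero]; exact zero_mem _
  | add y z _ _ hy hz => rw [mul_add]; exact add_mem hy hz
  | neg y _ hy => rw [mul_neg]; exact neg_mem hy

lemma stdAddChar_one_im_ne_zero {q : ℕ} [NeZero q] (hq : 3 ≤ q) :
    (ZMod.stdAddChar (1 : ZMod q) : ℂ).im ≠ 0 := by
  intro h
  have h1 : (ZMod.stdAddChar (-1 : ZMod q) : ℂ) = ZMod.stdAddChar (1 : ZMod q) := by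
    rw [AddChar.map_neg_eq_conj]; exact Complex.conj_eq_iff_im.2 h
  have h2 : (-1 : ZMod q) = 1 := ZMod.injective_stdAddChar h1
  have h3 : ((2 : ℕ) : ZMod q) = 0 := by push_cast; linear_combination -h2
  have := Nat.le_of_dvd (by norm_num) ((ZMod.natCast_eq_zero_iff 2 q).1 h3)
  omega

lemma mem_adjoin_of_isIntegral {q : ℕ} [NeZero q] {L : Type*} [Field L] [CharZero L]
    [IsCyclotomicExtension {q} ℚ L] {ζ : L} (hζ : IsPrimitiveRoot ζ q) {y : L}
    (hy : IsIntegral ℤ y) : y ∈ Algebra.adjoin ℤ ({ζ} : Set L) := by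
  have := IsCyclotomicExtension.Rat.isIntegralClosure_adjoin_singleton (K := L) hζ
  obtain ⟨y', rfl⟩ := (IsIntegralClosure.isIntegral_iff
    (A := Algebra.adjoin ℤ ({ζ} : Set L))).1 hy
  exact y'.2

lemma mem_etaSpan {q : ℕ} [NeZero q] (hq : 3 ≤ q) (x : 𝓞 (Kq q)) : x ∈ etaSpan q := by
  let L := CyclotomicField q ℚ
  have hcyc : IsCyclotomicExtension {q} ℚ L := CyclotomicField.isCyclotomicExtension q ℚ
  let f : L →ₐ[ℚ] ℂ := IsAlgClosed.lift
  set z : ℂ := ZMod.stdAddChar (1 : ZMod q) with hz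
  have hzp : IsPrimitiveRoot z q := isPrimitiveRoot_stdAddChar isUnit_one
  have hz0 : z ≠ 0 := hzp.ne_zero (NeZero.ne q)
  have h0 := (IsCyclotomicExtension.zeta_spec q ℚ L).map_of_injective (f := f) f.injective
  obtain ⟨i, -, hi⟩ := h0.eq_pow_of_pow_eq_one hzp.pow_eq_one
  set ζ : L := IsCyclotomicExtension.zeta q ℚ L ^ i with hζ
  have hfζ : f ζ = z := by rw [hζ, map_pow, hi]
  have hζp : IsPrimitiveRoot ζ q := by
    rw [← IsPrimitiveRoot.map_iff_of_injective (f := f) f.injective, hfζ]; exact hzp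
  have hη : z + z⁻¹ = ((dcos q 1 : ℝ) : ℂ) := by
    rw [dcos_ofReal, AddChar.map_neg_eq_inv]
  obtain ⟨y, hy⟩ : ∃ y : L, f y = (((x : Kq q) : ℝ) : ℂ) := by
    have hle : Kq q ≤ f.fieldRange.comap (Complex.ofRealAm.restrictScalars ℚ) := by
      rw [Kq, IntermediateField.adjoin_le_iff, Set.singleton_subset_iff]
      change ((2 * Real.cos (2 * Real.pi / q) : ℝ) : ℂ) ∈ f.fieldRange
      have := dcos_natCast (q := q) 1
      simp only [Nat.cast_one, mul_one] at this
      rw [← this, ← hη]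
      exact ⟨ζ + ζ⁻¹, by simp [hfζ]⟩
    exact hle (x : Kq q).2
  have hxint : IsIntegral ℤ (((x : Kq q) : ℝ) : ℂ) :=
    (RingOfIntegers.isIntegral_coe x).map ((algebraMap ℝ ℂ).comp (algebraMap (Kq q) ℝ)).toIntAlgHom
  have hyint : IsIntegral ℤ y := by
    have : IsIntegral ℤ (f y) := by rw [hy]; exact hxint
    exact (isIntegral_algHom_iff (f.restrictScalars ℤ) f.injective).1 this
  have hy' := mem_adjoin_of_isIntegral hζp hyint
  have key : ∃ u ∈ etaSpan q, ∃ v ∈ etaSpan q,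
      f y = (((u : Kq q) : ℝ) : ℂ) + (((v : Kq q) : ℝ) : ℂ) * z := by
    clear hy hyint
    induction hy' using Algebra.adjoin_induction with
    | mem t ht =>
      rw [Set.mem_singleton_iff] at ht
      exact ⟨0, zero_mem _, 1, one_mem_etaSpan, by simp [ht, hfζ]⟩
    | algebraMap n =>
      refine ⟨n • 1, zsmul_mem one_mem_etaSpan n, 0, zero_mem _, ?_⟩
      simp
    | add s t _ _ hs ht =>
      obtain ⟨u, hu, v, hv, h⟩ := hs
      obtain ⟨u', hu', v', hv', h'⟩ := ht
      refine ⟨u + u', add_mem hu hu', v + v', add_mem hv hv', ?_⟩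
      rw [map_add, h, h']; push_cast; ring
    | mul s t _ _ hs ht =>
      obtain ⟨u, hu, v, hv, h⟩ := hs
      obtain ⟨u', hu', v', hv', h'⟩ := ht
      refine ⟨u * u' - v * v', sub_mem (mul_mem_etaSpan hu hu') (mul_mem_etaSpan hv hv'),
        u * v' + u' * v + v * v' * eta q 1, add_mem (add_mem (mul_mem_etaSpan hu hv')
        (mul_mem_etaSpan hu' hv)) (mul_mem_etaSpan (mul_mem_etaSpan hv hv')
        (eta_mem_etaSpan 1)), ?_⟩
      rw [map_mul, h, h']; push_cast [coe_eta]
      rw [← hη]; field_simp; ring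
  obtain ⟨u, hu, v, hv, h⟩ := key
  rw [hy] at h
  have hv0 : ((v : Kq q) : ℝ) = 0 := by
    have := congrArg Complex.im h
    simp only [Complex.ofReal_im, Complex.add_im, Complex.im_ofReal_mul,
      zero_add] at this
    exact (mul_eq_zero.1 this.symm).resolve_right (stdAddChar_one_im_ne_zero hq)
  rw [hv0] at h
  have : x = u := ringOfIntegers_ext_real (by simpa using h)
  rwa [this]

lemma eta_induction {q : ℕ} [NeZero q] (hq : 3 ≤ q) {p : 𝓞 (Kq q) → Prop} (one : p 1)
    (eta : ∀ a, p (eta q a)) (add : ∀ x y, p x → p y → p (x + y)) (neg : ∀ x, p x → p (-x))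
    (x : 𝓞 (Kq q)) : p x := by
  have hx := mem_etaSpan hq x
  induction hx using AddSubgroup.closure_induction with
  | mem x hx =>
    rcases hx with rfl | ⟨a, rfl⟩
    · exact one
    · exact eta a
  | zero => simpa using add _ _ one (neg _ one)
  | add x y _ _ hx hy => exact add x y hx hy
  | neg x _ hx => exact neg x hx

/-- The embedding of `𝓞 (K_q)` sending `2 cos (2πa/q)` to `2 cos (2πsa/q)`. -/
noncomputable def emb {q : ℕ} [NeZero q] (s : (ZMod q)ˣ) : 𝓞 (Kq q) →+* ℝ :=
  (exists_Kq_hom s.isUnit).choose.comp (algebraMap (𝓞 (Kq q)) (Kq q))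

lemma emb_eta {q : ℕ} [NeZero q] (s : (ZMod q)ˣ) (a : ZMod q) :
    emb s (eta q a) = dcos q (s * a) :=
  (exists_Kq_hom s.isUnit).choose_spec a

lemma emb_injective {q : ℕ} [NeZero q] (s : (ZMod q)ˣ) : Function.Injective (emb s) :=
  (exists_Kq_hom s.isUnit).choose.injective.comp RingOfIntegers.coe_injective

lemma totallyPositive_iff {q : ℕ} [NeZero q] (hq : 3 ≤ q) (x : 𝓞 (Kq q)) :
    TotallyPositive (Kq q) x ↔ ∀ s : (ZMod q)ˣ, 0 < emb s x := by
  refine ⟨fun h s => h _, fun h σ => ?_⟩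
  obtain ⟨s, hs, hσ⟩ := Kq_hom_eq σ
  have : σ (x : Kq q) = emb hs.unit x := by
    refine eta_induction hq (p := fun x => σ (x : Kq q) = emb hs.unit x) ?_ ?_ ?_ ?_ x
    · simp
    · intro a; rw [emb_eta, hσ]; rfl
    · intro x y hx hy; simp only [map_add, hx, hy]
    · intro x hx; simp only [map_neg, hx]
  rw [this]; exact h _

instance {q : ℕ} [NeZero q] : NumberField (Kq q) where
  to_charZero := inferInstance
  to_finiteDimensional := by
    have h : IsIntegral ℚ (2 * Real.cos (2 * Real.pi / q)) := by
      have := (isIntegral_dcos (q := q) (1 : ℕ)).tower_top (A := ℚ)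
      rwa [dcos_natCast, Nat.cast_one, mul_one] at this
    exact IntermediateField.adjoin.finiteDimensional h

/-! ### Total positivity and universal ternary lattices -/

/-- Total positivity, expressed through `emb`. -/
def TP {q : ℕ} [NeZero q] (x : 𝓞 (Kq q)) : Prop := ∀ s : (ZMod q)ˣ, 0 < emb s x

/-- Being nonnegative under every embedding. -/
def NN {q : ℕ} [NeZero q] (x : 𝓞 (Kq q)) : Prop := ∀ s : (ZMod q)ˣ, 0 ≤ emb s x

section Positivity

variable {q : ℕ} [NeZero q] {x y z : 𝓞 (Kq q)}

lemma emb_eq_zero {s : (ZMod q)ˣ} : emb s x = 0 ↔ x = 0 :=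
  map_eq_zero_iff _ (emb_injective s)

lemma TP.nn (h : TP x) : NN x := fun s => (h s).le

lemma TP.ne_zero (h : TP x) : x ≠ 0 := by
  rintro rfl
  have := h 1
  simp at this

lemma NN.tp (h : NN x) (hx : x ≠ 0) : TP x := fun s =>
  lt_of_le_of_ne (h s) (fun h0 => hx (emb_eq_zero.1 h0.symm))

lemma tp_one : TP (1 : 𝓞 (Kq q)) := fun s => by simp

lemma nn_sq (x : 𝓞 (Kq q)) : NN (x ^ 2) := fun s => by rw [map_pow]; positivity

lemma tp_sq (h : x ≠ 0) : TP (x ^ 2) := (nn_sq x).tp (pow_ne_zero 2 h)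

lemma NN.add (hx : NN x) (hy : NN y) : NN (x + y) := fun s => by
  rw [map_add]; exact add_nonneg (hx s) (hy s)

lemma TP.add_nn (hx : TP x) (hy : NN y) : TP (x + y) := fun s => by
  rw [map_add]; exact add_pos_of_pos_of_nonneg (hx s) (hy s)

lemma NN.mul (hx : NN x) (hy : NN y) : NN (x * y) := fun s => by
  rw [map_mul]; exact mul_nonneg (hx s) (hy s)

lemma TP.mul (hx : TP x) (hy : TP y) : TP (x * y) := fun s => by
  rw [map_mul]; exact mul_pos (hx s) (hy s)

lemma NN.of_mul (hx : TP x) (h : NN (x * y)) : NN y := fun s => by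
  have := h s
  rw [map_mul] at this
  exact nonneg_of_mul_nonneg_right this (hx s)

lemma tp_ofNat (n : ℕ) [n.AtLeastTwo] : TP (ofNat(n) : 𝓞 (Kq q)) := fun s => by
  rw [map_ofNat]; exact Nat.ofNat_pos

lemma nn_two_sub_eta (a : ZMod q) : NN (2 - eta q a) := fun s => by
  rw [map_sub, map_ofNat, emb_eta]; linarith [(abs_le.1 (abs_dcos_le ((s : ZMod q) * a))).2]

lemma nn_two_add_eta (a : ZMod q) : NN (2 + eta q a) := fun s => by
  rw [map_add, map_ofNat, emb_eta]; linarith [(abs_le.1 (abs_dcos_le ((s : ZMod q) * a))).1]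

lemma tp_two_sub_eta {a : ZMod q} (ha : a ≠ 0) : TP (2 - eta q a) := by
  refine (nn_two_sub_eta a).tp fun h => ha ?_
  apply dcos_eq_two
  have := congrArg (fun x : 𝓞 (Kq q) => ((x : Kq q) : ℝ)) (sub_eq_zero.1 h)
  have h2 : (((2 : 𝓞 (Kq q)) : Kq q) : ℝ) = 2 := rfl
  simp only [coe_eta, h2] at this
  exact this.symm

end Positivity

/-- A universal totally positive definite symmetric bilinear form on `𝓞_K ^ 3`. -/
structure UnivTernary {q : ℕ} [NeZero q]
    (B : LinearMap.BilinForm (𝓞 (Kq q)) (Fin 3 → 𝓞 (Kq q))) : Prop where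
  symm : ∀ u v, B u v = B v u
  pos : ∀ v, v ≠ 0 → TP (B v v)
  univ : ∀ a, TP a → ∃ v, B v v = a

lemma exists_univTernary {q : ℕ} [NeZero q] (hq : 3 ≤ q) (h : ExistsUniversalTernary (Kq q)) :
    ∃ B : LinearMap.BilinForm (𝓞 (Kq q)) (Fin 3 → 𝓞 (Kq q)), UnivTernary B := by
  obtain ⟨M, hM, hpos, huniv⟩ := h
  have key : ∀ v, Matrix.toBilin' M v v = evalQF M v := fun v => by
    rw [Matrix.toBilin'_apply, evalQF]
  refine ⟨Matrix.toBilin' M, ⟨fun u v => ?_, fun v hv => ?_, fun a ha => ?_⟩⟩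
  · rw [Matrix.toBilin'_apply, Matrix.toBilin'_apply, Finset.sum_comm]
    refine Finset.sum_congr rfl fun i _ => Finset.sum_congr rfl fun j _ => ?_
    rw [hM.apply]; ring
  · rw [key]; exact (totallyPositive_iff hq _).1 (hpos v hv)
  · obtain ⟨v, hv⟩ := huniv a ((totallyPositive_iff hq _).2 ha)
    exact ⟨v, by rw [key, hv]⟩

lemma UnivTernary.exists_relation {q : ℕ} {B : LinearMap.BilinForm (𝓞 (Kq q)) (Fin 3 → 𝓞 (Kq q))}
    (v : Fin 4 → Fin 3 → 𝓞 (Kq q)) :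
    ∃ c : Fin 4 → 𝓞 (Kq q), c ≠ 0 ∧
      ∀ w, c 0 * B (v 0) w + c 1 * B (v 1) w + c 2 * B (v 2) w + c 3 * B (v 3) w = 0 := by
  have h : ¬ LinearIndependent (𝓞 (Kq q)) v := fun h => by
    have := h.fintype_card_le_finrank
    simp at this
  rw [Fintype.not_linearIndependent_iff] at h
  obtain ⟨c, hc, i, hi⟩ := h
  refine ⟨c, fun h0 => hi (by rw [h0]; rfl), fun w => ?_⟩
  have := congrArg (fun x => B x w) hc
  simpa [Fin.sum_univ_four, map_add, map_smul] using this

namespace UnivTernary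

variable {q : ℕ} [NeZero q] {B : LinearMap.BilinForm (𝓞 (Kq q)) (Fin 3 → 𝓞 (Kq q))}

lemma nn (hB : UnivTernary B) (v) : NN (B v v) := by
  by_cases hv : v = 0
  · subst hv; intro s; simp
  · exact (hB.pos v hv).nn

lemma eq_zero (hB : UnivTernary B) {v} (h : B v v = 0) : v = 0 := by
  by_contra hv
  exact (hB.pos v hv).ne_zero h

lemma self_ne_zero (hB : UnivTernary B) {v} (h : v ≠ 0) : B v v ≠ 0 := (hB.pos v h).ne_zero

lemma cauchySchwarz (hB : UnivTernary B) (u v) : NN (B u u * B v v - B u v ^ 2) := by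
  by_cases hu : u = 0
  · subst hu; intro s; simp
  · apply NN.of_mul (hB.pos u hu)
    have h := hB.nn (B u u • v - B u v • u)
    have e : B (B u u • v - B u v • u) (B u u • v - B u v • u) =
        B u u * (B u u * B v v - B u v ^ 2) := by
      simp only [map_sub, map_smul, LinearMap.sub_apply, LinearMap.smul_apply, smul_eq_mul,
        hB.symm v u]
      ring
    rwa [e] at h

/-- Splitting off a vector of norm one. -/
lemma split (hB : UnivTernary B) {e} (he : B e e = 1) (v) :
    ∃ w, B w e = 0 ∧ B v v = B v e ^ 2 + B w w := by
  refine ⟨v - B v e • e, ?_, ?_⟩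
  · simp [he]
  · simp only [map_sub, map_smul, LinearMap.sub_apply, LinearMap.smul_apply, smul_eq_mul,
        hB.symm e v, he]
    ring

lemma sq_eq_of_orthogonal (hB : UnivTernary B) {e v u u'} (he : e ≠ 0) (hv : v ≠ 0)
    (hev : B v e = 0) (hue : B u e = 0) (hue' : B u' e = 0) (huv : B u v = 0)
    (huv' : B u' v = 0) : B u u' ^ 2 = B u u * B u' u' := by
  obtain ⟨c, hc, h⟩ := exists_relation (B := B) ![e, v, u, u']
  simp only [Matrix.cons_val] at h
  have h0 : c 0 = 0 := by
    have := h e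
    rw [hev, hue, hue'] at this
    simpa [hB.self_ne_zero he] using this
  have h1 : c 1 = 0 := by
    have := h v
    rw [hB.symm e v, hev, huv, huv'] at this
    simpa [hB.self_ne_zero hv] using this
  have h2 := h u
  have h3 := h u'
  rw [h0, h1] at h2 h3
  rw [hB.symm u' u] at h2
  by_contra hne
  have hne' : B u u * B u' u' - B u u' ^ 2 ≠ 0 := fun h => hne (sub_eq_zero.1 h).symm
  have c2 : c 2 = 0 := by
    have : (B u u * B u' u' - B u u' ^ 2) * c 2 = 0 := by
      linear_combination B u' u' * h2 - B u u' * h3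
    exact (mul_eq_zero.1 this).resolve_left hne'
  have c3 : c 3 = 0 := by
    have : (B u u * B u' u' - B u u' ^ 2) * c 3 = 0 := by
      linear_combination B u u * h3 - B u u' * h2
    exact (mul_eq_zero.1 this).resolve_left hne'
  apply hc
  ext i
  fin_cases i <;> simp [h0, h1, c2, c3]

lemma expand_orthogonal (hB : UnivTernary B) {f g h} (hf : f ≠ 0) (hg : g ≠ 0) (hh : h ≠ 0)
    (hfg : B g f = 0) (hfh : B h f = 0) (hgh : B h g = 0) (y) :
    B f f * B g g * B h h * B y y = B y f ^ 2 * (B g g * B h h) + B y g ^ 2 * (B f f * B h h) +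
      B y h ^ 2 * (B f f * B g g) := by
  obtain ⟨c, hc, hr⟩ := exists_relation (B := B) ![f, g, h, y]
  simp only [Matrix.cons_val] at hr
  have h0 := hr f
  have h1 := hr g
  have h2 := hr h
  have h3 := hr y
  rw [hfg, hfh] at h0
  rw [hB.symm f g, hfg, hgh] at h1
  rw [hB.symm f h, hfh, hB.symm g h, hgh] at h2
  rw [hB.symm f y, hB.symm g y, hB.symm h y] at h3
  have c3 : c 3 ≠ 0 := by
    intro h3
    rw [h3] at h0 h1 h2
    apply hc
    have c0 : c 0 = 0 := by simpa [hB.self_ne_zero hf] using h0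
    have c1 : c 1 = 0 := by simpa [hB.self_ne_zero hg] using h1
    have c2 : c 2 = 0 := by simpa [hB.self_ne_zero hh] using h2
    ext i
    fin_cases i <;> simp [h3, c0, c1, c2]
  apply mul_left_cancel₀ c3
  linear_combination B f f * B g g * B h h * h3 - B y f * B g g * B h h * h0 -
    B y g * B f f * B h h * h1 - B y h * B f f * B g g * h2

lemma gram_eq_zero (hB : UnivTernary B) {e w v y} (he : e ≠ 0) (hw : B w e = 0) (hv : B v e = 0)
    (hy : B y e = 0) :
    B w w * (B v v * B y y - B v y ^ 2) - B w v * (B w v * B y y - B w y * B v y) +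
      B w y * (B w v * B v y - B v v * B w y) = 0 := by
  obtain ⟨c, hc, hr⟩ := exists_relation (B := B) ![e, w, v, y]
  simp only [Matrix.cons_val] at hr
  have c0 : c 0 = 0 := by
    have := hr e
    rw [hw, hv, hy] at this
    simpa [hB.self_ne_zero he] using this
  have h1 := hr w
  have h2 := hr v
  have h3 := hr y
  rw [c0, hB.symm v w, hB.symm y w] at h1
  rw [c0, hB.symm y v] at h2
  rw [c0] at h3
  by_contra hne
  apply hc
  have c1 : c 1 = 0 := by
    refine (mul_eq_zero.1 ?_).resolve_left hne
    linear_combination (B v v * B y y - B v y ^ 2) * h1 + (B w y * B v y - B w v * B y y) * h2 +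
      (B w v * B v y - B v v * B w y) * h3
  have c2 : c 2 = 0 := by
    refine (mul_eq_zero.1 ?_).resolve_left hne
    linear_combination (B w y * B v y - B w v * B y y) * h1 + (B w w * B y y - B w y ^ 2) * h2 +
      (B w y * B w v - B w w * B v y) * h3
  have c3 : c 3 = 0 := by
    refine (mul_eq_zero.1 ?_).resolve_left hne
    linear_combination (B w v * B v y - B v v * B w y) * h1 +
      (B w y * B w v - B w w * B v y) * h2 + (B w w * B v v - B w v ^ 2) * h3
  ext i
  fin_cases i <;> simp [c0, c1, c2, c3]

end UnivTernary

set_option linter.unusedSectionVars false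

/-! ### The case `q = 2 ^ k` with `k ≥ 4` -/

lemma dcos_le_of_val {q : ℕ} [NeZero q] {x : ZMod q} {j : ℕ} (h1 : j ≤ x.val)
    (h2 : x.val + j ≤ q) : dcos q x ≤ dcos q (j : ZMod q) := by
  have hq : (0 : ℝ) < q := by exact_mod_cast NeZero.pos q
  have hx := dcos_natCast (q := q) x.val
  rw [ZMod.natCast_zmod_val] at hx
  rw [hx, dcos_natCast]
  have hj : (j : ℝ) ≤ x.val := by exact_mod_cast h1
  have hxj : (x.val : ℝ) + j ≤ q := by exact_mod_cast h2
  have hj0 : (0 : ℝ) ≤ j := by positivity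
  have hpi := Real.pi_pos
  have e : ∀ t : ℝ, 2 * Real.pi * t / q = Real.pi * (2 * t / q) := fun t => by ring
  by_cases hh : 2 * (x.val : ℝ) ≤ q
  · have := Real.cos_le_cos_of_nonneg_of_le_pi (x := 2 * Real.pi * j / q)
      (y := 2 * Real.pi * x.val / q) (by positivity)
      (by rw [e]; nlinarith [(div_le_one hq).2 hh]) (by gcongr)
    linarith
  · have := Real.cos_le_cos_of_nonneg_of_le_pi (x := 2 * Real.pi * j / q)
      (y := 2 * Real.pi - 2 * Real.pi * x.val / q) (by positivity)
      (by
        rw [e]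
        have : 1 ≤ 2 * (x.val : ℝ) / q := by rw [le_div_iff₀ hq]; linarith
        nlinarith)
      (by
        rw [e, e]
        have h3 : 2 * (j : ℝ) / q + 2 * x.val / q ≤ 2 := by
          rw [← add_div, div_le_iff₀ hq]; linarith
        nlinarith)
    rw [Real.cos_two_pi_sub] at this
    linarith

lemma isUnit_iff_odd_val {q m : ℕ} [NeZero q] (hm : q = 2 ^ (m + 1)) (t : ZMod q) :
    IsUnit t ↔ Odd t.val := by
  have h := ZMod.isUnit_iff_coprime t.val q
  rw [ZMod.natCast_zmod_val] at h
  rw [h]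
  generalize t.val = v
  rw [hm, Nat.coprime_pow_right_iff (Nat.succ_pos m), Nat.coprime_two_right]

lemma dcos_add_half {q : ℕ} [NeZero q] {h : ZMod q} (h2 : 2 * h = 0) (h0 : h ≠ 0) (x : ZMod q) :
    dcos q (x + h) = - dcos q x := by
  have hh : dcos q h = -2 := by
    have h3 := dcos_mul h h
    rw [sub_self, ← two_mul, h2, dcos_zero] at h3
    have h4 : (dcos q h - 2) * (dcos q h + 2) = 0 := by linear_combination h3
    rcases mul_eq_zero.1 h4 with h5 | h5
    · exact absurd (dcos_eq_two (by linarith)) h0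
    · linarith
  have h1 := dcos_mul x h
  have e : x - h = x + h := by linear_combination -h2
  rw [e, hh] at h1
  linarith

lemma eta_add_half {q : ℕ} [NeZero q] {h : ZMod q} (h2 : 2 * h = 0) (h0 : h ≠ 0) (x : ZMod q) :
    eta q (x + h) = - eta q x :=
  ringOfIntegers_ext_real (by
    rw [coe_eta, dcos_add_half h2 h0]; rfl)

/-- Twice the sum of all embeddings, divided by `q`. -/
noncomputable def avg (q : ℕ) [NeZero q] : 𝓞 (Kq q) →+ ℝ where
  toFun x := 2 / q * ∑ s : (ZMod q)ˣ, emb s x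
  map_zero' := by simp
  map_add' x y := by simp only [map_add, Finset.sum_add_distrib, mul_add]

lemma avg_apply {q : ℕ} [NeZero q] (x : 𝓞 (Kq q)) :
    avg q x = 2 / q * ∑ s : (ZMod q)ˣ, emb s x := rfl

lemma avg_ofNat_mul {q : ℕ} [NeZero q] (n : ℕ) [n.AtLeastTwo] (x : 𝓞 (Kq q)) :
    avg q (ofNat(n) * x) = ofNat(n) * avg q x := by
  simp only [avg_apply, map_mul, map_ofNat, ← Finset.mul_sum]; ring

lemma NN.avg_nonneg {q : ℕ} [NeZero q] {x : 𝓞 (Kq q)} (h : NN x) : 0 ≤ avg q x := by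
  rw [avg_apply]
  have := Finset.sum_nonneg fun s (_ : s ∈ Finset.univ) => h s
  positivity

lemma TP.avg_pos {q : ℕ} [NeZero q] {x : 𝓞 (Kq q)} (h : TP x) : 0 < avg q x := by
  rw [avg_apply]
  have := Finset.sum_pos (fun s (_ : s ∈ Finset.univ) => h s) Finset.univ_nonempty
  have hq : (0 : ℝ) < q := by exact_mod_cast NeZero.pos q
  positivity

lemma NN.eq_zero_of_avg {q : ℕ} [NeZero q] {x : 𝓞 (Kq q)} (h : NN x) (h0 : avg q x = 0) :
    x = 0 := by
  by_contra hx
  exact (h.tp hx).avg_pos.ne' h0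

lemma avg_eta {q m : ℕ} [NeZero q] (hm : q = 2 ^ (m + 1)) {h : ZMod q} (h2 : 2 * h = 0)
    (h0 : h ≠ 0) (a : ZMod q) :
    avg q (eta q a) = (if a = 0 then 2 else 0) - (if a = h then 2 else 0) := by
  have key : ∀ t : ZMod q, (if IsUnit t then dcos q (t * a) else 0) =
      (dcos q (t * a) - dcos q (t * (a + h))) / 2 := by
    intro t
    split_ifs with ht
    · have : t * h = h := by
        rw [isUnit_iff_odd_val hm] at ht
        obtain ⟨k, hk⟩ := ht
        have e : t = 2 * k + 1 := by
          rw [← ZMod.natCast_zmod_val t, hk]; push_cast; rfl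
        rw [e]; linear_combination (k : ZMod q) * h2
      rw [mul_add, this, dcos_add_half h2 h0]; ring
    · have : t * h = 0 := by
        rw [isUnit_iff_odd_val hm, Nat.not_odd_iff_even] at ht
        obtain ⟨k, hk⟩ := ht
        have e : t = k + k := by
          rw [← ZMod.natCast_zmod_val t, hk]; push_cast; rfl
        rw [e]; linear_combination (k : ZMod q) * h2
      rw [mul_add, this, add_zero, sub_self, zero_div]
  have hsum : ∑ s : (ZMod q)ˣ, emb s (eta q a) = ∑ t, if IsUnit t then dcos q (t * a) else 0 := by
    simp only [emb_eta]
    rw [← Finset.sum_filter]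
    refine Finset.sum_bij (fun s _ => (s : ZMod q)) (by simp) (by simp [Units.ext_iff]) ?_ (by simp)
    intro b hb
    exact ⟨(Finset.mem_filter.1 hb).2.unit, Finset.mem_univ _, rfl⟩
  have hq : (q : ℝ) ≠ 0 := by exact_mod_cast NeZero.ne q
  rw [avg_apply, hsum]
  simp only [key]
  rw [← Finset.sum_div, Finset.sum_sub_distrib, sum_dcos, sum_dcos]
  have e : a + h = 0 ↔ a = h :=
    ⟨fun h' => by linear_combination h' - h2, fun h' => by linear_combination h' + h2⟩
  simp only [e]
  split_ifs <;> field_simp <;> ring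

/-- The data describing `q = 2 ^ k` with `k ≥ 4`. -/
structure TwoPow (q n : ℕ) : Prop where
  eq : q = 16 * n
  pow : ∃ m, q = 2 ^ (m + 1)

namespace TwoPow

variable {q n : ℕ} [NeZero q]

lemma three_le (hT : TwoPow q n) : 3 ≤ q := by
  have := hT.eq
  have := NeZero.pos q
  omega

lemma cast_ne (hT : TwoPow q n) {a b : ℕ} (ha : a < q) (hb : b < q) (hab : a ≠ b) :
    (a : ZMod q) ≠ b := by
  intro h
  have := (ZMod.natCast_eq_natCast_iff' a b q).1 h
  rw [Nat.mod_eq_of_lt ha, Nat.mod_eq_of_lt hb] at this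
  exact hab this

lemma sixteen (hT : TwoPow q n) : (16 * n : ZMod q) = 0 := by
  have := ZMod.natCast_self q
  rw [hT.eq] at this
  rw [hT.eq]
  exact_mod_cast this

lemma half_ne (hT : TwoPow q n) : (8 * n : ZMod q) ≠ 0 := by
  have := hT.eq
  have := NeZero.pos q
  have := hT.cast_ne (a := 8 * n) (b := 0) (by omega) (by omega) (by omega)
  exact_mod_cast this

lemma avg_eta (hT : TwoPow q n) (a : ZMod q) :
    avg q (eta q a) = (if a = 0 then 2 else 0) - (if a = 8 * n then 2 else 0) := by
  obtain ⟨m, hm⟩ := hT.pow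
  exact _root_.avg_eta hm (by linear_combination hT.sixteen) hT.half_ne a

lemma eta_add_half (hT : TwoPow q n) (x : ZMod q) : eta q (x + 8 * n) = - eta q x :=
  _root_.eta_add_half (by linear_combination hT.sixteen) hT.half_ne x

lemma avg_one (hT : TwoPow q n) : avg q 1 = 1 := by
  have h := hT.avg_eta 0
  rw [eta_zero, if_pos rfl, if_neg hT.half_ne.symm, ← mul_one (2 : 𝓞 (Kq q)),
    avg_ofNat_mul] at h
  linarith

/-- Reduction modulo two. -/
def parity (hT : TwoPow q n) : ZMod q →+* ZMod 2 :=
  ZMod.castHom (Dvd.intro (8 * n) (by rw [hT.eq]; ring)) (ZMod 2)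

lemma parity_two (hT : TwoPow q n) : hT.parity 2 = 0 := by
  rw [map_ofNat]; rfl

lemma avg_eta_odd (hT : TwoPow q n) {a : ZMod q} (ha : hT.parity a = 1) : avg q (eta q a) = 0 := by
  rw [hT.avg_eta, if_neg, if_neg, sub_zero]
  · rintro rfl
    have : hT.parity (8 * n) = 0 := by
      rw [show (8 * n : ZMod q) = 2 * (4 * n) by ring, map_mul, parity_two, zero_mul]
    rw [this] at ha
    exact absurd ha (by decide)
  · rintro rfl
    rw [map_zero] at ha
    exact absurd ha (by decide)

lemma avg_eta_int (hT : TwoPow q n) (a : ZMod q) : ∃ k : ℤ, avg q (eta q a) = 2 * k := by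
  rw [hT.avg_eta]
  refine ⟨(if a = 0 then 1 else 0) - (if a = 8 * n then 1 else 0), ?_⟩
  push_cast
  split_ifs <;> norm_num

lemma avg_int (hT : TwoPow q n) (x : 𝓞 (Kq q)) : ∃ k : ℤ, avg q x = k := by
  refine eta_induction hT.three_le (p := fun x => ∃ k : ℤ, avg q x = k) ?_ ?_ ?_ ?_ x
  · exact ⟨1, by rw [hT.avg_one]; norm_num⟩
  · intro a
    obtain ⟨k, hk⟩ := hT.avg_eta_int a
    exact ⟨2 * k, by rw [hk]; push_cast; ring⟩
  · rintro x y ⟨k, hk⟩ ⟨l, hl⟩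
    exact ⟨k + l, by rw [map_add, hk, hl]; push_cast; ring⟩
  · rintro x ⟨k, hk⟩
    exact ⟨-k, by rw [map_neg, hk]; push_cast; ring⟩

lemma avg_mul_eta_int (hT : TwoPow q n) (x : 𝓞 (Kq q)) (i : ZMod q) :
    ∃ k : ℤ, avg q (x * eta q i) = 2 * k := by
  refine eta_induction hT.three_le (p := fun x => ∃ k : ℤ, avg q (x * eta q i) = 2 * k)
    ?_ ?_ ?_ ?_ x
  · rw [one_mul]; exact hT.avg_eta_int i
  · intro a
    obtain ⟨k, hk⟩ := hT.avg_eta_int (a + i)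
    obtain ⟨l, hl⟩ := hT.avg_eta_int (a - i)
    exact ⟨k + l, by rw [eta_mul, map_add, hk, hl]; push_cast; ring⟩
  · rintro x y ⟨k, hk⟩ ⟨l, hl⟩
    exact ⟨k + l, by rw [add_mul, map_add, hk, hl]; push_cast; ring⟩
  · rintro x ⟨k, hk⟩
    exact ⟨-k, by rw [neg_mul, map_neg, hk]; push_cast; ring⟩

lemma avg_sq_mul_eta (hT : TwoPow q n) (x : 𝓞 (Kq q)) {i : ZMod q} (hi : hT.parity i = 1) :
    ∃ k : ℤ, avg q (x ^ 2 * eta q i) = 4 * k := by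
  refine eta_induction hT.three_le (p := fun x => ∃ k : ℤ, avg q (x ^ 2 * eta q i) = 4 * k)
    ?_ ?_ ?_ ?_ x
  · exact ⟨0, by rw [one_pow, one_mul, hT.avg_eta_odd hi]; norm_num⟩
  · intro a
    refine ⟨0, ?_⟩
    rw [eta_sq, add_mul, eta_mul, map_add, map_add, avg_ofNat_mul, hT.avg_eta_odd hi,
      hT.avg_eta_odd, hT.avg_eta_odd]
    · norm_num
    · rw [map_sub, map_mul, parity_two, hi, zero_mul]; rfl
    · rw [map_add, map_mul, parity_two, hi, zero_mul]; rfl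
  · rintro x y ⟨k, hk⟩ ⟨l, hl⟩
    obtain ⟨j, hj⟩ := hT.avg_mul_eta_int (x * y) i
    refine ⟨k + l + j, ?_⟩
    rw [show (x + y) ^ 2 * eta q i = x ^ 2 * eta q i + y ^ 2 * eta q i + 2 * (x * y * eta q i) by
      ring, map_add, map_add, avg_ofNat_mul, hk, hl, hj]
    push_cast; ring
  · rintro x ⟨k, hk⟩
    exact ⟨k, by rw [neg_sq, hk]⟩

lemma avg_nn_cases (hT : TwoPow q n) {x : 𝓞 (Kq q)} (h : NN x) : ∃ k : ℕ, avg q x = k := by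
  obtain ⟨k, hk⟩ := hT.avg_int x
  have := h.avg_nonneg
  rw [hk] at this
  have h0 : 0 ≤ k := by exact_mod_cast this
  lift k to ℕ using h0
  exact ⟨k, by rw [hk]; norm_num⟩

lemma eq_zero_of_avg_mul (hT : TwoPow q n) {x : 𝓞 (Kq q)} (h1 : avg q x = 0)
    (h : ∀ i, avg q (x * eta q i) = 0) : x = 0 := by
  have key : ∀ y, avg q (x * y) = 0 := by
    intro y
    refine eta_induction hT.three_le (p := fun y => avg q (x * y) = 0) ?_ h ?_ ?_ y
    · rw [mul_one, h1]
    · intro y z hy hz; rw [mul_add, map_add, hy, hz, add_zero]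
    · intro y hy; rw [mul_neg, map_neg, hy, neg_zero]
  have h2 := (nn_sq x).eq_zero_of_avg (by rw [sq, key])
  exact pow_eq_zero_iff two_ne_zero |>.1 h2

lemma eta_half (hT : TwoPow q n) : eta q (8 * n) = -2 := by
  have := hT.eta_add_half 0
  rwa [zero_add, eta_zero] at this

lemma eq_one_of_avg (hT : TwoPow q n) {x : 𝓞 (Kq q)} (hx : NN x) (h1 : avg q x = 1) : x = 1 := by
  rw [← sub_eq_zero]
  apply hT.eq_zero_of_avg_mul
  · rw [map_sub, h1, hT.avg_one, sub_self]
  · intro i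
    rw [sub_mul, one_mul, map_sub, hT.avg_eta]
    by_cases h0 : i = 0
    · subst h0
      rw [if_pos rfl, if_neg hT.half_ne.symm, eta_zero, mul_comm, avg_ofNat_mul, h1]; norm_num
    by_cases hh : i = 8 * n
    · subst hh
      rw [if_neg h0, if_pos rfl, hT.eta_half, mul_neg, map_neg, mul_comm, avg_ofNat_mul, h1]
      norm_num
    rw [if_neg h0, if_neg hh]
    have hxt : TP x := hx.tp (by rintro rfl; rw [map_zero] at h1; norm_num at h1)
    have ha := (hxt.mul (tp_two_sub_eta h0)).avg_pos
    have hb := (hxt.mul (tp_two_sub_eta (a := i + 8 * (n : ZMod q))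
      (fun h' => hh (by linear_combination h' - hT.sixteen)))).avg_pos
    rw [hT.eta_add_half, show x * (2 - - eta q i) = 2 * x + x * eta q i by ring, map_add,
      avg_ofNat_mul, h1] at hb
    rw [show x * (2 - eta q i) = 2 * x - x * eta q i by ring, map_sub, avg_ofNat_mul, h1] at ha
    obtain ⟨k, hk⟩ := hT.avg_mul_eta_int x i
    rw [hk] at ha hb ⊢
    have h3 : k < 1 := by
      have : (k : ℝ) < 1 := by linarith
      exact_mod_cast this
    have h4 : -1 < k := by
      have : (-1 : ℝ) < k := by linarith
      exact_mod_cast this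
    have : k = 0 := by omega
    rw [this]; norm_num

lemma avg_eq_zero_of_avg_sq_eq_two (hT : TwoPow q n) {b : 𝓞 (Kq q)} (h2 : avg q (b ^ 2) = 2) :
    avg q b = 0 := by
  have aux : ∀ c : 𝓞 (Kq q), avg q (c ^ 2) = 2 → avg q c ≠ 1 := by
    intro c hc h1
    have h3 := hT.eq_one_of_avg (nn_sq (c - 1)) (by
      rw [show (c - 1) ^ 2 = c ^ 2 - 2 * c + 1 by ring, map_add, map_sub, avg_ofNat_mul, hc, h1,
        hT.avg_one]; norm_num)
    rcases mul_eq_zero.1 (show c * (c - 2) = 0 by linear_combination h3) with h | h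
    · rw [h, map_zero] at h1; norm_num at h1
    · rw [sub_eq_zero.1 h, ← mul_one (2 : 𝓞 (Kq q)), avg_ofNat_mul, hT.avg_one] at h1
      norm_num at h1
  have bound : ∀ c : 𝓞 (Kq q), avg q (c ^ 2) = 2 → 2 * avg q c ≤ 3 := by
    intro c hc
    have := (nn_sq (c - 1)).avg_nonneg
    rw [show (c - 1) ^ 2 = c ^ 2 - 2 * c + 1 by ring, map_add, map_sub, avg_ofNat_mul, hc,
        hT.avg_one] at this
    linarith
  have h2' : avg q ((-b) ^ 2) = 2 := by rw [neg_sq, h2]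
  have b1 := bound b h2
  have b2 := bound (-b) h2'
  have a1 := aux b h2
  have a2 := aux (-b) h2'
  rw [map_neg] at b2 a2
  obtain ⟨k, hk⟩ := hT.avg_int b
  rw [hk] at b1 b2 a1 a2 ⊢
  have c1 : 2 * k ≤ 3 := by exact_mod_cast b1
  have c2 : 2 * (-k) ≤ 3 := by exact_mod_cast b2
  have c3 : k ≠ 1 := by exact_mod_cast a1
  have c4 : -k ≠ 1 := by exact_mod_cast a2
  have : k = 0 := by omega
  rw [this]; norm_num

lemma sq_eq_of_avg_sq_eq_two (hT : TwoPow q n) {b : 𝓞 (Kq q)} (h2 : avg q (b ^ 2) = 2) :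
    ∃ i, b ^ 2 = eta q i ^ 2 := by
  have hb0 : b ≠ 0 := by
    rintro rfl
    rw [zero_pow two_ne_zero, map_zero] at h2; norm_num at h2
  have key : ∃ i, avg q (b * eta q i) ≠ 0 := by
    by_contra! hall
    exact hb0 (hT.eq_zero_of_avg_mul (by
      have := hall 0
      rw [eta_zero, mul_comm, avg_ofNat_mul] at this
      linarith) hall)
  obtain ⟨i, hi⟩ := key
  obtain ⟨k, hk⟩ := hT.avg_mul_eta_int b i
  have hk0 : k ≠ 0 := by rintro rfl; rw [hk] at hi; norm_num at hi
  have hk1 : (1 : ℝ) ≤ k ^ 2 := by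
    have : 1 ≤ k ^ 2 := by have := pow_pos (abs_pos.2 hk0) 2; rw [sq_abs] at this; omega
    exact_mod_cast this
  have main : ∀ j : ZMod q, j ≠ 0 → j ≠ 8 * n → ∀ l : ℤ, avg q (b * eta q j) = 2 * l →
      (l : ℝ) ^ 2 ≥ 1 → b ^ 2 = eta q j ^ 2 := by
    intro j hj0 hjh l hl hl1
    have hsq : avg q (eta q j ^ 2) ≤ 2 := by
      have h2j : 2 * j ≠ 0 := by
        intro h
        have h4 := eta_sq j
        rw [h, eta_zero] at h4
        rcases mul_eq_zero.1 (show (2 - eta q j) * (2 - - eta q j) = 0 by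
          linear_combination -h4) with h5 | h5
        · exact (tp_two_sub_eta hj0).ne_zero h5
        · rw [← hT.eta_add_half] at h5
          exact (tp_two_sub_eta (fun h' => hjh (by linear_combination h' - hT.sixteen))).ne_zero h5
      rw [eta_sq, map_add, hT.avg_eta, if_neg h2j, ← mul_one (2 : 𝓞 (Kq q)), avg_ofNat_mul,
        hT.avg_one]
      split_ifs <;> norm_num
    rcases le_or_gt 0 l with h | h
    · have h3 : b - eta q j = 0 := by
        refine pow_eq_zero_iff two_ne_zero |>.1 ((nn_sq _).eq_zero_of_avg (le_antisymm ?_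
          (nn_sq _).avg_nonneg))
        have : (1 : ℝ) ≤ l := by
          have : (0 : ℝ) ≤ l := by exact_mod_cast h
          nlinarith
        rw [show (b - eta q j) ^ 2 = b ^ 2 - 2 * (b * eta q j) + eta q j ^ 2 by ring, map_add,
          map_sub, avg_ofNat_mul, h2, hl]
        linarith
      rw [sub_eq_zero.1 h3]
    · have h3 : b + eta q j = 0 := by
        refine pow_eq_zero_iff two_ne_zero |>.1 ((nn_sq _).eq_zero_of_avg (le_antisymm ?_
          (nn_sq _).avg_nonneg))
        have : (l : ℝ) ≤ -1 := by
          have : (l : ℝ) < 0 := by exact_mod_cast h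
          nlinarith
        rw [show (b + eta q j) ^ 2 = b ^ 2 + 2 * (b * eta q j) + eta q j ^ 2 by ring, map_add,
          map_add, avg_ofNat_mul, h2, hl]
        linarith
      rw [eq_neg_of_add_eq_zero_left h3, neg_sq]
  have hb : avg q b = 0 := hT.avg_eq_zero_of_avg_sq_eq_two h2
  refine ⟨i, main i ?_ ?_ k hk hk1⟩
  · rintro rfl
    rw [eta_zero, mul_comm, avg_ofNat_mul, hb, mul_zero] at hi
    exact hi rfl
  · rintro rfl
    rw [hT.eta_half, mul_neg, map_neg, mul_comm, avg_ofNat_mul, hb, mul_zero, neg_zero] at hi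
    exact hi rfl

end TwoPow

namespace TwoPow

variable {q n : ℕ} [NeZero q]

lemma n_pos (hT : TwoPow q n) : 0 < n := by
  have := hT.eq
  have := NeZero.pos q
  omega

lemma avg_eta_natCast (hT : TwoPow q n) {a : ℕ} (h0 : 0 < a) (ha : a < q) (hne : a ≠ 8 * n) :
    avg q (eta q (a : ZMod q)) = 0 := by
  have hq := hT.eq
  have hn := hT.n_pos
  have h1 := hT.cast_ne (a := a) (b := 0) ha (by omega) (by omega)
  have h2 := hT.cast_ne (a := a) (b := 8 * n) ha (by omega) hne
  push_cast at h1 h2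
  rw [hT.avg_eta, if_neg h1, if_neg h2, sub_zero]

lemma parity_index (hT : TwoPow q n) {c : ZMod q} (hc : c = 4 * n - 1 ∨ c = 4 * n + 1) :
    hT.parity c = 1 := by
  have : hT.parity (4 * n) = 0 := by
    rw [show (4 * n : ZMod q) = 2 * (2 * n) by ring, map_mul, parity_two, zero_mul]
  rcases hc with rfl | rfl
  · rw [map_sub, this, map_one]; decide
  · rw [map_add, this, map_one]; decide

lemma sq_add_sq (hT : TwoPow q n) {c : ZMod q} (hc : c = 4 * n - 1 ∨ c = 4 * n + 1) :
    eta q 1 ^ 2 + eta q c ^ 2 = 4 := by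
  have h : eta q (2 * c) = - eta q (2 * 1) := by
    rcases hc with rfl | rfl
    · rw [← hT.eta_add_half, ← eta_neg]; congr 1; linear_combination -hT.sixteen
    · rw [← hT.eta_add_half]; congr 1; ring
  rw [eta_sq, eta_sq, h]; ring

lemma avg_eta_one (hT : TwoPow q n) : avg q (eta q 1) = 0 := hT.avg_eta_odd (map_one _)

lemma avg_eta_one_sq (hT : TwoPow q n) : avg q (eta q 1 ^ 2) = 2 := by
  have hq := hT.eq
  have hn := hT.n_pos
  have := hT.avg_eta_natCast (a := 2) (by norm_num) (by omega) (by omega)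
  rw [Nat.cast_ofNat] at this
  rw [eta_sq, mul_one, map_add, this, ← mul_one (2 : 𝓞 (Kq q)), avg_ofNat_mul, hT.avg_one]
  norm_num

lemma avg_eta_one_cube (hT : TwoPow q n) : avg q (eta q 1 ^ 3) = 0 := by
  rw [pow_succ, eta_sq, add_mul, eta_mul, map_add, map_add, avg_ofNat_mul, hT.avg_eta_one,
    hT.avg_eta_odd, hT.avg_eta_odd]
  · norm_num
  · rw [map_sub, map_mul, parity_two, zero_mul, map_one]; decide
  · rw [map_add, map_mul, parity_two, zero_mul, map_one]; decide

lemma avg_sq_mul_index (hT : TwoPow q n) {c : ZMod q} (hc : c = 4 * n - 1 ∨ c = 4 * n + 1) :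
    avg q (eta q 1 ^ 2 * eta q c) = 0 := by
  have hp := hT.parity_index hc
  rw [eta_sq, add_mul, eta_mul, map_add, map_add, avg_ofNat_mul, hT.avg_eta_odd hp,
    hT.avg_eta_odd, hT.avg_eta_odd]
  · norm_num
  · rw [map_sub, map_mul, parity_two, zero_mul, hp]; decide
  · rw [map_add, map_mul, parity_two, zero_mul, hp]; decide

lemma avg_mul_index (hT : TwoPow q n) {c : ZMod q} (hc : c = 4 * n - 1 ∨ c = 4 * n + 1) :
    avg q (eta q 1 * eta q c) = 0 := by
  have hq := hT.eq
  have hn := hT.n_pos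
  have h0 := hT.avg_eta_natCast (a := 4 * n) (by omega) (by omega) (by omega)
  have h1 := hT.avg_eta_natCast (a := 4 * n + 2) (by omega) (by omega) (by omega)
  have h2 := hT.avg_eta_natCast (a := 4 * n - 2) (by omega) (by omega) (by omega)
  rw [Nat.cast_sub (by omega)] at h2
  push_cast at h0 h1 h2
  rw [mul_comm, eta_mul, map_add]
  rcases hc with rfl | rfl
  · rw [show (4 * n - 1 + 1 : ZMod q) = 4 * n by ring,
      show (4 * n - 1 - 1 : ZMod q) = 4 * n - 2 by ring, h0, h2, add_zero]
  · rw [show (4 * n + 1 + 1 : ZMod q) = 4 * n + 2 by ring,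
      show (4 * n + 1 - 1 : ZMod q) = 4 * n by ring, h0, h1, add_zero]

lemma avg_ofNat (hT : TwoPow q n) (k : ℕ) [k.AtLeastTwo] :
    avg q (ofNat(k) : 𝓞 (Kq q)) = ofNat(k) := by
  rw [← mul_one (ofNat(k) : 𝓞 (Kq q)), avg_ofNat_mul, hT.avg_one, mul_one]

lemma index_ne_zero (hT : TwoPow q n) {c : ZMod q} (hc : hT.parity c = 1) : c ≠ 0 := by
  rintro rfl
  rw [map_zero] at hc
  exact absurd hc (by decide)

lemma tp_beta (hT : TwoPow q n) {c : ZMod q} (hc : c = 4 * n - 1 ∨ c = 4 * n + 1) :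
    TP (3 + eta q 1 + eta q c) := by
  intro s
  have h := congrArg (emb s) (hT.sq_add_sq hc)
  simp only [map_add, map_pow, map_ofNat] at h ⊢
  nlinarith [sq_nonneg (emb s (eta q 1) - emb s (eta q c)),
    sq_nonneg (emb s (eta q 1) + emb s (eta q c) + 3)]

lemma not_nn_beta_sub_one (hT : TwoPow q n) {c : ZMod q} (hc : c = 4 * n - 1 ∨ c = 4 * n + 1) :
    ¬ NN (3 + eta q 1 + eta q c - 1) := by
  intro h
  have hp := hT.parity_index hc
  have t1 := tp_two_sub_eta (hT.index_ne_zero (map_one hT.parity))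
  have t2 := tp_two_sub_eta (hT.index_ne_zero hp)
  have hab := hT.sq_add_sq hc
  have h3 := (h.mul (t1.mul t2).nn).eq_zero_of_avg (by
    rw [show (3 + eta q 1 + eta q c - 1) * ((2 - eta q 1) * (2 - eta q c)) =
      eta q 1 ^ 2 * eta q c + 4 * eta q 1 - eta q 1 ^ 3 - 2 * (eta q 1 * eta q c) by
        linear_combination (eta q 1 - 2) * hab]
    rw [map_sub, map_sub, map_add, avg_ofNat_mul, avg_ofNat_mul, hT.avg_eta_one,
      hT.avg_sq_mul_index hc, hT.avg_mul_index hc, hT.avg_eta_one_cube]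
    norm_num)
  rcases mul_eq_zero.1 h3 with h4 | h4
  · have := congrArg (avg q) h4
    rw [map_sub, map_add, map_add, hT.avg_ofNat, hT.avg_eta_one, hT.avg_eta_odd hp, hT.avg_one,
      map_zero] at this
    norm_num at this
  · exact (t1.mul t2).ne_zero h4

lemma index_place (hT : TwoPow q n) : 1.845 ≤ dcos q 1 := by
  have h := dcos_natCast (q := q) 1
  rw [Nat.cast_one, Nat.cast_one, mul_one] at h
  have hq : (16 : ℝ) ≤ q := by
    have := hT.eq
    have := hT.n_pos
    exact_mod_cast (by omega : 16 ≤ q)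
  have h1 := Real.one_sub_sq_div_two_le_cos (x := 2 * Real.pi / q)
  have h2 : 2 * Real.pi / q ≤ 0.39275 := by
    rw [div_le_iff₀ (by linarith)]
    nlinarith [Real.pi_lt_d4]
  have h3 : 0 ≤ 2 * Real.pi / q := by positivity
  rw [h]; nlinarith

/-- The value of `(2 - η₁)(3 + η₁ + η_c)` at the identity embedding is small. -/
lemma emb_one_bounds (hT : TwoPow q n) {c : ZMod q} (hc : c = 4 * n - 1 ∨ c = 4 * n + 1) :
    1.845 ≤ emb 1 (eta q 1) ∧ emb 1 (eta q 1) < 2 ∧ emb 1 (eta q c) ≤ 0.79 := by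
  have h1 : 1.845 ≤ emb 1 (eta q 1) := by
    rw [emb_eta, Units.val_one, one_mul]; exact hT.index_place
  have t1 := tp_two_sub_eta (hT.index_ne_zero (map_one hT.parity)) 1
  rw [map_sub, map_ofNat] at t1
  refine ⟨h1, by linarith, ?_⟩
  have h := congrArg (emb 1) (hT.sq_add_sq hc)
  simp only [map_add, map_pow, map_ofNat] at h
  nlinarith

lemma not_nn_alpha_beta_sub_one (hT : TwoPow q n) {c : ZMod q}
    (hc : c = 4 * n - 1 ∨ c = 4 * n + 1) :
    ¬ NN ((2 - eta q 1) * (3 + eta q 1 + eta q c) - 1) := by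
  intro h
  have := h 1
  obtain ⟨h1, h2, h3⟩ := hT.emb_one_bounds hc
  simp only [map_sub, map_mul, map_add, map_ofNat, map_one] at this
  nlinarith

lemma not_nn_alpha_beta_sub_sq (hT : TwoPow q n) {c : ZMod q}
    (hc : c = 4 * n - 1 ∨ c = 4 * n + 1) {i : ZMod q} (hi : eta q i ≠ 0) :
    ¬ NN ((2 - eta q 1) * (3 + eta q 1 + eta q c) - eta q i ^ 2) := by
  intro h
  have hq := hT.eq
  have hn := hT.n_pos
  have hab := hT.sq_add_sq hc
  have hp := hT.parity_index hc
  have t1 := tp_two_sub_eta (hT.index_ne_zero (map_one hT.parity))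
  set x : ZMod q := 2 * i + 8 * n with hx
  have hsq : eta q i ^ 2 = 2 - eta q x := by
    rw [eta_sq, hT.eta_add_half]; ring
  have hx0 : x ≠ 0 := by
    intro h0
    rw [h0, eta_zero, sub_self] at hsq
    exact hi (pow_eq_zero_iff two_ne_zero |>.1 hsq)
  have h2x : eta q x ≠ eta q 2 := by
    intro h2
    rw [h2] at hsq
    have h1 := eta_sq (1 : ZMod q)
    rw [mul_one] at h1
    have h4 : NN (1 + eta q c) := by
      apply NN.of_mul t1
      rw [show (2 - eta q 1) * (1 + eta q c) = (2 - eta q 1) * (3 + eta q 1 + eta q c) -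
        eta q i ^ 2 by linear_combination h1 + hsq]
      exact h
    have t2 := tp_two_sub_eta (hT.index_ne_zero hp)
    have h5 := (h4.mul t2.nn).eq_zero_of_avg (by
      rw [show (1 + eta q c) * (2 - eta q c) = eta q c + eta q 1 ^ 2 - 2 by
        linear_combination -hab]
      rw [map_sub, map_add, hT.avg_eta_one_sq, hT.avg_eta_odd hp, hT.avg_ofNat]
      norm_num)
    have h6 := (mul_eq_zero.1 h5).resolve_right t2.ne_zero
    have h7 := congrArg (avg q) h6
    rw [map_add, hT.avg_one, hT.avg_eta_odd hp, map_zero] at h7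
    norm_num at h7
  have heven : x.val % 2 = 0 := by
    have : hT.parity x = 0 := by
      rw [show x = 2 * (i + 4 * n) by rw [hx]; ring, map_mul, parity_two, zero_mul]
    rw [← ZMod.natCast_zmod_val x, map_natCast] at this
    have := (ZMod.natCast_eq_zero_iff _ _).1 this
    omega
  have hv0 : x.val ≠ 0 := by rwa [Ne, ZMod.val_eq_zero]
  have hlt := ZMod.val_lt x
  have hv2 : x.val ≠ 2 := by
    intro hv
    apply h2x
    rw [← ZMod.natCast_zmod_val x, hv, Nat.cast_ofNat]
  have hvm2 : x.val ≠ q - 2 := by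
    intro hv
    apply h2x
    rw [← ZMod.natCast_zmod_val x, hv, Nat.cast_sub (by omega), ZMod.natCast_self, zero_sub,
      eta_neg, Nat.cast_ofNat]
  have hle := dcos_le_of_val (x := x) (j := 4) (by omega) (by omega)
  have h1 := h 1
  obtain ⟨b1, b2, b3⟩ := hT.emb_one_bounds hc
  have e2 := congrArg (emb 1) (eta_sq (1 : ZMod q))
  have e4 := congrArg (emb 1) (eta_sq (2 : ZMod q))
  rw [hsq] at h1
  have ex : emb 1 (eta q x) ≤ emb 1 (eta q 4) := by
    rw [emb_eta, emb_eta, Units.val_one, one_mul, one_mul]; exact_mod_cast hle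
  rw [show (2 * 2 : ZMod q) = 4 by norm_num] at e4
  simp only [map_sub, map_mul, map_add, map_ofNat, map_pow, mul_one] at h1 e2 e4
  set u := emb 1 (eta q 1)
  have e : emb 1 (eta q 4) = (u ^ 2 - 2) ^ 2 - 2 := by
    have : emb 1 (eta q 2) = u ^ 2 - 2 := by linarith
    rw [this] at e4; linarith
  have h5 : (2 - u) * ((2 + u) * u ^ 2) ≤ (2 - u) * (3 + u + emb 1 (eta q c)) := by
    nlinarith
  have h6 := le_of_mul_le_mul_left h5 (by linarith)
  nlinarith

end TwoPow

namespace TwoPow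

variable {q n : ℕ} [NeZero q]
  {B : LinearMap.BilinForm (𝓞 (Kq q)) (Fin 3 → 𝓞 (Kq q))}

lemma four_dvd_ne (hT : TwoPow q n) {x y : 𝓞 (Kq q)} (h : x = y ^ 2) {j : ℤ}
    (hj : avg q (x * eta q 1) = j) : 4 ∣ j := by
  obtain ⟨k, hk⟩ := hT.avg_sq_mul_eta y (map_one hT.parity)
  rw [← h, hj] at hk
  exact ⟨k, by exact_mod_cast hk⟩

lemma exists_alpha (hT : TwoPow q n) (hB : UnivTernary B) {e} (he : B e e = 1) :
    ∃ v, B v e = 0 ∧ B v v = 2 - eta q 1 := by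
  have hT1 := hT.index_ne_zero (map_one hT.parity)
  obtain ⟨v, hv⟩ := hB.univ _ (tp_two_sub_eta hT1)
  obtain ⟨w, hwe, hvw⟩ := hB.split he v
  rw [hv] at hvw
  set x := B v e
  refine ⟨w, hwe, ?_⟩
  have hx2 := hT.avg_nn_cases (nn_sq x)
  obtain ⟨k, hk⟩ := hx2
  obtain ⟨l, hl⟩ := hT.avg_nn_cases (hB.nn w)
  have hsum := congrArg (avg q) hvw
  rw [map_add, map_sub, hT.avg_ofNat, hT.avg_eta_one, hk, hl] at hsum
  have hkl : k + l = 2 := by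
    have : ((k + l : ℕ) : ℝ) = 2 := by push_cast; linarith
    exact_mod_cast this
  by_cases hk0 : k = 0
  · have := (nn_sq x).eq_zero_of_avg (by rw [hk, hk0, Nat.cast_zero])
    rw [this, zero_add] at hvw
    exact hvw.symm
  exfalso
  by_cases hl0 : l = 0
  · have := (hB.nn w).eq_zero_of_avg (by rw [hl, hl0, Nat.cast_zero])
    rw [this, add_zero] at hvw
    have := hT.four_dvd_ne (j := -2) hvw (by
      rw [show (2 - eta q 1) * eta q 1 = 2 * eta q 1 - eta q 1 ^ 2 by ring, map_sub,
        avg_ofNat_mul, hT.avg_eta_one, hT.avg_eta_one_sq]; norm_num)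
    omega
  have hk1 : k = 1 := by omega
  have hl1 : l = 1 := by omega
  have e1 := hT.eq_one_of_avg (nn_sq x) (by rw [hk, hk1, Nat.cast_one])
  have e2 := hT.eq_one_of_avg (hB.nn w) (by rw [hl, hl1, Nat.cast_one])
  rw [e1, e2] at hvw
  have h0 : eta q 1 = 0 := by linear_combination -hvw
  have := hT.avg_eta_one_sq
  rw [h0, zero_pow two_ne_zero, map_zero] at this
  norm_num at this

lemma avg_beta (hT : TwoPow q n) {c : ZMod q} (hc : c = 4 * n - 1 ∨ c = 4 * n + 1) :
    avg q (3 + eta q 1 + eta q c) = 3 := by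
  rw [map_add, map_add, hT.avg_ofNat, hT.avg_eta_one, hT.avg_eta_odd (hT.parity_index hc)]
  norm_num

lemma exists_beta (hT : TwoPow q n) (hB : UnivTernary B) {e} (he : B e e = 1)
    {c : ZMod q} (hc : c = 4 * n - 1 ∨ c = 4 * n + 1) :
    ∃ v, B v e = 0 ∧ B v v = 3 + eta q 1 + eta q c := by
  obtain ⟨v, hv⟩ := hB.univ _ (hT.tp_beta hc)
  obtain ⟨w, hwe, hvw⟩ := hB.split he v
  rw [hv] at hvw
  set x := B v e
  refine ⟨w, hwe, ?_⟩
  obtain ⟨k, hk⟩ := hT.avg_nn_cases (nn_sq x)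
  obtain ⟨l, hl⟩ := hT.avg_nn_cases (hB.nn w)
  have hsum := congrArg (avg q) hvw
  rw [hT.avg_beta hc, map_add, hk, hl] at hsum
  have hkl : k + l = 3 := by
    have : ((k + l : ℕ) : ℝ) = 3 := by push_cast; linarith
    exact_mod_cast this
  by_cases hk0 : k = 0
  · have := (nn_sq x).eq_zero_of_avg (by rw [hk, hk0, Nat.cast_zero])
    rw [this, zero_add] at hvw
    exact hvw.symm
  exfalso
  by_cases hl0 : l = 0
  · have := (hB.nn w).eq_zero_of_avg (by rw [hl, hl0, Nat.cast_zero])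
    rw [this, add_zero] at hvw
    have := hT.four_dvd_ne (j := 2) hvw (by
      rw [show (3 + eta q 1 + eta q c) * eta q 1 = 3 * eta q 1 + eta q 1 ^ 2 + eta q 1 * eta q c
        by ring, map_add, map_add, avg_ofNat_mul, hT.avg_eta_one, hT.avg_eta_one_sq,
        hT.avg_mul_index hc]; norm_num)
    omega
  apply hT.not_nn_beta_sub_one hc
  by_cases hk1 : k = 1
  · have e1 := hT.eq_one_of_avg (nn_sq x) (by rw [hk, hk1, Nat.cast_one])
    rw [hvw, e1, add_sub_cancel_left]
    exact hB.nn w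
  · have e2 := hT.eq_one_of_avg (hB.nn w) (by rw [hl, show l = 1 by omega, Nat.cast_one])
    rw [hvw, e2, add_sub_cancel_right]
    exact nn_sq x

lemma alpha_beta_orthogonal (hT : TwoPow q n) (hB : UnivTernary B) {u v}
    {c : ZMod q} (hc : c = 4 * n - 1 ∨ c = 4 * n + 1) (hv : B v v = 2 - eta q 1)
    (hu : B u u = 3 + eta q 1 + eta q c) : B u v = 0 := by
  have hcs := hB.cauchySchwarz v u
  rw [hv, hu, hB.symm v u] at hcs
  set b := B u v
  have hp := hT.parity_index hc
  obtain ⟨k, hk⟩ := hT.avg_nn_cases (nn_sq b)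
  obtain ⟨l, hl⟩ := hT.avg_nn_cases hcs
  have hprod : avg q ((2 - eta q 1) * (3 + eta q 1 + eta q c)) = 4 := by
    rw [show (2 - eta q 1) * (3 + eta q 1 + eta q c) = 6 - eta q 1 - eta q 1 ^ 2 +
      2 * eta q c - eta q 1 * eta q c by ring]
    simp only [map_add, map_sub]
    rw [avg_ofNat_mul, hT.avg_ofNat, hT.avg_eta_one, hT.avg_eta_one_sq, hT.avg_mul_index hc,
      hT.avg_eta_odd hp]
    norm_num
  rw [map_sub, hprod, hk] at hl
  have hkl : k + l = 4 := by
    have : ((k + l : ℕ) : ℝ) = 4 := by push_cast; linarith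
    exact_mod_cast this
  by_contra hb
  have hk0 : k ≠ 0 := by
    rintro rfl
    exact hb (pow_eq_zero_iff two_ne_zero |>.1 ((nn_sq b).eq_zero_of_avg (by rw [hk]; norm_num)))
  have hl' : avg q ((2 - eta q 1) * (3 + eta q 1 + eta q c) - b ^ 2) = l := by
    rw [map_sub, hprod, hk, hl]
  obtain h1 | h2 | h3 | h4 : k = 1 ∨ k = 2 ∨ k = 3 ∨ k = 4 := by omega
  · have e1 := hT.eq_one_of_avg (nn_sq b) (by rw [hk, h1, Nat.cast_one])
    rw [e1] at hcs
    exact hT.not_nn_alpha_beta_sub_one hc hcs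
  · obtain ⟨i, hi⟩ := hT.sq_eq_of_avg_sq_eq_two (b := b) (by rw [hk, h2]; norm_num)
    rw [hi] at hcs
    refine hT.not_nn_alpha_beta_sub_sq hc ?_ hcs
    intro h0
    rw [h0, zero_pow two_ne_zero] at hi
    exact hb (pow_eq_zero_iff two_ne_zero |>.1 hi)
  · have e1 := hT.eq_one_of_avg hcs (by rw [hl', show l = 1 by omega, Nat.cast_one])
    apply hT.not_nn_alpha_beta_sub_one hc
    rw [show (2 - eta q 1) * (3 + eta q 1 + eta q c) - 1 = b ^ 2 by linear_combination e1]
    exact nn_sq b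
  · have e1 := hcs.eq_zero_of_avg (by rw [hl', show l = 0 by omega, Nat.cast_zero])
    have := hT.four_dvd_ne (j := -2) (sub_eq_zero.1 e1) (by
      rw [show (2 - eta q 1) * (3 + eta q 1 + eta q c) * eta q 1 = 6 * eta q 1 - eta q 1 ^ 2 -
        eta q 1 ^ 3 + 2 * (eta q 1 * eta q c) - eta q 1 ^ 2 * eta q c by ring]
      simp only [map_add, map_sub]
      rw [avg_ofNat_mul, avg_ofNat_mul, hT.avg_eta_one, hT.avg_eta_one_sq, hT.avg_mul_index hc,
        hT.avg_eta_one_cube, hT.avg_sq_mul_index hc]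
      norm_num)
    omega

lemma beta_mul_beta_ne_sq (hT : TwoPow q n) (x : 𝓞 (Kq q)) :
    x ^ 2 ≠ (3 + eta q 1 + eta q (4 * n - 1)) * (3 + eta q 1 + eta q (4 * n + 1)) := by
  intro hx
  have hc : (4 * n - 1 : ZMod q) = 4 * n - 1 ∨ (4 * n - 1 : ZMod q) = 4 * n + 1 := Or.inl rfl
  have hab := hT.sq_add_sq hc
  have hpar := hT.parity_index hc
  have hneg : eta q (4 * n + 1) = - eta q (4 * n - 1) := by
    rw [← hT.eta_add_half, ← eta_neg]; congr 1; linear_combination -hT.sixteen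
  rw [hneg] at hx
  set a := eta q 1 with ha
  set b := eta q (4 * n - 1) with hb
  set r := eta q (2 * n) with hr
  have hr2 : r ^ 2 = 2 := by
    have h4 : eta q (4 * n) = 0 := by
      have h := hT.eta_add_half (-(4 * n))
      rw [show (-(4 * n) + 8 * n : ZMod q) = 4 * n by ring, eta_neg] at h
      have : (2 : 𝓞 (Kq q)) * eta q (4 * n) = 0 := by linear_combination h
      exact (mul_eq_zero.1 this).resolve_left two_ne_zero
    rw [hr, eta_sq, show (2 * (2 * n) : ZMod q) = 4 * n by ring, h4, zero_add]
  obtain ⟨y, hy⟩ : r ∣ x - 1 := by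
    refine (IsIntegrallyClosed.pow_dvd_pow_iff two_ne_zero).1
      ⟨2 + 3 * a + a ^ 2 - (x - 1), ?_⟩
    rw [hr2]; linear_combination hx - hab
  have hs : 2 + 3 * a + a ^ 2 = y ^ 2 + r * y := by
    apply mul_left_cancel₀ (two_ne_zero (α := 𝓞 (Kq q)))
    have hx1 : x = 1 + r * y := by linear_combination hy
    rw [hx1] at hx
    linear_combination hab - hx + y ^ 2 * hr2
  have hrab : r * (a + b) = 2 * eta q (2 * n - 1) := by
    rw [mul_add, hr, ha, hb, eta_mul, eta_mul,
      show (2 * n + (4 * n - 1) : ZMod q) = -(2 * n + 1) + 8 * n by ring, hT.eta_add_half,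
      eta_neg, show (2 * n - (4 * n - 1) : ZMod q) = -(2 * n - 1) by ring, eta_neg]
    ring
  obtain ⟨k, hk⟩ := hT.avg_sq_mul_eta y (map_one hT.parity)
  obtain ⟨l, hl⟩ := hT.avg_sq_mul_eta y hpar
  obtain ⟨j, hj⟩ := hT.avg_mul_eta_int y (2 * n - 1)
  have h6 : avg q ((2 + 3 * a + a ^ 2) * (a + b)) = 6 := by
    rw [show (2 + 3 * a + a ^ 2) * (a + b) = 2 * a + 3 * a ^ 2 + a ^ 3 + 2 * b + 3 * (a * b) +
      a ^ 2 * b by ring]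
    simp only [map_add]
    rw [avg_ofNat_mul, avg_ofNat_mul, avg_ofNat_mul, avg_ofNat_mul, hT.avg_eta_one,
      hT.avg_eta_one_sq, hT.avg_mul_index hc, hT.avg_eta_one_cube, hT.avg_sq_mul_index hc,
      hT.avg_eta_odd hpar]
    norm_num
  rw [hs, show (y ^ 2 + r * y) * (a + b) = y ^ 2 * a + y ^ 2 * b + 2 * (y * eta q (2 * n - 1)) by
    linear_combination y * hrab, map_add, map_add, hk, hl, avg_ofNat_mul, hj] at h6
  have : 4 * k + 4 * l + 4 * j = 6 := by
    have : (4 * k + 4 * l + 4 * j : ℝ) = 6 := by linarith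
    exact_mod_cast this
  omega

theorem not_univTernary (hT : TwoPow q n) (hB : UnivTernary B) : False := by
  obtain ⟨e, he⟩ := hB.univ 1 tp_one
  obtain ⟨v, hve, hv⟩ := hT.exists_alpha hB he
  obtain ⟨u, hue, hu⟩ := hT.exists_beta hB he (Or.inl rfl)
  obtain ⟨u', hue', hu'⟩ := hT.exists_beta hB he (Or.inr rfl)
  have he0 : e ≠ 0 := by rintro rfl; simp at he
  have hv0 : v ≠ 0 := by
    rintro rfl
    simp only [map_zero] at hv
    exact (tp_two_sub_eta (hT.index_ne_zero (map_one hT.parity))).ne_zero hv.symm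
  have := hB.sq_eq_of_orthogonal he0 hv0 hve hue hue'
    (hT.alpha_beta_orthogonal hB (Or.inl rfl) hv hu)
    (hT.alpha_beta_orthogonal hB (Or.inr rfl) hv hu')
  rw [hu, hu'] at this
  exact hT.beta_mul_beta_ne_sq _ this

end TwoPow

/-! ### The case of a prime `q ≥ 7` -/

/-- A prime `q ≥ 7`. -/
structure BigPrime (q : ℕ) : Prop where
  prime : q.Prime
  seven_le : 7 ≤ q

namespace BigPrime

variable {q : ℕ} [NeZero q]

lemma three_le (hP : BigPrime q) : 3 ≤ q := by have := hP.seven_le; omega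

lemma isUnit_iff (hP : BigPrime q) (t : ZMod q) : IsUnit t ↔ t ≠ 0 := by
  have := Fact.mk hP.prime
  exact isUnit_iff_ne_zero

lemma mul_eq_zero (hP : BigPrime q) {a b : ZMod q} : a * b = 0 ↔ a = 0 ∨ b = 0 := by
  have := Fact.mk hP.prime
  exact _root_.mul_eq_zero

lemma natCast_ne_zero (hP : BigPrime q) {m : ℕ} (h0 : m ≠ 0) (hm : m < q) : (m : ZMod q) ≠ 0 := by
  rw [Ne, ZMod.natCast_eq_zero_iff]
  exact fun h => absurd (Nat.le_of_dvd (Nat.pos_of_ne_zero h0) h) (by omega)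

lemma two_ne_zero (hP : BigPrime q) : (2 : ZMod q) ≠ 0 := by
  exact_mod_cast hP.natCast_ne_zero (m := 2) (by norm_num) (by have := hP.seven_le; omega)

lemma one_ne_zero (hP : BigPrime q) : (1 : ZMod q) ≠ 0 := by
  exact_mod_cast hP.natCast_ne_zero (m := 1) (by norm_num) (by have := hP.seven_le; omega)

lemma ne_neg (hP : BigPrime q) {a : ZMod q} (ha : a ≠ 0) : a ≠ -a := by
  intro h
  have : 2 * a = 0 := by linear_combination h
  exact (hP.mul_eq_zero.1 this).elim hP.two_ne_zero ha

lemma exists_half (hP : BigPrime q) (a : ZMod q) : ∃ i : ZMod q, 2 * i = a := by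
  obtain ⟨u, hu⟩ := (hP.isUnit_iff 2).2 hP.two_ne_zero
  exact ⟨↑u⁻¹ * a, by rw [← hu, ← mul_assoc, Units.mul_inv, one_mul]⟩

lemma exists_unit_mul (hP : BigPrime q) {a b : ZMod q} (ha : a ≠ 0) (hb : b ≠ 0) :
    ∃ s : (ZMod q)ˣ, (s : ZMod q) * a = b := by
  obtain ⟨u, hu⟩ := (hP.isUnit_iff a).2 ha
  obtain ⟨v, hv⟩ := (hP.isUnit_iff b).2 hb
  exact ⟨v * u⁻¹, by rw [← hu, ← hv, Units.val_mul, mul_assoc, Units.inv_mul, mul_one]⟩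

lemma sum_emb_eta (hP : BigPrime q) (a : ZMod q) :
    ∑ s : (ZMod q)ˣ, emb s (eta q a) = (if a = 0 then 2 * (q : ℝ) else 0) - 2 := by
  have hsum : ∑ s : (ZMod q)ˣ, emb s (eta q a) =
      ∑ t ∈ Finset.univ.erase (0 : ZMod q), dcos q (t * a) := by
    simp only [emb_eta]
    refine Finset.sum_bij (fun s _ => (s : ZMod q)) ?_ (by simp [Units.ext_iff]) ?_ (by simp)
    · intro s _
      rw [Finset.mem_erase]
      exact ⟨(hP.isUnit_iff _).1 s.isUnit, Finset.mem_univ _⟩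
    · intro b hb
      exact ⟨((hP.isUnit_iff b).2 (Finset.mem_erase.1 hb).1).unit, Finset.mem_univ _, rfl⟩
  rw [hsum, ← sum_dcos, ← Finset.add_sum_erase _ _ (Finset.mem_univ (0 : ZMod q)), zero_mul,
    dcos_zero]
  ring

lemma real_form_eta (hP : BigPrime q) (j i : ZMod q) :
    1 / (2 * q) * ∑ s : (ZMod q)ˣ, emb s ((2 - eta q j) * eta q i) =
      (((if i = 0 then 2 else 0) - (if i = j then 1 else 0) - (if i = -j then 1 else 0) : ℤ) : ℝ) := by
  have hq : (q : ℝ) ≠ 0 := by exact_mod_cast NeZero.ne q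
  have e : (2 - eta q j) * eta q i = eta q i + eta q i - eta q (i - j) - eta q (i + j) := by
    rw [sub_mul, mul_comm (eta q j), eta_mul]; ring
  rw [e]
  simp only [map_sub, map_add, Finset.sum_sub_distrib, Finset.sum_add_distrib, hP.sum_emb_eta,
    sub_eq_zero, add_eq_zero_iff_eq_neg]
  split_ifs <;> push_cast <;> field_simp <;> ring

lemma exists_int (hP : BigPrime q) (j : ZMod q) (x : 𝓞 (Kq q)) :
    ∃ n : ℤ, 1 / (2 * q) * ∑ s : (ZMod q)ˣ, emb s ((2 - eta q j) * x) = n := by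
  by_cases h2 : (2 : 𝓞 (Kq q)) = eta q 0
  swap
  · exact absurd eta_zero.symm h2
  refine eta_induction hP.three_le (p := fun x => ∃ n : ℤ, 1 / (2 * (q : ℝ)) *
    ∑ s : (ZMod q)ˣ, emb s ((2 - eta q j) * x) = n) ?_ ?_ ?_ ?_ x
  · have := hP.real_form_eta j 0
    rw [eta_zero] at this
    simp only [map_mul, map_ofNat, ← Finset.sum_mul, ← mul_assoc, mul_one] at this ⊢
    refine ⟨1 - if 0 = j then 1 else 0, ?_⟩
    have e : (0 = -j) ↔ (0 = j) := by rw [zero_eq_neg, eq_comm]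
    simp only [e] at this
    split_ifs at this ⊢ <;> push_cast at this ⊢ <;> linarith
  · exact fun a => ⟨_, hP.real_form_eta j a⟩
  · rintro x y ⟨m, hm⟩ ⟨n, hn⟩
    exact ⟨m + n, by simp only [mul_add, map_add, Finset.sum_add_distrib]; push_cast; rw [← hm, ← hn]⟩
  · rintro x ⟨m, hm⟩
    exact ⟨-m, by simp only [mul_neg, map_neg, Finset.sum_neg_distrib]; push_cast; rw [← hm]⟩

/-- The integral functional `x ↦ Tr ((2 - η_j) x) / q`. -/
noncomputable def form (hP : BigPrime q) (j : ZMod q) : 𝓞 (Kq q) →+ ℤ where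
  toFun x := ⌊1 / (2 * (q : ℝ)) * ∑ s : (ZMod q)ˣ, emb s ((2 - eta q j) * x)⌋
  map_zero' := by simp
  map_add' x y := by
    obtain ⟨m, hm⟩ := hP.exists_int j x
    obtain ⟨n, hn⟩ := hP.exists_int j y
    simp only [mul_add, map_add, Finset.sum_add_distrib]
    rw [hm, hn, ← Int.cast_add, Int.floor_intCast, Int.floor_intCast, Int.floor_intCast]

lemma form_cast (hP : BigPrime q) (j : ZMod q) (x : 𝓞 (Kq q)) :
    (hP.form j x : ℝ) = 1 / (2 * q) * ∑ s : (ZMod q)ˣ, emb s ((2 - eta q j) * x) := by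
  obtain ⟨n, hn⟩ := hP.exists_int j x
  change ((⌊1 / (2 * (q : ℝ)) * ∑ s : (ZMod q)ˣ, emb s ((2 - eta q j) * x)⌋ : ℤ) : ℝ) = _
  rw [hn, Int.floor_intCast]

lemma form_eta (hP : BigPrime q) (j i : ZMod q) : hP.form j (eta q i) =
    (if i = 0 then 2 else 0) - (if i = j then 1 else 0) - (if i = -j then 1 else 0) := by
  have := hP.real_form_eta j i
  rw [← hP.form_cast] at this
  exact_mod_cast this

lemma form_zsmul (hP : BigPrime q) (j : ZMod q) (n : ℤ) (x : 𝓞 (Kq q)) :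
    hP.form j (n * x) = n * hP.form j x := by
  rw [← zsmul_eq_mul, map_zsmul, smul_eq_mul]

lemma form_two_mul (hP : BigPrime q) (j : ZMod q) (x : 𝓞 (Kq q)) :
    hP.form j (2 * x) = 2 * hP.form j x := by
  exact_mod_cast hP.form_zsmul j 2 x

lemma form_one (hP : BigPrime q) {j : ZMod q} (hj : j ≠ 0) : hP.form j 1 = 1 := by
  have h := hP.form_eta j 0
  have h2 := hP.form_two_mul j 1
  rw [eta_zero, if_pos rfl, if_neg hj.symm, if_neg (by simpa [eq_comm] using hj)] at h
  rw [mul_one, h] at h2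
  omega

lemma form_intCast (hP : BigPrime q) {j : ZMod q} (hj : j ≠ 0) (n : ℤ) : hP.form j n = n := by
  rw [← mul_one (n : 𝓞 (Kq q)), form_zsmul, hP.form_one hj, mul_one]

lemma form_ofNat (hP : BigPrime q) {j : ZMod q} (hj : j ≠ 0) (n : ℕ) [n.AtLeastTwo] :
    hP.form j ofNat(n) = ofNat(n) := by
  exact_mod_cast hP.form_intCast hj ofNat(n)

lemma form_zero_left (hP : BigPrime q) (x : 𝓞 (Kq q)) : hP.form 0 x = 0 := by
  have := hP.form_cast 0 x
  rw [eta_zero, sub_self, zero_mul] at this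
  simpa using this

lemma form_nonneg (hP : BigPrime q) (j : ZMod q) {x : 𝓞 (Kq q)} (hx : NN x) :
    0 ≤ hP.form j x := by
  have := hP.form_cast j x
  have h2 := Finset.sum_nonneg fun s (_ : s ∈ Finset.univ) => ((nn_two_sub_eta j).mul hx) s
  have : (0 : ℝ) ≤ hP.form j x := by rw [this]; positivity
  exact_mod_cast this

lemma form_pos (hP : BigPrime q) {j : ZMod q} (hj : j ≠ 0) {x : 𝓞 (Kq q)} (hx : TP x) :
    1 ≤ hP.form j x := by
  have := hP.form_cast j x
  have hq : (0 : ℝ) < q := by exact_mod_cast NeZero.pos q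
  have h2 := Finset.sum_pos (fun s (_ : s ∈ Finset.univ) => ((tp_two_sub_eta hj).mul hx) s)
    Finset.univ_nonempty
  have : (0 : ℝ) < hP.form j x := by rw [this]; positivity
  exact_mod_cast this

lemma sum_eta (hP : BigPrime q) : ∑ i, eta q i = 0 := by
  apply emb_injective 1
  rw [map_sum, map_zero]
  simp only [emb_eta, Units.val_one]
  have := sum_dcos (q := q) 1
  rw [if_neg hP.one_ne_zero] at this
  simpa only [mul_one, one_mul] using this

lemma exists_coeff (hP : BigPrime q) (x : 𝓞 (Kq q)) :
    ∃ c : ZMod q → ℤ, (∀ i, c (-i) = c i) ∧ 2 * x = ∑ i, (c i : 𝓞 (Kq q)) * eta q i := by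
  refine eta_induction hP.three_le (p := fun x => ∃ c : ZMod q → ℤ, (∀ i, c (-i) = c i) ∧
    2 * x = ∑ i, (c i : 𝓞 (Kq q)) * eta q i) ?_ ?_ ?_ ?_ x
  · refine ⟨fun i => if i = 0 then 1 else 0, fun i => by simp, ?_⟩
    simp [eta_zero]
  · intro a
    refine ⟨fun i => (if i = a then 1 else 0) + (if i = -a then 1 else 0), fun i => ?_, ?_⟩
    · simp only [neg_eq_iff_eq_neg, neg_neg, add_comm]
    · simp [add_mul, Finset.sum_add_distrib, eta_neg, two_mul]
  · rintro x y ⟨c, hc, hx⟩ ⟨c', hc', hy⟩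
    refine ⟨c + c', fun i => by simp [hc, hc'], ?_⟩
    simp only [mul_add, hx, hy, Pi.add_apply, Int.cast_add, add_mul, Finset.sum_add_distrib]
  · rintro x ⟨c, hc, hx⟩
    refine ⟨-c, fun i => by simp [hc], ?_⟩
    simp only [mul_neg, hx, Pi.neg_apply, Int.cast_neg, neg_mul, Finset.sum_neg_distrib]

/-- An element with symmetric coefficients `c` on the `η_i`. -/
structure Coeff (x : 𝓞 (Kq q)) (c : ZMod q → ℤ) : Prop where
  even : ∀ i, c (-i) = c i
  eq : 2 * x = ∑ i, (c i : 𝓞 (Kq q)) * eta q i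

lemma exists_coeff_small (hP : BigPrime q) (x : 𝓞 (Kq q)) :
    ∃ c, Coeff x c ∧ 2 * |∑ i, c i| < q := by
  obtain ⟨c, hc, hx⟩ := hP.exists_coeff x
  have hqo : (q : ℤ) % 2 = 1 := by
    have h1 := hP.prime.eq_two_or_odd
    have := hP.seven_le
    omega
  obtain ⟨k, hk⟩ : ∃ k : ℤ, 2 * |(∑ i, c i) - q * k| < q := by
    refine ⟨((2 * ∑ i, c i) + q) / (2 * q), ?_⟩
    have hq0 : (0 : ℤ) < q := by exact_mod_cast NeZero.pos q
    have h1 := Int.emod_add_mul_ediv ((2 * ∑ i, c i) + q) (2 * q)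
    have h2 := Int.emod_nonneg ((2 * ∑ i, c i) + q) (b := 2 * q) (by omega)
    have h3 := Int.emod_lt_of_pos ((2 * ∑ i, c i) + q) (b := 2 * q) (by omega)
    set k := ((2 * ∑ i, c i) + q) / (2 * q)
    rw [mul_assoc] at h1
    generalize (q : ℤ) * k = w at h1 ⊢
    rcases abs_cases ((∑ i, c i) - w) with ⟨h, -⟩ | ⟨h, -⟩ <;> rw [h] <;> omega
  refine ⟨fun i => c i - k, ⟨fun i => by simp [hc], ?_⟩, ?_⟩
  · simp only [Int.cast_sub, sub_mul, Finset.sum_sub_distrib, ← Finset.mul_sum, hP.sum_eta, hx,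
      mul_zero, sub_zero]
  · simpa [Finset.sum_sub_distrib, ZMod.card] using hk

lemma Coeff.form (hP : BigPrime q) {x : 𝓞 (Kq q)} {c} (h : Coeff x c) (j : ZMod q) :
    hP.form j x = c 0 - c j := by
  have h1 := hP.form_two_mul j x
  rw [h.eq, map_sum] at h1
  simp only [form_zsmul, form_eta, mul_sub, mul_ite, mul_one, mul_zero, Finset.sum_sub_distrib,
    Finset.sum_ite_eq', Finset.mem_univ, if_true, h.even] at h1
  omega

lemma Coeff.form_sq (hP : BigPrime q) {x : 𝓞 (Kq q)} {c} (h : Coeff x c) (j : ZMod q) :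
    hP.form j (x ^ 2) = ∑ i, c i ^ 2 - ∑ i, c i * c (i + j) := by
  have e : (2 : 𝓞 (Kq q)) * (2 * x ^ 2) =
      2 * ∑ i, ∑ k, (((c i * c k : ℤ)) : 𝓞 (Kq q)) * eta q (k - i) := by
    have e1 : ∑ i, ∑ k, (((c i * c k : ℤ)) : 𝓞 (Kq q)) * eta q (k + i) =
        ∑ i, ∑ k, (((c i * c k : ℤ)) : 𝓞 (Kq q)) * eta q (k - i) := by
      rw [← Equiv.sum_comp (Equiv.neg _)]
      simp only [Equiv.neg_apply, h.even, ← sub_eq_add_neg]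
    calc (2 : 𝓞 (Kq q)) * (2 * x ^ 2) = (2 * x) * (2 * x) := by ring
      _ = ∑ i, ∑ k, ((((c i * c k : ℤ)) : 𝓞 (Kq q)) * eta q (k + i) +
          (((c i * c k : ℤ)) : 𝓞 (Kq q)) * eta q (k - i)) := by
        rw [h.eq, Finset.sum_mul_sum]
        refine Finset.sum_congr rfl fun i _ => Finset.sum_congr rfl fun k _ => ?_
        rw [← mul_add, ← eta_mul]; push_cast; ring
      _ = _ := by
        simp only [Finset.sum_add_distrib]; rw [e1]; ring
  have e2 := mul_left_cancel₀ _root_.two_ne_zero e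
  have h1 := hP.form_two_mul j (x ^ 2)
  rw [e2, map_sum] at h1
  simp only [map_sum, form_zsmul, form_eta, mul_sub, mul_ite, mul_one, mul_zero,
    Finset.sum_sub_distrib, sub_eq_iff_eq_add, Finset.sum_ite_eq', Finset.mem_univ, if_true,
    zero_add] at h1
  have e3 : ∑ i, c i * c (-j + i) = ∑ i, c i * c (i + j) := by
    rw [← Equiv.sum_comp (Equiv.addRight j)]
    refine Finset.sum_congr rfl fun i _ => ?_
    rw [Equiv.coe_addRight, show -j + (i + j) = i by ring, mul_comm]
  simp only [add_comm j, e3, ← Finset.sum_mul, ← pow_two] at h1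
  omega

lemma Coeff.sum_form_sq (hP : BigPrime q) {x : 𝓞 (Kq q)} {c} (h : Coeff x c) :
    ∑ j, hP.form j (x ^ 2) = q * ∑ i, c i ^ 2 - (∑ i, c i) ^ 2 := by
  simp only [h.form_sq hP, Finset.sum_sub_distrib, Finset.sum_const, Finset.card_univ, ZMod.card,
    nsmul_eq_mul]
  rw [Finset.sum_comm]
  congr 1
  rw [pow_two, Finset.sum_mul]
  have : ∀ i, ∑ j, c i * c (i + j) = c i * ∑ j, c j := fun i => by
    rw [← Finset.mul_sum]; congr 1; exact Equiv.sum_comp (Equiv.addLeft i) c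
  exact Finset.sum_congr rfl fun i _ => this i

lemma eq_zero_of_form (hP : BigPrime q) {x : 𝓞 (Kq q)} (h : ∀ j ≠ 0, hP.form j x = 0) : x = 0 := by
  obtain ⟨c, hc, -⟩ := hP.exists_coeff_small x
  have h0 : ∀ j, c j = c 0 := fun j => by
    by_cases hj : j = 0
    · rw [hj]
    · have := h j hj; rw [hc.form hP] at this; omega
  have := hc.eq
  simp only [h0, ← Finset.mul_sum, hP.sum_eta, mul_zero] at this
  exact (_root_.mul_eq_zero.1 this).resolve_left _root_.two_ne_zero

end BigPrime

namespace BigPrime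

variable {q : ℕ} [NeZero q]

/-! #### Divisibility by `2` -/

lemma two_dvd_frobenius (hP : BigPrime q) (x : 𝓞 (Kq q)) : 2 ∣ x ^ 2 ^ (q - 1) - x := by
  have hq1 : q - 1 ≠ 0 := by have := hP.seven_le; omega
  have he : Even (2 ^ (q - 1)) := (Nat.even_pow.2 ⟨even_two, hq1⟩)
  refine eta_induction hP.three_le (p := fun x => (2 : 𝓞 (Kq q)) ∣ x ^ 2 ^ (q - 1) - x)
    ?_ ?_ ?_ ?_ x
  · simp
  · intro a
    have key : ∀ n : ℕ, (2 : 𝓞 (Kq q)) ∣ eta q a ^ 2 ^ n - eta q (2 ^ n * a) := by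
      intro n
      induction n with
      | zero => simp
      | succ n ih =>
        obtain ⟨y, hy⟩ := ih
        have h2 := eta_sq (q := q) (2 ^ n * a)
        rw [show (2 * (2 ^ n * a) : ZMod q) = 2 ^ (n + 1) * a by ring] at h2
        refine ⟨2 * y ^ 2 + 2 * y * eta q (2 ^ n * a) + 1, ?_⟩
        rw [pow_succ 2 n, pow_mul, eq_add_of_sub_eq hy, eq_sub_of_add_eq h2.symm]
        ring
    have h1 : (2 : ZMod q) ^ (q - 1) = 1 := by
      have := Fact.mk hP.prime
      exact ZMod.pow_card_sub_one_eq_one hP.two_ne_zero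
    have := key (q - 1)
    rwa [h1, one_mul] at this
  · intro x y hx hy
    obtain ⟨r, hr⟩ := (Commute.all x y).exists_add_pow_prime_pow_eq Nat.prime_two (q - 1)
    rw [hr]
    obtain ⟨u, hu⟩ := hx
    obtain ⟨v, hv⟩ := hy
    exact ⟨u + v + x * y * r, by push_cast; linear_combination hu + hv⟩
  · rintro x ⟨u, hu⟩
    exact ⟨u + x, by rw [he.neg_pow]; linear_combination hu⟩

lemma two_dvd_of_sq (hP : BigPrime q) {x : 𝓞 (Kq q)} (h : 2 ∣ x ^ 2) : 2 ∣ x := by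
  have h1 : x ^ 2 ∣ x ^ 2 ^ (q - 1) := by
    apply pow_dvd_pow
    have : q - 1 ≠ 0 := by have := hP.seven_le; omega
    calc 2 = 2 ^ 1 := rfl
      _ ≤ _ := Nat.pow_le_pow_right (by norm_num) (by omega)
  have := dvd_sub (h.trans h1) (hP.two_dvd_frobenius x)
  rwa [sub_sub_cancel] at this

lemma not_two_dvd_eta (hP : BigPrime q) {i : ZMod q} (hi : i ≠ 0) : ¬ 2 ∣ eta q i := by
  rintro ⟨y, hy⟩
  have := hP.form_two_mul i y
  rw [← hy, form_eta, if_neg hi, if_pos rfl, if_neg (hP.ne_neg hi)] at this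
  omega

lemma not_two_dvd_one (hP : BigPrime q) : ¬ (2 : 𝓞 (Kq q)) ∣ 1 := by
  rintro ⟨y, hy⟩
  have := hP.form_two_mul 1 y
  rw [← hy, hP.form_one hP.one_ne_zero] at this
  omega

lemma sq_ne_two (hP : BigPrime q) (x : 𝓞 (Kq q)) : x ^ 2 ≠ 2 := by
  intro h
  obtain ⟨y, rfl⟩ := hP.two_dvd_of_sq (x := x) ⟨1, by rw [h, mul_one]⟩
  exact hP.not_two_dvd_one ⟨y ^ 2, mul_left_cancel₀ _root_.two_ne_zero (by linear_combination -h)⟩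

lemma sq_ne_three (hP : BigPrime q) (x : 𝓞 (Kq q)) : x ^ 2 ≠ 3 := by
  intro h
  obtain ⟨y, hy⟩ := hP.two_dvd_of_sq (x := x - 1) ⟨2 - x, by linear_combination h⟩
  rw [sub_eq_iff_eq_add.1 hy] at h
  exact hP.not_two_dvd_one ⟨y ^ 2 + y, mul_left_cancel₀ _root_.two_ne_zero (by linear_combination -h)⟩

lemma sq_ne_three_add_eta (hP : BigPrime q) {j : ZMod q} (hj : j ≠ 0) (x : 𝓞 (Kq q)) :
    x ^ 2 ≠ 3 + eta q j := by
  intro h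
  obtain ⟨i, rfl⟩ := hP.exists_half j
  have hi : i ≠ 0 := by rintro rfl; simp at hj
  have e := eta_sq (q := q) i
  obtain ⟨y, hy⟩ := hP.two_dvd_of_sq (x := x - 1 - eta q i)
    ⟨1 + eta q i ^ 2 - x - x * eta q i + eta q i, by linear_combination h - e⟩
  apply hP.not_two_dvd_eta hi
  refine ⟨-(y ^ 2 + y + y * eta q i), mul_left_cancel₀ _root_.two_ne_zero ?_⟩
  have : x = 1 + eta q i + 2 * y := by linear_combination hy
  rw [this] at h
  linear_combination h - e

lemma sq_ne_two_sub_eta (hP : BigPrime q) {j : ZMod q} (hj : j ≠ 0) (x : 𝓞 (Kq q)) :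
    x ^ 2 ≠ 2 - eta q j := by
  intro h
  obtain ⟨i, rfl⟩ := hP.exists_half j
  have hi : i ≠ 0 := by rintro rfl; simp at hj
  have e := eta_sq (q := q) i
  obtain ⟨y, hy⟩ := hP.two_dvd_of_sq (x := x - eta q i)
    ⟨2 - x * eta q i, by linear_combination h + e⟩
  apply hP.not_two_dvd_eta hi
  apply hP.two_dvd_of_sq
  refine ⟨1 - y * eta q i - y ^ 2, mul_left_cancel₀ _root_.two_ne_zero ?_⟩
  have : x = eta q i + 2 * y := by linear_combination hy
  rw [this] at h
  linear_combination h + e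

/-! #### Divisibility by `2 - η_1` -/

lemma dvd_two_sub_eta (a : ZMod q) : 2 - eta q 1 ∣ 2 - eta q a := by
  have key : ∀ n : ℕ, 2 - eta q 1 ∣ 2 - eta q n ∧ 2 - eta q 1 ∣ 2 - eta q ((n + 1 : ℕ) : ZMod q) := by
    intro n
    induction n with
    | zero => exact ⟨by simp [eta_zero], by simp⟩
    | succ n ih =>
      refine ⟨ih.2, ?_⟩
      obtain ⟨⟨u, hu⟩, ⟨v, hv⟩⟩ := ih
      have := eta_mul (q := q) ((n + 1 : ℕ) : ZMod q) 1
      rw [show ((n + 1 : ℕ) : ZMod q) - 1 = n by push_cast; ring,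
        show ((n + 1 : ℕ) : ZMod q) + 1 = (n + 1 + 1 : ℕ) by push_cast; ring] at this
      exact ⟨2 + eta q 1 * v - u, by linear_combination eta q 1 * hv - hu + this⟩
  have := (key a.val).1
  rwa [ZMod.natCast_zmod_val] at this

lemma exists_int_congr (hP : BigPrime q) (x : 𝓞 (Kq q)) : ∃ n : ℤ, 2 - eta q 1 ∣ x - n := by
  refine eta_induction hP.three_le (p := fun x => ∃ n : ℤ, 2 - eta q 1 ∣ x - n) ?_ ?_ ?_ ?_ x
  · exact ⟨1, by simp⟩
  · intro a
    refine ⟨2, ?_⟩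
    rw [← dvd_neg, neg_sub]
    exact_mod_cast dvd_two_sub_eta a
  · rintro x y ⟨m, hm⟩ ⟨n, hn⟩
    refine ⟨m + n, ?_⟩
    rw [Int.cast_add, add_sub_add_comm]
    exact dvd_add hm hn
  · rintro x ⟨m, hm⟩
    refine ⟨-m, ?_⟩
    rw [Int.cast_neg, ← neg_sub', dvd_neg]
    exact hm

lemma dvd_natCast_self (hP : BigPrime q) : 2 - eta q 1 ∣ (q : 𝓞 (Kq q)) := by
  obtain ⟨d, hd⟩ : ∃ d, q = 2 * d + 1 := by
    have h1 := hP.prime.eq_two_or_odd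
    have := hP.seven_le
    exact ⟨q / 2, by omega⟩
  have h0 := hP.sum_eta
  have h1 : ∑ i, eta q i = ∑ i ∈ Finset.range q, eta q (i : ZMod q) := by
    refine Finset.sum_bij' (fun a _ => a.val) (fun n _ => (n : ZMod q)) ?_ ?_ ?_ ?_ ?_
    · intro a _; exact Finset.mem_range.2 (ZMod.val_lt a)
    · intro n _; exact Finset.mem_univ _
    · intro a _; exact ZMod.natCast_zmod_val a
    · intro n hn; exact ZMod.val_cast_of_lt (Finset.mem_range.1 hn)
    · intro a _; rw [ZMod.natCast_zmod_val]
  have hq : ((2 * d + 1 : ℕ) : ZMod q) = 0 := by rw [← hd, ZMod.natCast_self]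
  have h2 : ∑ i ∈ Finset.range q, eta q (i : ZMod q) =
      2 * (1 + ∑ i ∈ Finset.range d, eta q ((i + 1 : ℕ) : ZMod q)) := by
    rw [show Finset.range q = Finset.range (2 * d + 1) by rw [← hd], Finset.sum_range_succ', Nat.cast_zero, eta_zero, two_mul d, Finset.sum_range_add]
    have : ∑ x ∈ Finset.range d, eta q ((d + x + 1 : ℕ) : ZMod q) =
        ∑ x ∈ Finset.range d, eta q ((x + 1 : ℕ) : ZMod q) := by
      rw [← Finset.sum_range_reflect]
      refine Finset.sum_congr rfl fun x hx => ?_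
      rw [← eta_neg]
      congr 1
      have hx' := Finset.mem_range.1 hx
      rw [show d + (d - 1 - x) + 1 = 2 * d - x by omega, Nat.cast_sub (by omega)]
      push_cast at hq ⊢
      linear_combination -hq
    rw [this]; ring
  rw [h1, h2] at h0
  have h3 := (_root_.mul_eq_zero.1 h0).resolve_left _root_.two_ne_zero
  have h4 : 2 - eta q 1 ∣ ∑ i ∈ Finset.range d, (2 - eta q ((i + 1 : ℕ) : ZMod q)) :=
    Finset.dvd_sum fun i _ => dvd_two_sub_eta _
  rw [Finset.sum_sub_distrib, Finset.sum_const, Finset.card_range, nsmul_eq_mul] at h4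
  rw [show (q : 𝓞 (Kq q)) = ((2 * d + 1 : ℕ) : 𝓞 (Kq q)) from congrArg _ hd]
  convert h4 using 1
  rw [Nat.cast_add, Nat.cast_mul, Nat.cast_two, Nat.cast_one]
  linear_combination h3

lemma natCast_dvd_of_dvd (hP : BigPrime q) {n : ℤ} (h : 2 - eta q 1 ∣ (n : 𝓞 (Kq q))) :
    (q : ℤ) ∣ n := by
  obtain ⟨y, hy⟩ := h
  have h1 := hP.form_cast 1 y
  rw [← hy] at h1
  have h2 : ∑ s : (ZMod q)ˣ, emb s (n : 𝓞 (Kq q)) = n * (q - 1 : ℝ) := by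
    have := Fact.mk hP.prime
    simp only [map_intCast, Finset.sum_const, Finset.card_univ, ZMod.card_units_eq_totient,
      Nat.totient_prime hP.prime, nsmul_eq_mul]
    rw [Nat.cast_sub hP.prime.one_le]; push_cast; ring
  have hq : (q : ℝ) ≠ 0 := by exact_mod_cast NeZero.ne q
  rw [h2] at h1
  field_simp at h1
  have h3 : (q : ℤ) * (n - 2 * hP.form 1 y) = n := by
    have : (q : ℝ) * (n - 2 * hP.form 1 y) = n := by linear_combination -h1
    exact_mod_cast this
  exact ⟨_, h3.symm⟩

lemma dvd_of_dvd_natCast_mul_sq (hP : BigPrime q) {m : ℕ} (h0 : m ≠ 0) (hm : m < q) {z : 𝓞 (Kq q)}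
    (h : 2 - eta q 1 ∣ m * z ^ 2) : 2 - eta q 1 ∣ z := by
  obtain ⟨n, y, hy⟩ := hP.exists_int_congr z
  obtain ⟨x, hx⟩ := h
  have h1 : 2 - eta q 1 ∣ ((m * n ^ 2 : ℤ) : 𝓞 (Kq q)) := by
    refine ⟨x - m * (y * (z + n)), ?_⟩
    push_cast
    linear_combination hx - m * (z + n) * hy
  have h2 := hP.natCast_dvd_of_dvd h1
  have hp := Nat.prime_iff_prime_int.1 hP.prime
  have h3 : (q : ℤ) ∣ n := by
    rcases hp.dvd_or_dvd h2 with h | h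
    · have := Nat.le_of_dvd (Nat.pos_of_ne_zero h0) (Int.natCast_dvd_natCast.1 h)
      omega
    · exact hp.dvd_of_dvd_pow h
  obtain ⟨k, rfl⟩ := h3
  have h4 := (hP.dvd_natCast_self).mul_right (k : 𝓞 (Kq q))
  have := dvd_add (Dvd.intro y hy.symm) h4
  push_cast at this
  rwa [sub_add_cancel] at this

lemma not_dvd_of_congr (hP : BigPrime q) {m : ℕ} (h0 : m ≠ 0) (hm : m < q) {x : 𝓞 (Kq q)}
    (hx : 2 - eta q 1 ∣ m - x) : ¬ 2 - eta q 1 ∣ x := by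
  intro h
  have h1 := dvd_add hx h
  rw [sub_add_cancel] at h1
  have := Int.natCast_dvd_natCast.1 (hP.natCast_dvd_of_dvd (n := m) (by exact_mod_cast h1))
  have := Nat.le_of_dvd (Nat.pos_of_ne_zero h0) this
  omega

lemma not_dvd_natCast (hP : BigPrime q) {m : ℕ} (h0 : m ≠ 0) (hm : m < q) :
    ¬ 2 - eta q 1 ∣ (m : 𝓞 (Kq q)) :=
  hP.not_dvd_of_congr h0 hm (by simp)

/-! #### Elements with small forms -/

lemma Coeff.eq_of_sum_sq_le (hP : BigPrime q) {x : 𝓞 (Kq q)} {c} (h : Coeff x c)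
    (hc : ∑ i, c i ^ 2 ≤ 3) :
    (∃ a : ℤ, |a| ≤ 1 ∧ x = a) ∨
    ∃ a b : ℤ, ∃ i, i ≠ 0 ∧ a ^ 2 + 2 * b ^ 2 = ∑ i, c i ^ 2 ∧ |a| ≤ 1 ∧ b ^ 2 = 1 ∧
      x = a + b * eta q i := by
  have hle : ∀ s : Finset (ZMod q), ∑ i ∈ s, c i ^ 2 ≤ 3 := fun s =>
    (Finset.sum_le_sum_of_subset_of_nonneg (Finset.subset_univ s)
      fun i _ _ => sq_nonneg (c i)).trans hc
  have h0 : |c 0| ≤ 1 := by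
    have := hle {0}
    rw [Finset.sum_singleton] at this
    rw [abs_le]; constructor <;> nlinarith
  by_cases hz : ∀ i ≠ 0, c i = 0
  · left
    refine ⟨c 0, h0, mul_left_cancel₀ _root_.two_ne_zero ?_⟩
    rw [h.eq, Finset.sum_eq_single 0 (fun i _ hi => by rw [hz i hi, Int.cast_zero, zero_mul])
      (by simp), eta_zero, mul_comm]
  · right
    push Not at hz
    obtain ⟨i, hi, hci⟩ := hz
    have hne := hP.ne_neg hi
    have hci1 : c i ^ 2 = 1 := by
      have := hle {i, -i}
      rw [Finset.sum_pair hne, h.even] at this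
      have h1 : 0 < c i ^ 2 := by positivity
      omega
    have hk : ∀ k, k ≠ 0 → k ≠ i → k ≠ -i → c k = 0 := by
      intro k hk0 hki hki'
      by_contra hck
      have hkn := hP.ne_neg hk0
      have := hle {i, -i, k, -k}
      rw [Finset.sum_insert, Finset.sum_insert, Finset.sum_pair hkn, h.even, h.even] at this
      · have h1 : 0 < c k ^ 2 := by positivity
        omega
      · simp only [Finset.mem_insert, Finset.mem_singleton, neg_inj, not_or]
        exact ⟨fun h => hki' h.symm, fun h => hki h.symm⟩
      · simp only [Finset.mem_insert, Finset.mem_singleton, not_or]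
        exact ⟨hne, fun h => hki h.symm, fun h => hki' (by rw [h, neg_neg])⟩
    have hsub : ∀ k ∈ Finset.univ, k ∉ ({0, i, -i} : Finset (ZMod q)) → c k = 0 := by
      intro k _ hk'
      simp only [Finset.mem_insert, Finset.mem_singleton, not_or] at hk'
      exact hk k hk'.1 hk'.2.1 hk'.2.2
    have hni : (0 : ZMod q) ∉ ({i, -i} : Finset (ZMod q)) := by
      simp only [Finset.mem_insert, Finset.mem_singleton, not_or]
      exact ⟨hi.symm, fun h => hi (neg_eq_zero.1 h.symm)⟩
    refine ⟨c 0, c i, i, hi, ?_, h0, hci1, mul_left_cancel₀ _root_.two_ne_zero ?_⟩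
    · rw [← Finset.sum_subset (Finset.subset_univ {0, i, -i})
        (fun k hk hk' => by rw [hsub k hk hk']; rfl), Finset.sum_insert hni, Finset.sum_pair hne,
        h.even]
      ring
    · rw [h.eq, ← Finset.sum_subset (Finset.subset_univ {0, i, -i})
        (fun k hk hk' => by rw [hsub k hk hk', Int.cast_zero, zero_mul]), Finset.sum_insert hni,
        Finset.sum_pair hne, h.even, eta_neg, eta_zero]
      ring

lemma Coeff.abs_sum_le {x : 𝓞 (Kq q)} {c} (_h : Coeff x c) :
    |∑ i, c i| ≤ ∑ i, c i ^ 2 := by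
  refine (Finset.abs_sum_le_sum_abs _ _).trans (Finset.sum_le_sum fun i _ => ?_)
  rw [← sq_abs]
  exact Int.le_self_sq _

lemma eq_of_sum_form_sq_le (hP : BigPrime q) {x : 𝓞 (Kq q)}
    (h : ∑ j, hP.form j (x ^ 2) ≤ 2 * q - 3) : x = 0 ∨ x ^ 2 = 1 ∨ ∃ i ≠ 0, x ^ 2 = eta q i ^ 2 := by
  obtain ⟨c, hc, hs⟩ := hP.exists_coeff_small x
  have hsum := hc.abs_sum_le
  have hq7 : (7 : ℤ) ≤ q := by exact_mod_cast hP.seven_le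
  rw [hc.sum_form_sq hP, ← sq_abs] at h
  have hP2 : ∑ i, c i ^ 2 ≤ 2 := by
    by_contra hlt
    push Not at hlt
    set P := ∑ i, c i ^ 2
    set S := |∑ i, c i|
    have hS0 : 0 ≤ S := abs_nonneg _
    by_cases hPq : 2 * P < q
    · nlinarith
    · nlinarith
  rcases hc.eq_of_sum_sq_le hP (by omega) with ⟨a, ha, rfl⟩ | ⟨a, b, i, hi, hab, ha, hb, rfl⟩
  · rw [abs_le] at ha
    obtain h | h | h : a = -1 ∨ a = 0 ∨ a = 1 := by omega
    · right; left; rw [h]; norm_num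
    · left; rw [h]; norm_num
    · right; left; rw [h]; norm_num
  · right; right
    have ha0 : a = 0 := by
      have : a ^ 2 ≤ 0 := by omega
      nlinarith
    refine ⟨i, hi, ?_⟩
    rw [ha0, Int.cast_zero, zero_add, mul_pow]
    rw [show (b : 𝓞 (Kq q)) ^ 2 = 1 by exact_mod_cast hb, one_mul]

end BigPrime

namespace BigPrime

variable {q : ℕ} [NeZero q] {B : LinearMap.BilinForm (𝓞 (Kq q)) (Fin 3 → 𝓞 (Kq q))}

lemma sum_form_lower (hP : BigPrime q) {x : 𝓞 (Kq q)} {m : ℤ} (h : ∀ j ≠ 0, m ≤ hP.form j x) :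
    m * (q - 1) ≤ ∑ j, hP.form j x := by
  rw [← Finset.add_sum_erase _ _ (Finset.mem_univ 0), hP.form_zero_left, zero_add]
  have := Finset.sum_le_sum fun j (hj : j ∈ Finset.univ.erase (0 : ZMod q)) =>
    h j (Finset.mem_erase.1 hj).1
  rw [Finset.sum_const, Finset.card_erase_of_mem (Finset.mem_univ _), Finset.card_univ, ZMod.card,
    nsmul_eq_mul, Nat.cast_sub hP.prime.one_le] at this
  push_cast at this
  linarith

lemma sum_form_upper (hP : BigPrime q) {x : 𝓞 (Kq q)} {m : ℤ} (h : ∀ j ≠ 0, hP.form j x ≤ m) :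
    ∑ j, hP.form j x ≤ m * (q - 1) := by
  have := hP.sum_form_lower (x := -x) (m := -m) fun j hj => by
    rw [map_neg]; exact neg_le_neg (h j hj)
  simp only [map_neg, Finset.sum_neg_distrib] at this
  linarith

/-- If the forms of `x` are bounded by `2` and not all equal to `2`, their sum is at most
`2q - 3`. -/
lemma sum_form_lt (hP : BigPrime q) {x : 𝓞 (Kq q)} (h : ∀ j ≠ 0, hP.form j x ≤ 2) (h2 : x ≠ 2) :
    ∑ j, hP.form j x ≤ 2 * q - 3 := by
  have h1 := hP.sum_form_upper h
  by_contra hlt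
  push Not at hlt
  apply h2
  rw [← sub_eq_zero]
  apply hP.eq_zero_of_form
  intro j hj
  rw [map_sub, hP.form_ofNat hj]
  by_contra hne
  have h3 : ∑ i, hP.form i x = ∑ i ∈ Finset.univ.erase 0, hP.form i x := by
    rw [← Finset.add_sum_erase _ _ (Finset.mem_univ 0), hP.form_zero_left, zero_add]
  have hj' : j ∈ Finset.univ.erase (0 : ZMod q) := Finset.mem_erase.2 ⟨hj, Finset.mem_univ _⟩
  have h4 : ∑ i ∈ Finset.univ.erase 0, hP.form i x <
      ∑ i ∈ Finset.univ.erase (0 : ZMod q), (2 : ℤ) :=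
    Finset.sum_lt_sum (fun i hi => h i (Finset.mem_erase.1 hi).1)
      ⟨j, hj', lt_of_le_of_ne (h j hj) (fun h => hne (by rw [h, sub_self]))⟩
  rw [Finset.sum_const, Finset.card_erase_of_mem (Finset.mem_univ _), Finset.card_univ, ZMod.card,
    nsmul_eq_mul, Nat.cast_sub hP.prime.one_le] at h4
  push_cast at h4
  linarith

/-- There is an embedding sending `η_i` close to `2`. -/
lemma exists_emb_eta_gt (hP : BigPrime q) {i : ZMod q} (hi : i ≠ 0) :
    ∃ s, 1 < emb s (eta q i) := by
  obtain ⟨s, hs⟩ := hP.exists_unit_mul hi hP.one_ne_zero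
  refine ⟨s, ?_⟩
  rw [emb_eta, hs]
  have h := dcos_natCast (q := q) 1
  rw [Nat.cast_one, Nat.cast_one, mul_one] at h
  rw [h]
  have hq : (7 : ℝ) ≤ q := by exact_mod_cast hP.seven_le
  have hpi := Real.pi_lt_d2
  have hpi0 := Real.pi_pos
  have h1 := Real.one_sub_sq_div_two_le_cos (x := 2 * Real.pi / q)
  have h2 : 2 * Real.pi / q ≤ 9 / 10 := by rw [div_le_iff₀ (by linarith)]; linarith
  have h3 : 0 < 2 * Real.pi / q := by positivity
  nlinarith

lemma emb_one_eta_one_gt (hP : BigPrime q) : 1 < emb 1 (eta q 1) := by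
  obtain ⟨s, hs⟩ := hP.exists_emb_eta_gt hP.one_ne_zero
  refine hs.trans_le ?_
  rw [emb_eta, emb_eta, mul_one, mul_one, Units.val_one]
  have h7 := hP.seven_le
  have hv : (s : ZMod q).val ≠ 0 := by
    rw [Ne, ZMod.val_eq_zero]; exact (hP.isUnit_iff _).1 s.isUnit
  have := dcos_le_of_val (x := (s : ZMod q)) (j := 1) (by omega)
    (by have := ZMod.val_lt (s : ZMod q); omega)
  rwa [Nat.cast_one] at this

/-- There is an embedding sending `η_i` close to `-2`. -/
lemma exists_emb_eta_lt (hP : BigPrime q) {i : ZMod q} (hi : i ≠ 0) :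
    ∃ s, emb s (eta q i) < -1 := by
  obtain ⟨k, rfl⟩ := hP.exists_half i
  have hk : k ≠ 0 := by rintro rfl; simp at hi
  obtain ⟨d, hd⟩ : ∃ d, q = 2 * d + 1 := by
    have h1 := hP.prime.eq_two_or_odd
    have := hP.seven_le
    exact ⟨q / 2, by omega⟩
  have h7 := hP.seven_le
  obtain ⟨s, hs⟩ := hP.exists_unit_mul hi (hP.natCast_ne_zero (m := d) (by omega) (by omega))
  refine ⟨s, ?_⟩
  rw [emb_eta, hs, dcos_natCast]
  have hq : (q : ℝ) = 2 * d + 1 := by exact_mod_cast hd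
  have hq7 : (7 : ℝ) ≤ q := by exact_mod_cast h7
  rw [show 2 * Real.pi * d / q = Real.pi - Real.pi / q by
    rw [eq_sub_iff_add_eq, ← add_div, div_eq_iff (by linarith), hq]; ring, Real.cos_pi_sub]
  have hpi := Real.pi_lt_d2
  have hpi0 := Real.pi_pos
  have h1 := Real.one_sub_sq_div_two_le_cos (x := Real.pi / q)
  have h2 : Real.pi / q ≤ 9 / 20 := by rw [div_le_iff₀ (by linarith)]; linarith
  have h3 : 0 < Real.pi / q := by positivity
  nlinarith

lemma form_eta_le (hP : BigPrime q) {i : ZMod q} (hi : i ≠ 0) (j : ZMod q) :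
    hP.form j (eta q i) ≤ 0 := by
  rw [form_eta, if_neg hi]
  split_ifs <;> omega

lemma sum_form_eta (hP : BigPrime q) {i : ZMod q} (hi : i ≠ 0) :
    ∑ j, hP.form j (eta q i) = -2 := by
  simp only [form_eta, if_neg hi, Finset.sum_sub_distrib]
  have e : ∀ x : ZMod q, i = -x ↔ x = -i := fun x => by rw [eq_comm, neg_eq_iff_eq_neg]
  simp [e]

lemma sum_form_one (hP : BigPrime q) : ∑ j, hP.form j 1 = q - 1 := by
  apply le_antisymm
  · simpa using hP.sum_form_upper (x := 1) (m := 1) fun j hj => (hP.form_one hj).le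
  · simpa using hP.sum_form_lower (x := 1) (m := 1) fun j hj => (hP.form_one hj).ge

lemma sum_form_ofNat_mul (hP : BigPrime q) (n : ℕ) [n.AtLeastTwo] (x : 𝓞 (Kq q)) :
    ∑ j, hP.form j (ofNat(n) * x) = ofNat(n) * ∑ j, hP.form j x := by
  rw [Finset.mul_sum]
  exact Finset.sum_congr rfl fun j _ => by exact_mod_cast hP.form_zsmul j ofNat(n) x

lemma not_nn_one_sub_eta (hP : BigPrime q) {i : ZMod q} (hi : i ≠ 0) : ¬ NN (1 - eta q i) := by
  obtain ⟨s, hs⟩ := hP.exists_emb_eta_gt hi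
  intro h
  have := h s
  rw [map_sub, map_one] at this
  linarith

lemma not_nn_one_add_eta (hP : BigPrime q) {i : ZMod q} (hi : i ≠ 0) : ¬ NN (1 + eta q i) := by
  obtain ⟨s, hs⟩ := hP.exists_emb_eta_lt hi
  intro h
  have := h s
  rw [map_add, map_one] at this
  linarith

lemma tp_three_add_eta (a : ZMod q) : TP (3 + eta q a) := by
  have := tp_one.add_nn (nn_two_add_eta a)
  rwa [← add_assoc, show (1 : 𝓞 (Kq q)) + 2 = 3 by norm_num] at this

lemma eq_zero_of_nn_sub_sq (hP : BigPrime q) {x : 𝓞 (Kq q)} (h : NN (2 - eta q 1 - x ^ 2)) :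
    x = 0 := by
  have hne : 2 - eta q 1 - x ^ 2 ≠ 0 := fun h0 =>
    hP.sq_ne_two_sub_eta hP.one_ne_zero x (sub_eq_zero.1 h0).symm
  have htp := h.tp hne
  have h1 := hP.sum_form_lower (m := 1) fun j hj => hP.form_pos hj htp
  have h2 := hP.sum_form_ofNat_mul 2 1
  have hq7 : (7 : ℤ) ≤ q := by exact_mod_cast hP.seven_le
  simp only [map_sub, Finset.sum_sub_distrib, hP.sum_form_eta hP.one_ne_zero] at h1
  rw [mul_one, hP.sum_form_one] at h2
  rw [h2] at h1
  rcases hP.eq_of_sum_form_sq_le (x := x) (by linarith) with h | h | ⟨i, hi, h⟩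
  · exact h
  · have := htp 1
    rw [h, map_sub, map_sub, map_one, map_ofNat] at this
    linarith [hP.emb_one_eta_one_gt]
  · exfalso
    rw [h] at htp
    have h1 := hP.sum_form_lower (m := 1) fun j hj => hP.form_pos hj htp
    have h2i : 2 * i ≠ 0 := fun h0 => (hP.mul_eq_zero.1 h0).elim hP.two_ne_zero hi
    rw [eta_sq, sub_add_eq_sub_sub_swap, sub_sub_cancel_left] at h1
    simp only [map_sub, map_neg, Finset.sum_sub_distrib, Finset.sum_neg_distrib,
      hP.sum_form_eta hP.one_ne_zero, hP.sum_form_eta h2i] at h1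
    linarith

lemma two_eq_sq_add (hP : BigPrime q) {x r : 𝓞 (Kq q)} (hr : NN r) (h : 2 = x ^ 2 + r)
    (hx : x ≠ 0) : x ^ 2 = 1 ∧ r = 1 := by
  have hr0 : r ≠ 0 := by
    rintro rfl
    exact hP.sq_ne_two x (by rw [h, add_zero])
  have h1 : x ^ 2 = 1 := by
    rw [← sub_eq_zero]
    apply hP.eq_zero_of_form
    intro j hj
    have h2 := congrArg (hP.form j) h
    rw [map_add, hP.form_ofNat hj] at h2
    have h3 := hP.form_pos hj (tp_sq hx)
    have h4 := hP.form_pos hj (hr.tp hr0)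
    rw [map_sub, hP.form_one hj]
    omega
  exact ⟨h1, by rw [h1] at h; linear_combination -h⟩

lemma three_eq_sq_add (hP : BigPrime q) {x r : 𝓞 (Kq q)} (hr : NN r) (h : 3 = x ^ 2 + r)
    (hx : x ≠ 0) : x ^ 2 = 1 ∧ r = 2 := by
  have hr0 : r ≠ 0 := by
    rintro rfl
    exact hP.sq_ne_three x (by rw [h, add_zero])
  have h1 := hP.sum_form_lt (x := x ^ 2) (fun j hj => by
    have h2 := congrArg (hP.form j) h
    rw [map_add, hP.form_ofNat hj] at h2
    have h4 := hP.form_pos hj (hr.tp hr0)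
    omega) (hP.sq_ne_two x)
  rcases hP.eq_of_sum_form_sq_le h1 with h0 | h0 | ⟨i, hi, h0⟩
  · exact absurd h0 hx
  · exact ⟨h0, by rw [h0] at h; linear_combination -h⟩
  · exfalso
    have h2i : 2 * i ≠ 0 := fun h0 => (hP.mul_eq_zero.1 h0).elim hP.two_ne_zero hi
    apply hP.not_nn_one_sub_eta h2i
    rw [h0, eta_sq] at h
    rwa [show 1 - eta q (2 * i) = r by linear_combination h]

lemma exists_alpha (hP : BigPrime q) (hB : UnivTernary B) {e} (he : B e e = 1) :
    ∃ v, B v e = 0 ∧ B v v = 2 - eta q 1 := by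
  obtain ⟨v, hv⟩ := hB.univ _ (tp_two_sub_eta hP.one_ne_zero)
  obtain ⟨w, hw, hvw⟩ := hB.split he v
  refine ⟨w, hw, ?_⟩
  rw [hv] at hvw
  have := hP.eq_zero_of_nn_sub_sq (x := B v e) (by
    rw [hvw, add_sub_cancel_left]; exact hB.nn w)
  rw [hvw, this]; ring

lemma one_ne_alpha_mul (hP : BigPrime q) {m : ℕ} (h0 : m ≠ 0) (hm : m < 7) (x : 𝓞 (Kq q)) :
    (m : 𝓞 (Kq q)) ≠ (2 - eta q 1) * x := fun h =>
  hP.not_dvd_natCast h0 (hm.trans_le hP.seven_le) ⟨x, h⟩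

/-- The orthogonal complement of a vector of norm `1` does not represent `1`. -/
lemma ne_one_of_orthogonal (hP : BigPrime q) (hB : UnivTernary B) {e} (he : B e e = 1) {e'}
    (hee' : B e' e = 0) : B e' e' ≠ 1 := by
  intro he'
  obtain ⟨v, hve, hv⟩ := hP.exists_alpha hB he
  have hα := tp_two_sub_eta (q := q) hP.one_ne_zero
  have hb : B e' v = 0 := by
    apply hP.eq_zero_of_nn_sub_sq
    have := hB.cauchySchwarz e' v
    rwa [he', hv, one_mul] at this
  have he0 : e ≠ 0 := by rintro rfl; simp at he
  have he'0 : e' ≠ 0 := by rintro rfl; simp at he'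
  have hv0 : v ≠ 0 := by rintro rfl; simp at hv; exact hα.ne_zero hv.symm
  obtain ⟨y, hy⟩ := hB.univ 3 (tp_ofNat 3)
  have hexp := hB.expand_orthogonal he0 he'0 hv0 hee' hve (by rw [hB.symm, hb]) y
  rw [he, he', hv, hy] at hexp
  obtain ⟨z, hz⟩ := hP.dvd_of_dvd_natCast_mul_sq (m := 1) _root_.one_ne_zero hP.prime.one_lt
    (z := B y v) ⟨3 - B y e ^ 2 - B y e' ^ 2, by push_cast; linear_combination -hexp⟩
  rw [hz] at hexp
  have h3 : 3 = B y e ^ 2 + (B y e' ^ 2 + (2 - eta q 1) * z ^ 2) := by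
    apply mul_left_cancel₀ hα.ne_zero
    linear_combination hexp
  have hr : NN ((2 - eta q 1) * z ^ 2) := hα.nn.mul (nn_sq z)
  have hone := hP.one_ne_alpha_mul (m := 1) _root_.one_ne_zero (by norm_num) (z ^ 2)
  have htwo := hP.one_ne_alpha_mul (m := 2) (by norm_num) (by norm_num) (z ^ 2)
  have hthree := hP.one_ne_alpha_mul (m := 3) (by norm_num) (by norm_num) (z ^ 2)
  push_cast at hone htwo hthree
  have not_two : ∀ t : 𝓞 (Kq q), t ^ 2 + (2 - eta q 1) * z ^ 2 ≠ 2 := by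
    intro t ht
    by_cases ht0 : t = 0
    · exact htwo (by rw [ht0] at ht; linear_combination -ht)
    · exact hone (hP.two_eq_sq_add hr ht.symm ht0).2.symm
  by_cases hx : B y e = 0
  · by_cases hx' : B y e' = 0
    · exact hthree (by rw [h3, hx, hx']; ring)
    · exact htwo (hP.three_eq_sq_add hr (by rw [h3, hx]; ring) hx').2.symm
  · exact not_two _ (hP.three_eq_sq_add ((nn_sq _).add hr) h3 hx).2

lemma exists_two (hP : BigPrime q) (hB : UnivTernary B) {e} (he : B e e = 1) :
    ∃ w, B w e = 0 ∧ B w w = 2 := by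
  obtain ⟨v, hv⟩ := hB.univ 2 (tp_ofNat 2)
  obtain ⟨w, hw, hvw⟩ := hB.split he v
  refine ⟨w, hw, ?_⟩
  rw [hv] at hvw
  by_cases hx : B v e = 0
  · rw [hvw, hx]; ring
  · exact absurd (hP.two_eq_sq_add (hB.nn w) hvw hx).2 (hP.ne_one_of_orthogonal hB he hw)

/-- The contradiction in the diagonal case. -/
lemma false_of_orthogonal (hP : BigPrime q) (hB : UnivTernary B) {e v w} (he : B e e = 1)
    (hve : B v e = 0) (hv : B v v = 2 - eta q 1) (hwe : B w e = 0) (hw : B w w = 2)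
    (hb : B w v = 0) : False := by
  have hα := tp_two_sub_eta (q := q) hP.one_ne_zero
  have he0 : e ≠ 0 := by rintro rfl; simp at he
  have hw0 : w ≠ 0 := by rintro rfl; simp at hw
  have hv0 : v ≠ 0 := by rintro rfl; simp at hv; exact hα.ne_zero hv.symm
  obtain ⟨y, hy⟩ := hB.univ _ (tp_three_add_eta (q := q) 1)
  have hexp := hB.expand_orthogonal he0 hw0 hv0 hwe hve (by rw [hB.symm, hb]) y
  rw [he, hw, hv, hy] at hexp
  obtain ⟨z, hz⟩ := hP.dvd_of_dvd_natCast_mul_sq (m := 2) (by norm_num)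
    (by have := hP.seven_le; omega)
    (z := B y v) ⟨2 * (3 + eta q 1) - 2 * B y e ^ 2 - B y w ^ 2,
      by push_cast; linear_combination -hexp⟩
  rw [hz] at hexp
  have h2 : 2 * (3 + eta q 1) = 2 * B y e ^ 2 + B y w ^ 2 + 2 * ((2 - eta q 1) * z ^ 2) := by
    apply mul_left_cancel₀ hα.ne_zero
    linear_combination hexp
  obtain ⟨t, ht⟩ := hP.two_dvd_of_sq (x := B y w)
    ⟨3 + eta q 1 - B y e ^ 2 - (2 - eta q 1) * z ^ 2, by linear_combination -h2⟩
  rw [ht] at h2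
  set x := B y e
  have h3 : 3 + eta q 1 = x ^ 2 + 2 * t ^ 2 + (2 - eta q 1) * z ^ 2 := by
    apply mul_left_cancel₀ (_root_.two_ne_zero (α := 𝓞 (Kq q)))
    linear_combination h2
  have hr : NN ((2 - eta q 1) * z ^ 2) := hα.nn.mul (nn_sq z)
  have hform : ∀ {j : ZMod q}, j ≠ 0 → hP.form j (3 + eta q 1) ≤ 3 := fun {j} hj => by
    rw [map_add, hP.form_ofNat hj]
    linarith [hP.form_eta_le hP.one_ne_zero j]
  by_cases ht0 : t = 0
  swap
  · have ht1 : t ^ 2 = 1 := by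
      rw [← sub_eq_zero]
      apply hP.eq_zero_of_form
      intro j hj
      have h4 := congrArg (hP.form j) h3
      rw [map_add _ (x ^ 2 + _), map_add _ (x ^ 2), hP.form_two_mul] at h4
      have h5 := hP.form_pos hj (tp_sq ht0)
      have h6 := hP.form_nonneg j (nn_sq x)
      have h7 := hP.form_nonneg j hr
      have h8 := hform hj
      rw [map_sub, hP.form_one hj]
      omega
    apply hP.not_nn_one_add_eta hP.one_ne_zero
    rw [show 1 + eta q 1 = x ^ 2 + (2 - eta q 1) * z ^ 2 by rw [ht1] at h3; linear_combination h3]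
    exact (nn_sq x).add hr
  rw [ht0] at h3
  have h4 : 3 + eta q 1 = x ^ 2 + (2 - eta q 1) * z ^ 2 := by linear_combination h3
  have hlt : ∀ {m : ℕ}, m < 7 → m < q := fun h => h.trans_le hP.seven_le
  have hne : 3 + eta q 1 ≠ (2 - eta q 1) * z ^ 2 := fun h =>
    hP.not_dvd_of_congr (m := 5) (by norm_num) (hlt (by norm_num)) (x := 3 + eta q 1)
      ⟨1, by push_cast; ring⟩ ⟨_, h⟩
  have hz0 : z ≠ 0 := by
    rintro rfl
    exact hP.sq_ne_three_add_eta hP.one_ne_zero x (by linear_combination -h4)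
  have h5 := hP.sum_form_lt (x := x ^ 2) (fun j hj => by
    have h4 := congrArg (hP.form j) h4
    rw [map_add _ (x ^ 2)] at h4
    have h5 := hP.form_pos hj (hα.mul (tp_sq hz0))
    have h6 := hform hj
    omega) (hP.sq_ne_two x)
  rcases hP.eq_of_sum_form_sq_le h5 with h | h | ⟨i, hi, h⟩
  · exact hne (by rw [h4, h]; ring)
  · exact hP.not_dvd_of_congr (m := 4) (by norm_num) (hlt (by norm_num)) (x := 2 + eta q 1)
      ⟨1, by push_cast; ring⟩ ⟨z ^ 2, by rw [h] at h4; linear_combination h4⟩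
  · obtain ⟨u, hu⟩ := dvd_two_sub_eta (q := q) (2 * i)
    refine hP.not_dvd_of_congr (m := 1) (by norm_num) (hlt (by norm_num))
      (x := 1 + eta q 1 - eta q (2 * i)) ⟨1 - u, ?_⟩ ⟨z ^ 2, ?_⟩
    · push_cast; linear_combination -hu
    · rw [h, eta_sq] at h4; linear_combination h4

end BigPrime

namespace BigPrime

variable {q : ℕ} [NeZero q] {b : 𝓞 (Kq q)}

lemma form_two_sub_eta (hP : BigPrime q) {j : ZMod q} (hj : j ≠ 0) :
    hP.form j (2 - eta q 1) = 2 + (if j = 1 then 1 else 0) + (if j = -1 then 1 else 0) := by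
  rw [map_sub, hP.form_ofNat hj, form_eta, if_neg hP.one_ne_zero]
  have e : (1 : ZMod q) = -j ↔ j = -1 := by rw [eq_neg_iff_add_eq_zero, eq_neg_iff_add_eq_zero,
    add_comm]
  simp only [e, eq_comm (a := (1 : ZMod q))]
  ring

lemma tp_two_mul_sub_sq (hP : BigPrime q) (h : NN (2 * (2 - eta q 1) - b ^ 2)) :
    TP (2 * (2 - eta q 1) - b ^ 2) := by
  refine h.tp fun h0 => ?_
  obtain ⟨m, rfl⟩ := hP.two_dvd_of_sq (x := b) ⟨2 - eta q 1, by linear_combination -h0⟩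
  have h1 : 2 - eta q 1 = 2 * m ^ 2 := by
    apply mul_left_cancel₀ (_root_.two_ne_zero (α := 𝓞 (Kq q)))
    linear_combination h0
  have h2 := congrArg (hP.form 1) h1
  rw [hP.form_two_sub_eta hP.one_ne_zero, hP.form_two_mul, if_pos rfl,
    if_neg (hP.ne_neg hP.one_ne_zero)] at h2
  omega

lemma form_sq_le_three (hP : BigPrime q) (h : NN (2 * (2 - eta q 1) - b ^ 2)) {j : ZMod q}
    (hj : j ≠ 0) (hj1 : j ≠ 1) (hj2 : j ≠ -1) : hP.form j (b ^ 2) ≤ 3 := by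
  have := hP.form_pos hj (hP.tp_two_mul_sub_sq h)
  rw [map_sub, hP.form_two_mul, hP.form_two_sub_eta hj, if_neg hj1, if_neg hj2] at this
  omega

lemma sum_form_sub_sq (hP : BigPrime q) :
    ∑ j, hP.form j (2 * (2 - eta q 1) - b ^ 2) = 4 * q - ∑ j, hP.form j (b ^ 2) := by
  have h2 := hP.sum_form_ofNat_mul 2 1
  rw [mul_one, hP.sum_form_one] at h2
  simp only [map_sub, Finset.sum_sub_distrib, hP.sum_form_ofNat_mul, mul_sub,
    hP.sum_form_eta hP.one_ne_zero]
  rw [h2]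
  ring

lemma sum_form_sq_le_add_one (hP : BigPrime q) (h : NN (2 * (2 - eta q 1) - b ^ 2)) :
    ∑ j, hP.form j (b ^ 2) ≤ 3 * q + 1 := by
  have h1 := hP.sum_form_lower (m := 1) fun j hj => hP.form_pos hj (hP.tp_two_mul_sub_sq h)
  rw [hP.sum_form_sub_sq] at h1
  linarith

lemma sum_form_sq_le (hP : BigPrime q) (h : NN (2 * (2 - eta q 1) - b ^ 2))
    (hh : 3 / 2 < emb 1 (eta q 1)) : ∑ j, hP.form j (b ^ 2) ≤ 3 * q := by
  by_contra hlt
  push Not at hlt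
  have h0 := hP.sum_form_sub_sq (b := b)
  have htp := hP.tp_two_mul_sub_sq h
  have h1 : 2 * (2 - eta q 1) - b ^ 2 - 1 = 0 := by
    apply hP.eq_zero_of_form
    have hnn : ∀ j, 0 ≤ hP.form j (2 * (2 - eta q 1) - b ^ 2 - 1) := fun j => by
      by_cases hj : j = 0
      · rw [hj, hP.form_zero_left]
      · rw [map_sub, hP.form_one hj]
        linarith [hP.form_pos hj htp]
    have hs : ∑ j, hP.form j (2 * (2 - eta q 1) - b ^ 2 - 1) ≤ 0 := by
      rw [Finset.sum_congr rfl fun j _ => map_sub (hP.form j) _ 1, Finset.sum_sub_distrib, h0,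
        hP.sum_form_one]
      linarith
    intro j _
    exact (Finset.sum_eq_zero_iff_of_nonneg fun j _ => hnn j).1
      (le_antisymm hs (Finset.sum_nonneg fun j _ => hnn j)) j (Finset.mem_univ j)
  have h2 := nn_sq b 1
  rw [show b ^ 2 = 3 - 2 * eta q 1 by linear_combination -h1] at h2
  simp only [map_sub, map_mul, map_ofNat] at h2
  linarith

lemma emb_one_eta_one_ge {m : ℝ} (hm0 : 0 < m) (hm : m ≤ q) :
    2 - (6.284 / m) ^ 2 ≤ emb 1 (eta q 1) := by
  have h := dcos_natCast (q := q) 1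
  rw [Nat.cast_one, Nat.cast_one, mul_one] at h
  rw [emb_eta, Units.val_one, mul_one, h]
  have hpi := Real.pi_lt_d4
  have hpi0 := Real.pi_pos
  have h1 := Real.one_sub_sq_div_two_le_cos (x := 2 * Real.pi / q)
  have hq : 0 < (q : ℝ) := hm0.trans_le hm
  have h2 : 2 * Real.pi / q ≤ 6.284 / m := by
    apply div_le_div₀ <;> linarith
  have h3 : 0 < 2 * Real.pi / q := by positivity
  nlinarith

lemma eta_two_mul (a : ZMod q) : eta q (2 * a) = eta q a ^ 2 - 2 := by
  rw [eta_sq, add_sub_cancel_right]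

lemma eta_three_mul (a : ZMod q) : eta q (3 * a) = eta q a ^ 3 - 3 * eta q a := by
  have h := eta_mul (q := q) (2 * a) a
  rw [show 2 * a + a = 3 * a by ring, show 2 * a - a = a by ring, eta_two_mul] at h
  linear_combination -h

/-- The possible entries of the Gram matrix. -/
def SmallEntry (b : 𝓞 (Kq q)) : Prop :=
  b = 0 ∨ b ^ 2 = 1 ∨ ∃ i ≠ 0, b ^ 2 = eta q i ^ 2 ∨ b ^ 2 = (1 + eta q i) ^ 2 ∨
    b ^ 2 = (1 - eta q i) ^ 2

lemma Coeff.smallEntry (hP : BigPrime q) {c} (h : Coeff b c) (hc : ∑ i, c i ^ 2 ≤ 3) :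
    SmallEntry b := by
  have habs : ∀ {a : ℤ}, |a| ≤ 1 → a = -1 ∨ a = 0 ∨ a = 1 := fun {a} ha => by
    rw [abs_le] at ha; omega
  rcases h.eq_of_sum_sq_le hP hc with ⟨a, ha, rfl⟩ | ⟨a, b, i, hi, hab, ha, hb, rfl⟩
  · rcases habs ha with rfl | rfl | rfl
    · right; left; norm_num
    · left; norm_num
    · right; left; norm_num
  · right; right
    refine ⟨i, hi, ?_⟩
    have hb' : b = 1 ∨ b = -1 := sq_eq_one_iff.1 hb
    rcases habs ha with rfl | rfl | rfl <;> rcases hb' with rfl | rfl <;> push_cast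
    · right; right; ring
    · right; left; ring
    · left; ring
    · left; ring
    · right; left; ring
    · right; right; ring

lemma sum_sq_sub_sum_emod_two (c : ZMod q → ℤ) : (∑ i, c i ^ 2 - ∑ i, c i) % 2 = 0 := by
  rw [← Finset.sum_sub_distrib]
  refine Int.emod_eq_zero_of_dvd (Finset.dvd_sum fun i _ => ?_)
  rw [show c i ^ 2 - c i = (c i - 1) * (c i - 1 + 1) by ring]
  exact (Int.even_mul_succ_self _).two_dvd

lemma smallEntry_of_nn (hP : BigPrime q) (hq : q = 7 ∨ 17 ≤ q)
    (h : NN (2 * (2 - eta q 1) - b ^ 2)) : SmallEntry b := by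
  obtain ⟨c, hc, hs⟩ := hP.exists_coeff_small b
  have hsum := hc.abs_sum_le
  refine hc.smallEntry hP ?_
  by_contra hlt
  push Not at hlt
  have hS0 : 0 ≤ |∑ i, c i| := abs_nonneg _
  rcases hq with hq | hq
  · have h1 := hP.sum_form_sq_le_add_one h
    rw [hc.sum_form_sq hP, ← sq_abs] at h1
    have hq' : (q : ℤ) = 7 := by exact_mod_cast hq
    rw [hq'] at h1 hs
    have hpar := sum_sq_sub_sum_emod_two c
    have habs : |∑ i, c i| = ∑ i, c i ∨ |∑ i, c i| = -∑ i, c i := abs_choice _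
    have hpar' : (∑ i, c i ^ 2 - |∑ i, c i|) % 2 = 0 := by omega
    generalize ∑ i, c i ^ 2 = P at *
    generalize |∑ i, c i| = S at *
    have hS : S ≤ 3 := by omega
    have hP5 : P ≤ 4 := by nlinarith
    interval_cases P <;> interval_cases S <;> omega
  · have hq' : (17 : ℤ) ≤ q := by exact_mod_cast hq
    have hh := emb_one_eta_one_ge (m := 17) (by norm_num) (by exact_mod_cast hq)
    have h1 := hP.sum_form_sq_le h (by norm_num at hh ⊢; linarith)
    rw [hc.sum_form_sq hP, ← sq_abs] at h1
    set P := ∑ i, c i ^ 2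
    set S := |∑ i, c i|
    by_cases hPq : 2 * P < q
    · nlinarith
    · nlinarith

/-- In the remaining cases all nonzero coefficients are equal to the same sign. -/
lemma smallEntry_or_indicator (hP : BigPrime q) (hq : q = 11 ∨ q = 13)
    (h : NN (2 * (2 - eta q 1) - b ^ 2)) (hh : 3 / 2 < emb 1 (eta q 1)) :
    SmallEntry b ∨ ∃ (e : ℤ) (p : ZMod q → Bool), e ^ 2 = 1 ∧ (∀ i, p (-i) = p i) ∧
      2 * b = e * ∑ i, (if p i then eta q i else 0) ∧
      (((∑ i, if p i then 1 else 0) = 4) ∨ (q = 11 ∧ (∑ i, if p i then 1 else 0) = 5)) ∧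
      ∀ j, j ≠ 0 → j ≠ 1 → j ≠ -1 →
        (∑ i, if p i then 1 else 0) ≤ (∑ i, if p i && p (i + j) then 1 else 0) + 3 := by
  obtain ⟨c, hc, hs⟩ := hP.exists_coeff_small b
  have hsum := hc.abs_sum_le
  by_cases hlt : ∑ i, c i ^ 2 ≤ 3
  · exact Or.inl (hc.smallEntry hP hlt)
  right
  push Not at hlt
  have h1 := hP.sum_form_sq_le h hh
  have hpar := sum_sq_sub_sum_emod_two c
  have key : |∑ i, c i| = ∑ i, c i ^ 2 ∧ (∑ i, c i ^ 2 = 4 ∨ q = 11 ∧ ∑ i, c i ^ 2 = 5) := by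
    rw [hc.sum_form_sq hP, ← sq_abs] at h1
    have habs : |∑ i, c i| = ∑ i, c i ∨ |∑ i, c i| = -∑ i, c i := abs_choice _
    have hpar' : (∑ i, c i ^ 2 - |∑ i, c i|) % 2 = 0 := by omega
    have hS0 : 0 ≤ |∑ i, c i| := abs_nonneg _
    generalize ∑ i, c i ^ 2 = P at *
    generalize |∑ i, c i| = S at *
    rcases hq with hq | hq
    · have hq' : (q : ℤ) = 11 := by exact_mod_cast hq
      rw [hq'] at h1 hs
      have hS : S ≤ 5 := by omega
      have hP5 : P ≤ 5 := by nlinarith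
      interval_cases P <;> interval_cases S <;> omega
    · have hq' : (q : ℤ) = 13 := by exact_mod_cast hq
      rw [hq'] at h1 hs
      have hS : S ≤ 6 := by omega
      have hP5 : P ≤ 5 := by nlinarith
      interval_cases P <;> interval_cases S <;> omega
  obtain ⟨hS, hcard⟩ := key
  obtain ⟨e, he, heS⟩ : ∃ e : ℤ, e ^ 2 = 1 ∧ ∑ i, c i ^ 2 = ∑ i, e * c i := by
    rw [← hS]
    rcases abs_choice (∑ i, c i) with h | h
    · exact ⟨1, by norm_num, by rw [h, ← Finset.mul_sum, one_mul]⟩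
    · exact ⟨-1, by norm_num, by rw [h, ← Finset.mul_sum]; ring⟩
  have hec : ∀ i, c i = 0 ∨ c i = e := by
    have hnn : ∀ i ∈ Finset.univ, 0 ≤ c i ^ 2 - e * c i := fun i _ => by
      rw [show c i ^ 2 - e * c i = (e * c i) ^ 2 - e * c i by rw [mul_pow, he, one_mul]]
      exact sub_nonneg.2 (Int.le_self_sq _)
    have h0 : ∑ i, (c i ^ 2 - e * c i) = 0 := by rw [Finset.sum_sub_distrib, heS, sub_self]
    intro i
    have := (Finset.sum_eq_zero_iff_of_nonneg hnn).1 h0 i (Finset.mem_univ i)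
    rw [show c i ^ 2 - e * c i = c i * (c i - e) by ring, _root_.mul_eq_zero, sub_eq_zero] at this
    exact this
  have he0 : e ≠ 0 := by rintro rfl; norm_num at he
  have hsq : ∀ i, c i ^ 2 = if decide (c i ≠ 0) then 1 else 0 := fun i => by
    rcases hec i with h | h <;> simp [h, he0, he]
  have hprod : ∀ i j, c i * c (i + j) =
      if decide (c i ≠ 0) && decide (c (i + j) ≠ 0) then 1 else 0 := fun i j => by
    rcases hec i with h | h <;> rcases hec (i + j) with h' | h' <;>
      simp [h, h', he0, ← sq, he]
  have hcast : ((∑ i, if decide (c i ≠ 0) then 1 else 0 : ℕ) : ℤ) = ∑ i, c i ^ 2 := by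
    simp only [hsq]; push_cast; rfl
  refine ⟨e, fun i => decide (c i ≠ 0), he, fun i => by simp only [hc.even], ?_, ?_, ?_⟩
  · rw [hc.eq, Finset.mul_sum]
    refine Finset.sum_congr rfl fun i _ => ?_
    rcases hec i with h | h <;> simp [h, he0]
  · rcases hcard with h | ⟨h', h⟩
    · left; rw [h] at hcast; exact_mod_cast hcast
    · right; rw [h] at hcast; exact ⟨h', by exact_mod_cast hcast⟩
  · intro j hj0 hj1 hj2
    have h3 := hP.form_sq_le_three h hj0 hj1 hj2
    rw [hc.form_sq hP, ← hcast] at h3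
    simp only [hprod] at h3
    have : ((∑ i, if decide (c i ≠ 0) then 1 else 0 : ℕ) : ℤ) ≤
        ((∑ i, if decide (c i ≠ 0) && decide (c (i + j) ≠ 0) then 1 else 0 : ℕ) : ℤ) + 3 := by
      push_cast at h3 ⊢; linarith
    exact_mod_cast this

end BigPrime

namespace BigPrime

variable {q : ℕ} [NeZero q] {b : 𝓞 (Kq q)}

lemma dcos_two_mul (a : ZMod q) : dcos q (2 * a) = dcos q a ^ 2 - 2 := by
  have h := congrArg (emb 1) (eta_two_mul a)
  rwa [map_sub, map_pow, map_ofNat, emb_eta, emb_eta, Units.val_one, one_mul, one_mul] at h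

lemma dcos_three_mul (a : ZMod q) : dcos q (3 * a) = dcos q a ^ 3 - 3 * dcos q a := by
  have h := congrArg (emb 1) (eta_three_mul a)
  rwa [map_sub, map_pow, map_mul, map_ofNat, emb_eta, emb_eta, Units.val_one, one_mul, one_mul] at h

lemma place (hP : BigPrime q) (h : NN (2 * (2 - eta q 1) - b ^ 2)) {m : ZMod q} (hm : m ≠ 0) :
    ∃ s : (ZMod q)ˣ, (∀ a, emb s (eta q a) = dcos q (m * a)) ∧
      emb s (b ^ 2) ≤ 4 - 2 * dcos q m := by
  obtain ⟨s, hs⟩ := (hP.isUnit_iff m).2 hm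
  have he : ∀ a, emb s (eta q a) = dcos q (m * a) := fun a => by rw [emb_eta, hs]
  refine ⟨s, he, ?_⟩
  have := h s
  rw [map_sub, map_mul, map_sub, he, mul_one, map_ofNat] at this
  linarith

lemma place_one (hP : BigPrime q) (h : NN (2 * (2 - eta q 1) - b ^ 2)) (hb : b ^ 2 = 1)
    {m : ZMod q} (hm : m ≠ 0) : 1 ≤ 4 - 2 * dcos q m := by
  obtain ⟨s, -, h1⟩ := hP.place h hm
  rwa [hb, map_one] at h1

lemma place_eta (hP : BigPrime q) (h : NN (2 * (2 - eta q 1) - b ^ 2)) {i : ZMod q}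
    (hb : b ^ 2 = eta q i ^ 2) {m : ZMod q} (hm : m ≠ 0) :
    dcos q (m * i) ^ 2 ≤ 4 - 2 * dcos q m := by
  obtain ⟨s, he, h1⟩ := hP.place h hm
  rwa [hb, map_pow, he] at h1

lemma place_one_add (hP : BigPrime q) (h : NN (2 * (2 - eta q 1) - b ^ 2)) {i : ZMod q}
    (hb : b ^ 2 = (1 + eta q i) ^ 2) {m : ZMod q} (hm : m ≠ 0) :
    (1 + dcos q (m * i)) ^ 2 ≤ 4 - 2 * dcos q m := by
  obtain ⟨s, he, h1⟩ := hP.place h hm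
  rwa [hb, map_pow, map_add, map_one, he] at h1

lemma place_one_sub (hP : BigPrime q) (h : NN (2 * (2 - eta q 1) - b ^ 2)) {i : ZMod q}
    (hb : b ^ 2 = (1 - eta q i) ^ 2) {m : ZMod q} (hm : m ≠ 0) :
    (1 - dcos q (m * i)) ^ 2 ≤ 4 - 2 * dcos q m := by
  obtain ⟨s, he, h1⟩ := hP.place h hm
  rwa [hb, map_pow, map_sub, map_one, he] at h1

lemma three_ne_zero (hP : BigPrime q) : (3 : ZMod q) ≠ 0 := by
  exact_mod_cast hP.natCast_ne_zero (m := 3) (by norm_num) (by have := hP.seven_le; omega)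

lemma sub_eta_eq (hP : BigPrime q) (h : NN (2 * (2 - eta q 1) - b ^ 2)) {i : ZMod q} (hi : i ≠ 0)
    (hb : b ^ 2 = (1 - eta q i) ^ 2) : b ^ 2 = (1 - eta q 1) ^ 2 := by
  by_cases h1 : i = 1
  · rw [hb, h1]
  by_cases h2 : i = -1
  · rw [hb, h2, eta_neg]
  exfalso
  have h3 := hP.form_sq_le_three h hi h1 h2
  have h2i : 2 * i ≠ 0 := fun h0 => (hP.mul_eq_zero.1 h0).elim hP.two_ne_zero hi
  rw [hb, show (1 - eta q i) ^ 2 = 3 - 2 * eta q i + eta q (2 * i) by rw [eta_two_mul]; ring,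
    map_add, map_sub, hP.form_ofNat hi, hP.form_two_mul, form_eta, form_eta, if_neg hi, if_neg h2i,
    if_pos rfl, if_neg (hP.ne_neg hi)] at h3
  rw [if_neg fun h => hi (by linear_combination h), if_neg fun h => ?_] at h3
  · omega
  · have : 3 * i = 0 := by linear_combination h
    exact (hP.mul_eq_zero.1 this).elim hP.three_ne_zero hi

lemma SmallEntry.eq_zero (hP : BigPrime q) (hq : 13 ≤ q) (h : NN (2 * (2 - eta q 1) - b ^ 2))
    (hb : SmallEntry b) : b = 0 := by
  have hh := emb_one_eta_one_ge (q := q) (m := 13) (by norm_num) (by exact_mod_cast hq)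
  rw [emb_eta, Units.val_one, mul_one] at hh
  have h1 := hP.one_ne_zero
  have h2 := hP.two_ne_zero
  have h3 := hP.three_ne_zero
  have e2 := dcos_two_mul (q := q) 1
  have e3 := dcos_three_mul (q := q) 1
  rw [mul_one] at e2 e3
  set x := dcos q 1
  have hx : 1.7663 ≤ x := by norm_num at hh ⊢; linarith
  have hx2 : 3.1198 ≤ x ^ 2 := by nlinarith
  have hx3 : 0.2115 ≤ x ^ 3 - 3 * x := by nlinarith
  rcases hb with hb | hb | ⟨i, hi, hb | hb | hb⟩
  · exact hb
  · have := hP.place_one h hb h1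
    linarith
  · have a1 := hP.place_eta h hb h1
    have a2 := hP.place_eta h hb h2
    rw [dcos_two_mul, e2] at a2
    rw [one_mul] at a1
    nlinarith
  · have a1 := hP.place_one_add h hb h1
    have a2 := hP.place_one_add h hb h2
    have a3 := hP.place_one_add h hb h3
    rw [dcos_two_mul, e2] at a2
    rw [dcos_three_mul, e3] at a3
    rw [one_mul] at a1
    set y := dcos q i
    have b1 : y ≤ -0.3163 := by nlinarith
    have b2 : y ^ 2 ≤ 2.327 := by nlinarith
    have b3 : -1.5255 ≤ y := by nlinarith
    have b4 : y ^ 3 - 3 * y + 1 ≤ 1.8912 := by nlinarith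
    nlinarith [mul_nonneg (sub_nonneg.2 b1) (sub_nonneg.2 b3)]
  · have a1 := hP.place_one_sub h (hP.sub_eta_eq h hi hb) h1
    rw [one_mul] at a1
    nlinarith

end BigPrime

/-! #### The primes 11 and 13 -/

/-- The function on `ZMod 13` symmetric under negation with prescribed values. -/
def symm13 (a b c d e f g : Bool) (i : ZMod 13) : Bool :=
  (![a, b, c, d, e, f, g, g, f, e, d, c, b] : Fin 13 → Bool) i

/-- The function on `ZMod 11` symmetric under negation with prescribed values. -/
def symm11 (a b c d e f : Bool) (i : ZMod 11) : Bool :=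
  (![a, b, c, d, e, f, f, e, d, c, b] : Fin 11 → Bool) i

lemma symm13_autocorrelation : ∀ a b c d e f g : Bool,
    (∑ i : ZMod 13, if symm13 a b c d e f g i then 1 else 0) = 4 →
    ∃ j : ZMod 13, j ≠ 0 ∧ j ≠ 1 ∧ j ≠ -1 ∧
      (∑ i, if symm13 a b c d e f g i && symm13 a b c d e f g (i + j) then 1 else 0) = 0 := by
  decide +kernel

lemma symm11_autocorrelation_four : ∀ a b c d e f : Bool,
    (∑ i : ZMod 11, if symm11 a b c d e f i then 1 else 0) = 4 →
    (∃ j : ZMod 11, j ≠ 0 ∧ j ≠ 1 ∧ j ≠ -1 ∧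
      (∑ i, if symm11 a b c d e f i && symm11 a b c d e f (i + j) then 1 else 0) <
      1) ∨ ((a, b, c), (d, e, f)) = ((false, false, true), (false, true, false)) := by
  decide +kernel

lemma symm11_autocorrelation_five : ∀ a b c d e f : Bool,
    (∑ i : ZMod 11, if symm11 a b c d e f i then 1 else 0) = 5 →
    (∃ j : ZMod 11, j ≠ 0 ∧ j ≠ 1 ∧ j ≠ -1 ∧
      (∑ i, if symm11 a b c d e f i && symm11 a b c d e f (i + j) then 1 else 0) <
      2) ∨ ((a, b, c), (d, e, f)) = ((true, false, true), (false, false, true)) := by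
  decide +kernel

lemma BigPrime.eq_zero_of_eq_thirteen (hP : BigPrime 13) {b : 𝓞 (Kq 13)}
    (h : NN (2 * (2 - eta 13 1) - b ^ 2)) : b = 0 := by
  have hh := emb_one_eta_one_ge (q := 13) (m := 13) (by norm_num) (by norm_num)
  rcases hP.smallEntry_or_indicator (Or.inr rfl) h (by norm_num at hh ⊢; linarith) with
    hb | ⟨e, p, he, hp, hb, hcard, hj⟩
  · exact hb.eq_zero hP le_rfl h
  · exfalso
    have hcard := hcard.resolve_right fun h => by norm_num at h
    have hps : p = symm13 (p 0) (p 1) (p 2) (p 3) (p 4) (p 5) (p 6) := by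
      funext i
      fin_cases i
      any_goals rfl
      · exact hp 6
      · exact hp 5
      · exact hp 4
      · exact hp 3
      · exact hp 2
      · exact hp 1
    rw [hps] at hcard hj
    obtain ⟨j, hj0, hj1, hj2, h0⟩ := symm13_autocorrelation _ _ _ _ _ _ _ hcard
    have := hj j hj0 hj1 hj2
    erw [hcard, h0] at this
    omega

lemma dcos_eleven_bounds :
    (1.6736 ≤ dcos 11 1 ∧ dcos 11 1 ≤ 1.683) ∧ (0.83 ≤ dcos 11 2 ∧ dcos 11 2 ≤ 0.832) ∧
    (-0.2889 ≤ dcos 11 3 ∧ dcos 11 3 ≤ -0.284) ∧ (-1.31 ≤ dcos 11 4 ∧ dcos 11 4 ≤ -1.308) ∧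
    (-1.9192 ≤ dcos 11 5 ∧ dcos 11 5 ≤ -1.9166) := by
  have hh := BigPrime.emb_one_eta_one_ge (q := 11) (m := 11) (by norm_num) (by norm_num)
  rw [emb_eta, Units.val_one, mul_one] at hh
  have hneg : ∀ {a c : ZMod 11}, c = -a → dcos 11 c = dcos 11 a := fun h => by rw [h, dcos_neg]
  have e2 : dcos 11 2 = dcos 11 1 ^ 2 - 2 := by rw [← BigPrime.dcos_two_mul]; rfl
  have e4 : dcos 11 4 = dcos 11 2 ^ 2 - 2 := by rw [← BigPrime.dcos_two_mul]; rfl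
  have e3 : dcos 11 3 = dcos 11 4 ^ 2 - 2 := by rw [← BigPrime.dcos_two_mul]; exact hneg (by decide)
  have e5 : dcos 11 5 = dcos 11 3 ^ 2 - 2 := by
    rw [← BigPrime.dcos_two_mul]; exact (hneg (by decide)).symm
  have e1 : dcos 11 1 = dcos 11 5 ^ 2 - 2 := by rw [← BigPrime.dcos_two_mul]; exact hneg (by decide)
  have e3' : dcos 11 3 = dcos 11 1 ^ 3 - 3 * dcos 11 1 := by rw [← BigPrime.dcos_three_mul]; rfl
  have n : ∀ k : ℕ, 11 ≤ 4 * k → k ≤ 5 → dcos 11 (k : ZMod 11) ≤ 0 := by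
    intro k hk hk'
    rw [dcos_natCast]
    have hpi := Real.pi_pos
    have hk1 : (11 : ℝ) ≤ 4 * k := by exact_mod_cast hk
    have hk2 : (k : ℝ) ≤ 5 := by exact_mod_cast hk'
    have := Real.cos_nonpos_of_pi_div_two_le_of_le (x := 2 * Real.pi * k / (11 : ℕ))
      (by push_cast; rw [div_le_div_iff₀ (by norm_num) (by norm_num)]; nlinarith)
      (by push_cast; rw [div_le_iff₀ (by norm_num)]; nlinarith)
    linarith
  have n3 : dcos 11 3 ≤ 0 := by exact_mod_cast n 3 (by norm_num) (by norm_num)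
  have n4 : dcos 11 4 ≤ 0 := by exact_mod_cast n 4 (by norm_num) (by norm_num)
  have n5 : dcos 11 5 ≤ 0 := by exact_mod_cast n 5 (by norm_num) (by norm_num)
  have l1 : 1.6736 ≤ dcos 11 1 := by norm_num at hh ⊢; linarith
  have u5 : dcos 11 5 ≤ -1.9166 := by nlinarith
  have l3 : -0.2889 ≤ dcos 11 3 := by nlinarith
  have u4 : dcos 11 4 ≤ -1.308 := by nlinarith
  have l2 : 0.8009 ≤ dcos 11 2 := by nlinarith
  have u2 : dcos 11 2 ≤ 0.832 := by nlinarith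
  have u1 : dcos 11 1 ≤ 1.683 := by nlinarith
  have l5 : -1.9192 ≤ dcos 11 5 := by nlinarith
  have u3 : dcos 11 3 ≤ -0.284 := by nlinarith
  have l4 : -1.31 ≤ dcos 11 4 := by nlinarith
  have m2 : 0.83 ≤ dcos 11 2 := by nlinarith
  exact ⟨⟨l1, u1⟩, ⟨m2, u2⟩, ⟨l3, u3⟩, ⟨l4, u4⟩, ⟨l5, u5⟩⟩

lemma BigPrime.SmallEntry.eq_zero_of_eq_eleven (hP : BigPrime 11) {b : 𝓞 (Kq 11)}
    (h : NN (2 * (2 - eta 11 1) - b ^ 2)) (hb : BigPrime.SmallEntry b) : b = 0 := by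
  have h1 := hP.one_ne_zero
  have h2 := hP.two_ne_zero
  have h3 := hP.three_ne_zero
  have h4 : (4 : ZMod 11) ≠ 0 := by decide
  have h5 : (5 : ZMod 11) ≠ 0 := by decide
  have hneg : ∀ {a c : ZMod 11}, c = -a → dcos 11 c = dcos 11 a := fun h => by rw [h, dcos_neg]
  obtain ⟨⟨l1, u1⟩, ⟨l2, u2⟩, ⟨l3, u3⟩, ⟨l4, u4⟩, ⟨l5, u5⟩⟩ := dcos_eleven_bounds
  have rep : ∀ i : ZMod 11, i ≠ 0 → ∃ k, (k = 1 ∨ k = 2 ∨ k = 3 ∨ k = 4 ∨ k = 5) ∧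
      eta 11 i = eta 11 k := by
    intro i hi
    have : ∃ k : ZMod 11, (k = 1 ∨ k = 2 ∨ k = 3 ∨ k = 4 ∨ k = 5) ∧ (i = k ∨ i = -k) := by
      revert i; decide
    obtain ⟨k, hk, h⟩ := this
    refine ⟨k, hk, ?_⟩
    rcases h with rfl | rfl
    · rfl
    · rw [eta_neg]
  rcases hb with hb | hb | ⟨i, hi, hb | hb | hb⟩
  · exact hb
  · have := hP.place_one h hb h1
    linarith
  · exfalso
    obtain ⟨k, hk, hki⟩ := rep i hi
    rw [hki] at hb
    have a1 := hP.place_eta h hb h1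
    have a2 := hP.place_eta h hb h2
    rw [dcos_two_mul] at a2
    rw [one_mul] at a1
    rcases hk with rfl | rfl | rfl | rfl | rfl <;> nlinarith
  · exfalso
    obtain ⟨k, hk, hki⟩ := rep i hi
    rw [hki] at hb
    have a1 := hP.place_one_add h hb h1
    have a3 := hP.place_one_add h hb h3
    have a4 := hP.place_one_add h hb h4
    rw [one_mul] at a1
    rcases hk with rfl | rfl | rfl | rfl | rfl
    · nlinarith
    · nlinarith
    · rw [show (4 : ZMod 11) * 3 = 1 by decide] at a4; nlinarith
    · rw [show (3 : ZMod 11) * 4 = 1 by decide] at a3; nlinarith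
    · nlinarith
  · exfalso
    have a5 := hP.place_one_sub h (hP.sub_eta_eq h hi hb) h5
    rw [mul_one] at a5
    nlinarith

lemma BigPrime.eq_zero_of_eq_eleven (hP : BigPrime 11) {b : 𝓞 (Kq 11)}
    (h : NN (2 * (2 - eta 11 1) - b ^ 2)) : b = 0 := by
  have h1 := hP.one_ne_zero
  have h2 := hP.two_ne_zero
  have h3 := hP.three_ne_zero
  have h4 : (4 : ZMod 11) ≠ 0 := by decide
  have h5 : (5 : ZMod 11) ≠ 0 := by decide
  have hneg : ∀ {a c : ZMod 11}, c = -a → dcos 11 c = dcos 11 a := fun h => by rw [h, dcos_neg]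
  obtain ⟨⟨l1, u1⟩, ⟨l2, u2⟩, ⟨l3, u3⟩, ⟨l4, u4⟩, ⟨l5, u5⟩⟩ := dcos_eleven_bounds
  have u : 3 / 2 < emb 1 (eta 11 1) := by
    rw [emb_eta, Units.val_one, mul_one]; norm_num at l1 ⊢; linarith
  rcases hP.smallEntry_or_indicator (Or.inl rfl) h u with
    hb | ⟨e, p, he, hp, hb, hcard, hj⟩
  · exact hb.eq_zero_of_eq_eleven hP h
  · exfalso
    have hps : p = symm11 (p 0) (p 1) (p 2) (p 3) (p 4) (p 5) := by
      funext i
      fin_cases i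
      any_goals rfl
      · exact hp 5
      · exact hp 4
      · exact hp 3
      · exact hp 2
      · exact hp 1
    have hb2 : (2 * b) ^ 2 = (∑ i, if p i then eta 11 i else 0) ^ 2 := by
      rw [hb, mul_pow, show (e : 𝓞 (Kq 11)) ^ 2 = 1 by exact_mod_cast he, one_mul]
    rw [hps] at hcard hj hb2
    have hauto : ∀ j : ZMod 11, j ≠ 0 → j ≠ 1 → j ≠ -1 → (∑ i, if symm11 (p 0) (p 1) (p 2) (p 3)
        (p 4) (p 5) i then 1 else 0) ≤ (∑ i, if symm11 (p 0) (p 1) (p 2) (p 3) (p 4) (p 5) i &&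
          symm11 (p 0) (p 1) (p 2) (p 3) (p 4) (p 5) (i + j) then 1 else 0) + 3 := hj
    have hcase : ((p 0, p 1, p 2), (p 3, p 4, p 5)) = ((false, false, true), (false, true, false)) ∨
        ((p 0, p 1, p 2), (p 3, p 4, p 5)) = ((true, false, true), (false, false, true)) := by
      rcases hcard with hcard | ⟨-, hcard⟩
      · rcases symm11_autocorrelation_four _ _ _ _ _ _ hcard with ⟨j, hj0, hj1, hj2, h0⟩ | h0
        · have := hauto j hj0 hj1 hj2
          erw [hcard] at this
          omega
        · exact Or.inl h0
      · rcases symm11_autocorrelation_five _ _ _ _ _ _ hcard with ⟨j, hj0, hj1, hj2, h0⟩ | h0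
        · have := hauto j hj0 hj1 hj2
          erw [hcard] at this
          omega
        · exact Or.inr h0
    rcases hcase with h0 | h0
    · simp only [Prod.mk.injEq] at h0
      obtain ⟨⟨q0, q1, q2⟩, q3, q4, q5⟩ := h0
      rw [q0, q1, q2, q3, q4, q5] at hb2
      have hsum : (∑ i : ZMod 11, if symm11 false false true false true false i
          then eta 11 i else 0) = 2 * (eta 11 2 + eta 11 4) := by
        have : (∑ i : ZMod 11, if symm11 false false true false true false i
          then eta 11 i else 0) = eta 11 2 + eta 11 4 + eta 11 (-4) + eta 11 (-2) := by
          rw [← Finset.sum_filter, show (Finset.univ.filter fun i : ZMod 11 =>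
            symm11 false false true false true false i = true) = {2, 4, -4, -2} by decide,
            Finset.sum_insert (by decide), Finset.sum_insert (by decide), Finset.sum_insert (by decide), Finset.sum_singleton]
          ring
        rw [this, eta_neg, eta_neg]; ring
      obtain ⟨s, hs, h6⟩ := hP.place h h2
      rw [hsum] at hb2
      have hb3 : b ^ 2 = (eta 11 2 + eta 11 4) ^ 2 := by
        apply mul_left_cancel₀ (show (4 : 𝓞 (Kq 11)) ≠ 0 by norm_num)
        linear_combination hb2
      rw [hb3, map_pow, map_add, hs, hs, show (2 : ZMod 11) * 2 = 4 by decide,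
        hneg (show (2 : ZMod 11) * 4 = -3 by decide)] at h6
      nlinarith
    · simp only [Prod.mk.injEq] at h0
      obtain ⟨⟨q0, q1, q2⟩, q3, q4, q5⟩ := h0
      rw [q0, q1, q2, q3, q4, q5] at hb2
      have hsum : (∑ i : ZMod 11, if symm11 true false true false false true i
          then eta 11 i else 0) = 2 * (1 + eta 11 2 + eta 11 5) := by
        have : (∑ i : ZMod 11, if symm11 true false true false false true i
          then eta 11 i else 0) = eta 11 0 + eta 11 2 + eta 11 5 + eta 11 (-5) + eta 11 (-2) := by
          rw [← Finset.sum_filter, show (Finset.univ.filter fun i : ZMod 11 =>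
            symm11 true false true false false true i = true) = {0, 2, 5, -5, -2} by decide,
            Finset.sum_insert (by decide), Finset.sum_insert (by decide), Finset.sum_insert (by decide), Finset.sum_insert (by decide), Finset.sum_singleton]
          ring
        rw [this, eta_neg, eta_neg, eta_zero]; ring
      obtain ⟨s, hs, h6⟩ := hP.place h h3
      rw [hsum] at hb2
      have hb3 : b ^ 2 = (1 + eta 11 2 + eta 11 5) ^ 2 := by
        apply mul_left_cancel₀ (show (4 : 𝓞 (Kq 11)) ≠ 0 by norm_num)
        linear_combination hb2
      rw [hb3, map_pow, map_add, map_add, map_one, hs, hs,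
        hneg (show (3 : ZMod 11) * 2 = -5 by decide), show (3 : ZMod 11) * 5 = 4 by decide] at h6
      nlinarith

/-- The Gram matrix entry vanishes for `q ≥ 11`. -/
lemma BigPrime.eq_zero_of_nn {q : ℕ} [NeZero q] (hP : BigPrime q) (hq : q ≠ 7) {b : 𝓞 (Kq q)}
    (h : NN (2 * (2 - eta q 1) - b ^ 2)) : b = 0 := by
  have h7 := hP.seven_le
  have hp := hP.prime
  by_cases h17 : 17 ≤ q
  · exact (hP.smallEntry_of_nn (Or.inr h17) h).eq_zero hP (by omega) h
  · interval_cases q <;> first | (exfalso; revert hp; norm_num; done) | skip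
    · exact absurd rfl hq
    · convert hP.eq_zero_of_eq_eleven (b := b) (by convert h)
    · convert hP.eq_zero_of_eq_thirteen (b := b) (by convert h)

lemma BigPrime.not_univTernary {q : ℕ} [NeZero q] (hP : BigPrime q) (hq : q ≠ 7)
    {B : LinearMap.BilinForm (𝓞 (Kq q)) (Fin 3 → 𝓞 (Kq q))} (hB : UnivTernary B) : False := by
  obtain ⟨e, he⟩ := hB.univ 1 tp_one
  obtain ⟨v, hve, hv⟩ := hP.exists_alpha hB he
  obtain ⟨w, hwe, hw⟩ := hP.exists_two hB he
  refine hP.false_of_orthogonal hB he hve hv hwe hw (hP.eq_zero_of_nn hq ?_)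
  have := hB.cauchySchwarz w v
  rwa [hw, hv] at this

/-! #### The prime 7 -/

lemma BigPrime.eta_three_eq (hP : BigPrime 7) : eta 7 3 = -1 - eta 7 1 - eta 7 2 := by
  have h := hP.sum_eta
  have e : ∑ i : ZMod 7, eta 7 i = eta 7 0 + eta 7 1 + eta 7 2 + eta 7 3 + eta 7 (-3) +
      eta 7 (-2) + eta 7 (-1) := Fin.sum_univ_seven _
  rw [e, eta_neg, eta_neg, eta_neg, eta_zero] at h
  apply mul_left_cancel₀ (_root_.two_ne_zero (α := 𝓞 (Kq 7)))
  linear_combination h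

lemma BigPrime.eta_two_eq : eta 7 2 = eta 7 1 ^ 2 - 2 := by
  rw [← eta_two_mul, mul_one]

lemma BigPrime.eta_one_cubic (hP : BigPrime 7) :
    eta 7 1 ^ 3 + eta 7 1 ^ 2 - 2 * eta 7 1 - 1 = 0 := by
  have h := eta_three_mul (q := 7) 1
  rw [mul_one, hP.eta_three_eq, eta_two_eq] at h
  linear_combination -h

lemma ZMod.seven_cases : ∀ i : ZMod 7, i = 0 ∨ (i = 1 ∨ i = -1) ∨ (i = 2 ∨ i = -2) ∨
    (i = 3 ∨ i = -3) := by decide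

/-- The element `Δ` generates a prime ideal of norm `13` in the ring for `q = 7`. -/
structure NormThirteen (Δ : 𝓞 (Kq 7)) : Prop where
  congr : ∀ x, ∃ n : ℤ, Δ ∣ x - n
  dvd_thirteen : Δ ∣ 13
  dvd : ∀ n : ℤ, Δ ∣ n → 13 ∣ n

lemma normThirteen_of {Δ Δ' : 𝓞 (Kq 7)} (hP : BigPrime 7) (n₁ n₂ n₃ : ℤ)
    (h₁ : Δ ∣ eta 7 1 - n₁) (h₂ : Δ ∣ eta 7 2 - n₂) (h₃ : Δ ∣ eta 7 3 - n₃)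
    (h : Δ * Δ' = 13) {m : ℤ} (hm : hP.form 3 Δ' = m) (hm' : ¬ 13 ∣ m) : NormThirteen Δ where
  congr x := by
    refine eta_induction (q := 7) (by norm_num) (p := fun x => ∃ n : ℤ, Δ ∣ x - n) ?_ ?_ ?_ ?_ x
    · exact ⟨1, by simp⟩
    · intro a
      rcases ZMod.seven_cases a with rfl | (rfl | rfl) | (rfl | rfl) | (rfl | rfl)
      · exact ⟨2, by simp [eta_zero]⟩
      · exact ⟨n₁, h₁⟩
      · exact ⟨n₁, by rwa [eta_neg]⟩
      · exact ⟨n₂, h₂⟩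
      · exact ⟨n₂, by rwa [eta_neg]⟩
      · exact ⟨n₃, h₃⟩
      · exact ⟨n₃, by rwa [eta_neg]⟩
    · rintro x y ⟨m, hm⟩ ⟨n, hn⟩
      exact ⟨m + n, by push_cast; convert dvd_add hm hn using 1; ring⟩
    · rintro x ⟨m, hm⟩
      exact ⟨-m, by push_cast; rw [sub_neg_eq_add, ← sub_neg_eq_add, ← neg_sub', dvd_neg]; exact hm⟩
  dvd_thirteen := ⟨Δ', h.symm⟩
  dvd n := by
    rintro ⟨y, hy⟩
    have h1 : (n : 𝓞 (Kq 7)) * Δ' = (13 : ℤ) * y := by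
      push_cast; linear_combination Δ' * hy + y * h
    have h2 := congrArg (hP.form 3) h1
    rw [BigPrime.form_zsmul, BigPrime.form_zsmul, hm] at h2
    exact (Int.Prime.dvd_mul' (p := 13) (by norm_num) ⟨_, h2⟩).resolve_right hm'

namespace BigPrime

lemma dcos_seven_bounds (hP : BigPrime 7) :
    (1.2465 ≤ dcos 7 1 ∧ dcos 7 1 ≤ 1.248) ∧ (-0.4463 ≤ dcos 7 2 ∧ dcos 7 2 ≤ -0.4424) ∧
      dcos 7 3 ≤ -1.8 := by
  have h1 := emb_one_eta_one_ge (q := 7) (m := 7) (by norm_num) (by norm_num)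
  have h2 := congrArg (emb 1) hP.eta_one_cubic
  have h3 := congrArg (emb 1) hP.eta_three_eq
  have h4 := congrArg (emb 1) eta_two_eq
  simp only [map_add, map_sub, map_mul, map_pow, map_neg, map_one, map_ofNat, map_zero, emb_eta,
    Units.val_one, one_mul] at h1 h2 h3 h4
  set x := dcos 7 1
  have h5 : 1.19 ≤ x := by norm_num at h1 ⊢; linarith
  have h6 : 1.2465 ≤ x := by
    by_contra hlt
    push Not at hlt
    nlinarith [mul_nonneg (sub_nonneg.2 h5) (sub_nonneg.2 hlt.le),
      mul_nonneg (mul_nonneg (sub_nonneg.2 h5) (sub_nonneg.2 hlt.le)) (by linarith : 0 ≤ x)]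
  have h7 : x ≤ 1.248 := by
    by_contra hlt
    push Not at hlt
    nlinarith [mul_nonneg (sub_nonneg.2 h5) (sub_nonneg.2 hlt.le),
      mul_nonneg (mul_nonneg (sub_nonneg.2 h5) (sub_nonneg.2 hlt.le)) (by linarith : 0 ≤ x)]
  have h8 : -0.4463 ≤ dcos 7 2 := by rw [h4]; nlinarith
  have h9 : dcos 7 2 ≤ -0.4424 := by rw [h4]; nlinarith
  exact ⟨⟨h6, h7⟩, ⟨h8, h9⟩, by rw [h3]; linarith⟩

lemma smallEntry_seven (hP : BigPrime 7) {b : 𝓞 (Kq 7)} (h : NN (2 * (2 - eta 7 1) - b ^ 2)) :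
    b = 0 ∨ b ^ 2 = 1 ∨ b ^ 2 = eta 7 2 ^ 2 ∨ b ^ 2 = (1 + eta 7 2) ^ 2 := by
  obtain ⟨⟨l1, u1⟩, ⟨l2, u2⟩, u3⟩ := hP.dcos_seven_bounds
  have k1 := hP.one_ne_zero
  have k2 := hP.two_ne_zero
  have k3 := hP.three_ne_zero
  rcases hP.smallEntry_of_nn (Or.inl rfl) h with hb | hb | ⟨i, hi, hb⟩
  · exact Or.inl hb
  · exact Or.inr (Or.inl hb)
  obtain ⟨i, hi', hb⟩ : ∃ i : ZMod 7, (i = 1 ∨ i = 2 ∨ i = 3) ∧ (b ^ 2 = eta 7 i ^ 2 ∨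
      b ^ 2 = (1 + eta 7 i) ^ 2 ∨ b ^ 2 = (1 - eta 7 1) ^ 2) := by
    rw [or_congr_right (or_congr_right (show b ^ 2 = (1 - eta 7 i) ^ 2 ↔
      b ^ 2 = (1 - eta 7 i) ^ 2 ∧ b ^ 2 = (1 - eta 7 1) ^ 2 from
      ⟨fun hb => ⟨hb, hP.sub_eta_eq h hi hb⟩, And.left⟩))] at hb
    replace hb := Or.imp_right (Or.imp_right And.right) hb
    rcases ZMod.seven_cases i with rfl | (rfl | rfl) | (rfl | rfl) | (rfl | rfl)
    · exact absurd rfl hi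
    · exact ⟨_, Or.inl rfl, hb⟩
    · exact ⟨1, Or.inl rfl, by rwa [eta_neg] at hb⟩
    · exact ⟨_, Or.inr (Or.inl rfl), hb⟩
    · exact ⟨2, Or.inr (Or.inl rfl), by rwa [eta_neg] at hb⟩
    · exact ⟨_, Or.inr (Or.inr rfl), hb⟩
    · exact ⟨3, Or.inr (Or.inr rfl), by rwa [eta_neg] at hb⟩
  rcases hb with hb | hb | hb
  · rcases hi' with rfl | rfl | rfl
    · have := hP.place_eta h hb k1
      rw [mul_one] at this
      nlinarith
    · exact Or.inr (Or.inr (Or.inl hb))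
    · have := hP.place_eta h hb k1
      rw [one_mul] at this
      nlinarith
  · rcases hi' with rfl | rfl | rfl
    · have := hP.place_one_add h hb k1
      rw [mul_one] at this
      nlinarith
    · exact Or.inr (Or.inr (Or.inr hb))
    · have := hP.place_one_add h hb k2
      rw [show (2 : ZMod 7) * 3 = -1 by decide, dcos_neg] at this
      nlinarith
  · have := hP.place_one_sub h hb k3
    rw [mul_one] at this
    nlinarith

/-- The orthogonal complement of a vector of norm `1` represents `3 + η_j` for `q = 7`. -/
lemma exists_three_add_eta (hP : BigPrime 7) {B} (hB : UnivTernary B) {e} (he : B e e = 1)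
    {j : ZMod 7} (hj : j ≠ 0) : ∃ y, B y e = 0 ∧ B y y = 3 + eta 7 j := by
  obtain ⟨y, hy⟩ := hB.univ _ (tp_three_add_eta (q := 7) j)
  obtain ⟨w, hw, hyw⟩ := hB.split he y
  refine ⟨w, hw, ?_⟩
  rw [hy] at hyw
  set x := B y e
  suffices hx : x = 0 by rw [hyw, hx]; ring
  have hw0 : B w w ≠ 0 := fun h0 => hP.sq_ne_three_add_eta hj x (by rw [hyw, h0, add_zero])
  have htp := (hB.nn w).tp hw0
  have h5 := hP.sum_form_lt (x := x ^ 2) (fun k hk => by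
    have h4 := congrArg (hP.form k) hyw
    rw [map_add, map_add, hP.form_ofNat hk] at h4
    have h5 := hP.form_pos hk htp
    have h6 := hP.form_eta_le hj k
    omega) (hP.sq_ne_two x)
  rcases hP.eq_of_sum_form_sq_le h5 with h | h | ⟨i, hi, h⟩
  · exact h
  · exfalso
    obtain ⟨i, rfl⟩ := hP.exists_half j
    have hcub : ∃ t : 𝓞 (Kq 7), t * eta 7 i = 1 := by
      have hi : i ≠ 0 := by rintro rfl; exact hj (mul_zero _)
      have h3 := hP.eta_three_eq
      have h2 := eta_two_eq
      have h1 := hP.eta_one_cubic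
      have key : ∀ k : ZMod 7, k = 1 ∨ k = 2 ∨ k = 3 → ∃ t : 𝓞 (Kq 7), t * eta 7 k = 1 := by
        rintro k (rfl | rfl | rfl)
        · exact ⟨eta 7 1 ^ 2 + eta 7 1 - 2, by linear_combination h1⟩
        · exact ⟨eta 7 2 ^ 2 + eta 7 2 - 2, by
            rw [h2]; linear_combination (eta 7 1 ^ 3 - eta 7 1 ^ 2 - 2 * eta 7 1 + 1) * h1⟩
        · rw [h3, h2]
          exact ⟨(1 - eta 7 1 - eta 7 1 ^ 2) ^ 2 + (1 - eta 7 1 - eta 7 1 ^ 2) - 2, by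
            linear_combination ((1) * eta 7 1 ^ 0 + (1) * eta 7 1 ^ 1 + (-2) * eta 7 1 ^ 2 + (-1) * eta 7 1 ^ 3) * h1⟩
      rcases ZMod.seven_cases i with rfl | (rfl | rfl) | (rfl | rfl) | (rfl | rfl)
      · exact absurd rfl hi
      · exact key _ (by decide)
      · rw [eta_neg]; exact key _ (by decide)
      · exact key _ (by decide)
      · rw [eta_neg]; exact key _ (by decide)
      · exact key _ (by decide)
      · rw [eta_neg]; exact key _ (by decide)
    obtain ⟨t, ht⟩ := hcub
    refine hP.ne_one_of_orthogonal hB he (e' := t • w) (by simp [hw]) ?_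
    have h7 : B w w = eta 7 i ^ 2 := by rw [eta_sq]; rw [h] at hyw; linear_combination -hyw
    simp only [map_smul, LinearMap.smul_apply, smul_eq_mul, h7]
    linear_combination (t * eta 7 i + 1) * ht
  · exfalso
    have h2i : 2 * i ≠ 0 := fun h0 => (hP.mul_eq_zero.1 h0).elim hP.two_ne_zero hi
    have h7 : B w w = 1 + eta 7 j - eta 7 (2 * i) := by
      rw [h, eta_sq] at hyw; linear_combination -hyw
    by_cases hij : 2 * i = j ∨ 2 * i = -j
    · apply hP.ne_one_of_orthogonal hB he hw
      rcases hij with hij | hij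
      · rw [h7, hij]; ring
      · rw [h7, hij, eta_neg]; ring
    · push Not at hij
      have h8 := hP.form_pos hj htp
      have hn : ¬ j = -j := hP.ne_neg hj
      have hn' : ¬ 2 * i = -j := hij.2
      rw [h7, map_sub, map_add, hP.form_one hj, form_eta, form_eta, if_neg hj, if_neg h2i,
        if_pos rfl, if_neg hn, if_neg hij.1, if_neg hn'] at h8
      omega

/-- A nonzero off-diagonal entry of the Gram matrix is impossible for `q = 7`. -/
lemma false_of_normThirteen (hP : BigPrime 7) {B} (hB : UnivTernary B) {e v w} (he : B e e = 1)
    (hve : B v e = 0) (hv : B v v = 2 - eta 7 1) (hwe : B w e = 0) (hw : B w w = 2)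
    {Δ : 𝓞 (Kq 7)} (hΔ : 2 * (2 - eta 7 1) - B w v ^ 2 = Δ) (h13 : NormThirteen Δ)
    {j : ZMod 7} (hj : j ≠ 0) (h7 : Δ ∣ eta 7 j - 7) : False := by
  have he0 : e ≠ 0 := by rintro rfl; simp at he
  obtain ⟨y, hye, hy⟩ := hP.exists_three_add_eta hB he hj
  have hg := hB.gram_eq_zero he0 hwe hve hye
  rw [hw, hv, hy] at hg
  have hsq : (2 * B v y - B w v * B w y) ^ 2 = Δ * (2 * (3 + eta 7 j) - B w y ^ 2) := by
    rw [← hΔ]; linear_combination -2 * hg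
  set c := 2 * B v y - B w v * B w y
  have hc : Δ ∣ c := by
    obtain ⟨n, hn⟩ := h13.congr c
    have h1 : Δ ∣ ((n ^ 2 : ℤ) : 𝓞 (Kq 7)) := by
      have h2 : ((n ^ 2 : ℤ) : 𝓞 (Kq 7)) = c ^ 2 - (c - n) * (c + n) := by push_cast; ring
      rw [h2]
      exact dvd_sub ⟨_, hsq⟩ (hn.mul_right _)
    have h3 := Int.Prime.dvd_pow' (p := 13) (by norm_num) (h13.dvd _ h1)
    have h4 : Δ ∣ (n : 𝓞 (Kq 7)) := by
      obtain ⟨k, rfl⟩ := h3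
      push_cast
      exact h13.dvd_thirteen.mul_right _
    simpa using dvd_add hn h4
  have hA : Δ ∣ 2 * (3 + eta 7 j) - B w y ^ 2 := by
    obtain ⟨d, hd⟩ := hc
    refine ⟨d ^ 2, ?_⟩
    have hΔ0 : Δ ≠ 0 := by
      rintro rfl
      obtain ⟨k, hk⟩ := h13.dvd_thirteen
      rw [zero_mul] at hk
      norm_num at hk
    apply mul_left_cancel₀ hΔ0
    rw [← hsq, hd]; ring
  obtain ⟨m, hm⟩ := h13.congr (B w y)
  have h1 : Δ ∣ ((20 - m ^ 2 : ℤ) : 𝓞 (Kq 7)) := by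
    have h2 : ((20 - m ^ 2 : ℤ) : 𝓞 (Kq 7)) = 2 * (3 + eta 7 j) - B w y ^ 2 -
      2 * (eta 7 j - 7) + (B w y - m) * (B w y + m) := by push_cast; ring
    rw [h2]
    exact dvd_add (dvd_sub hA (h7.mul_left _)) (hm.mul_right _)
  have h2 := (ZMod.intCast_zmod_eq_zero_iff_dvd (20 - m ^ 2) 13).2 (h13.dvd _ h1)
  push_cast at h2
  generalize (m : ZMod 13) = k at h2
  revert k
  decide

lemma not_univTernary_seven (hP : BigPrime 7)
    {B : LinearMap.BilinForm (𝓞 (Kq 7)) (Fin 3 → 𝓞 (Kq 7))} (hB : UnivTernary B) : False := by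
  obtain ⟨e, he⟩ := hB.univ 1 tp_one
  obtain ⟨v, hve, hv⟩ := hP.exists_alpha hB he
  obtain ⟨w, hwe, hw⟩ := hP.exists_two hB he
  have hnn := hB.cauchySchwarz w v
  rw [hw, hv] at hnn
  have k1 := hP.one_ne_zero
  have k2 := hP.two_ne_zero
  have k3 := hP.three_ne_zero
  have h1 := hP.eta_one_cubic
  have h2 := eta_two_eq
  have h3 := hP.eta_three_eq
  have f0 : hP.form 3 (eta 7 1) = 0 := by
    rw [form_eta, if_neg (by decide), if_neg (by decide), if_neg (by decide)]; rfl
  have f2 : hP.form 3 (eta 7 2) = 0 := by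
    rw [form_eta, if_neg (by decide), if_neg (by decide), if_neg (by decide)]; rfl
  have form_lin : ∀ a b c : ℤ, hP.form 3 (a + b * eta 7 1 + c * eta 7 2) = a := fun a b c => by
    rw [map_add, map_add, form_zsmul, form_zsmul, hP.form_intCast k3, f0, f2]; ring
  set x := eta 7 1 with hx
  rcases hP.smallEntry_seven hnn with hb | hb | hb | hb
  · exact hP.false_of_orthogonal hB he hve hv hwe hw hb
  · refine hP.false_of_normThirteen hB he hve hv hwe hw (Δ := 3 - 2 * x) (by rw [hb]; ring) ?_ k3 ?_
    · refine normThirteen_of hP 8 10 7 ⟨-4 - 5 * x - 2 * x ^ 2, ?_⟩ ⟨-6 - 8 * x - 3 * x ^ 2, ?_⟩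
        ⟨-4 - 7 * x - 3 * x ^ 2, ?_⟩ ?_ (form_lin 15 10 4) (by norm_num)
      · push_cast; linear_combination -4 * h1
      · rw [h2]; push_cast; linear_combination -6 * h1
      · rw [h3, h2]; push_cast; linear_combination -6 * h1
      · rw [h2]; push_cast; linear_combination -8 * h1
    · exact ⟨-4 - 7 * x - 3 * x ^ 2, by rw [h3, h2]; linear_combination -6 * h1⟩
  · refine hP.false_of_normThirteen hB he hve hv hwe hw (Δ := 1 - x + x ^ 2) (by rw [hb, h2]; linear_combination (1 - x) * h1) ?_ k2 ?_
    · refine normThirteen_of hP 10 7 8 ⟨-7 - x + x ^ 2, ?_⟩ ⟨-6 - x + x ^ 2, ?_⟩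
        ⟨-5 - 2 * x, ?_⟩ ?_ (form_lin 7 2 (-1)) (by norm_num)
      · push_cast; linear_combination (3 - x) * h1
      · rw [h2]; push_cast; linear_combination (3 - x) * h1
      · rw [h3, h2]; push_cast; linear_combination (2) * h1
      · rw [h2]; push_cast; linear_combination (4 - x) * h1
    · exact ⟨-6 - x + x ^ 2, by rw [h2]; linear_combination (3 - x) * h1⟩
  · refine hP.false_of_normThirteen hB he hve hv hwe hw (Δ := 4 - x - x ^ 2) (by rw [hb, h2]; linear_combination (1 - x) * h1) ?_ k1 ?_
    · refine normThirteen_of hP 7 8 10 ⟨-2 - x - x ^ 2, ?_⟩ ⟨-3 - 2 * x - x ^ 2, ?_⟩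
        ⟨-3 - 3 * x - 2 * x ^ 2, ?_⟩ ?_ (form_lin 8 3 2) (by norm_num)
      · push_cast; linear_combination (-1 - x) * h1
      · rw [h2]; push_cast; linear_combination (-2 - x) * h1
      · rw [h3, h2]; push_cast; linear_combination (-3 - 2 * x) * h1
      · rw [h2]; push_cast; linear_combination (-3 - 2 * x) * h1
    · exact ⟨-2 - x - x ^ 2, by linear_combination (-1 - x) * h1⟩

end BigPrime

/-! #### Orders in real quadratic fields -/

open QuadraticAlgebra in
/-- The parameters `m`, `n` for which `ω² = m + n ω` defines a real quadratic order. -/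
class RealQuad (m n : ℤ) : Prop where
  disc_pos : 0 < n ^ 2 + 4 * m
  not_sq : ∀ k : ℤ, k ^ 2 ≠ n ^ 2 + 4 * m

namespace RealQuad

variable {m n : ℤ} [RealQuad m n]

/-- The two real embeddings of a real quadratic order. -/
noncomputable def pl (s : ℤˣ) : QuadraticAlgebra ℤ m n →+* ℝ where
  toFun x := x.re + x.im * ((n + (s : ℤ) * √((n ^ 2 + 4 * m : ℤ) : ℝ)) / 2)
  map_zero' := by simp
  map_one' := by simp [QuadraticAlgebra.re_one, QuadraticAlgebra.im_one]
  map_add' x y := by simp only [QuadraticAlgebra.re_add, QuadraticAlgebra.im_add]; push_cast; ring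
  map_mul' x y := by
    have h := Real.sq_sqrt (x := ((n ^ 2 + 4 * m : ℤ) : ℝ))
      (by exact_mod_cast (disc_pos (m := m) (n := n)).le)
    have hs : ((s : ℤ) : ℝ) ^ 2 = 1 := by rcases Int.units_eq_one_or s with rfl | rfl <;> simp
    set r := √((n ^ 2 + 4 * m : ℤ) : ℝ)
    simp only [QuadraticAlgebra.re_mul, QuadraticAlgebra.im_mul]
    push_cast at h ⊢
    linear_combination (-(x.im * y.im * r ^ 2) / 4 : ℝ) * hs - (x.im * y.im / 4 : ℝ) * h

lemma pl_apply (s : ℤˣ) (x : QuadraticAlgebra ℤ m n) :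
    pl s x = x.re + x.im * ((n + (s : ℤ) * √((n ^ 2 + 4 * m : ℤ) : ℝ)) / 2) := rfl

lemma pl_mul_pl (x : QuadraticAlgebra ℤ m n) : pl 1 x * pl (-1) x = (x.norm : ℝ) := by
  have h := Real.sq_sqrt (x := ((n ^ 2 + 4 * m : ℤ) : ℝ))
    (by exact_mod_cast (disc_pos (m := m) (n := n)).le)
  rw [pl_apply, pl_apply, QuadraticAlgebra.norm_def]
  push_cast at h ⊢
  linear_combination (-(x.im : ℝ) ^ 2 / 4) * h

lemma pl_add_pl (x : QuadraticAlgebra ℤ m n) : pl 1 x + pl (-1) x = (x.trace : ℝ) := by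
  rw [pl_apply, pl_apply, QuadraticAlgebra.trace_def]
  push_cast
  ring

lemma norm_eq_zero {x : QuadraticAlgebra ℤ m n} (h : x.norm = 0) : x = 0 := by
  rw [QuadraticAlgebra.norm_def] at h
  have h1 : (2 * x.re + n * x.im) ^ 2 = x.im ^ 2 * (n ^ 2 + 4 * m) := by linear_combination 4 * h
  by_cases hv : x.im = 0
  · rw [hv] at h1
    ext
    · have : 2 * x.re = 0 := by
        apply pow_eq_zero_iff (two_ne_zero) |>.1
        linear_combination h1
      simpa using this
    · exact hv
  · exfalso
    obtain ⟨k, hk⟩ := (Int.pow_dvd_pow_iff two_ne_zero).1 ⟨_, h1⟩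
    apply not_sq (m := m) (n := n) k
    apply mul_left_cancel₀ (pow_ne_zero 2 hv)
    rw [← h1, hk]; ring

lemma pl_eq_zero {s : ℤˣ} {x : QuadraticAlgebra ℤ m n} (h : pl s x = 0) : x = 0 := by
  apply norm_eq_zero
  have := pl_mul_pl x
  rcases Int.units_eq_one_or s with rfl | rfl
  · rw [h, zero_mul] at this; exact_mod_cast this.symm
  · rw [h, mul_zero] at this; exact_mod_cast this.symm

instance : IsDomain (QuadraticAlgebra ℤ m n) :=
  Function.Injective.isDomain (pl (m := m) (n := n) 1)
    ((injective_iff_map_eq_zero _).2 fun _ h => pl_eq_zero h)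

/-- Total positivity. -/
def TPos (x : QuadraticAlgebra ℤ m n) : Prop := ∀ s, 0 < pl s x

lemma TPos.mk {x : QuadraticAlgebra ℤ m n} (h1 : 0 < pl 1 x) (h2 : 0 < pl (-1) x) : TPos x :=
  fun s => by rcases Int.units_eq_one_or s with rfl | rfl <;> assumption

lemma TPos.of_norm_trace {x : QuadraticAlgebra ℤ m n} (h1 : 0 < x.norm) (h2 : 0 < x.trace) :
    TPos x := by
  have h3 : (0 : ℝ) < x.norm := by exact_mod_cast h1
  have h4 : (0 : ℝ) < x.trace := by exact_mod_cast h2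
  rw [← pl_mul_pl] at h3
  rw [← pl_add_pl] at h4
  rcases pos_and_pos_or_neg_and_neg_of_mul_pos h3 with h | h
  · exact TPos.mk h.1 h.2
  · linarith [h.1, h.2]

variable {x y : QuadraticAlgebra ℤ m n}

lemma TPos.norm_pos (h : TPos x) : 0 < x.norm := by
  have := mul_pos (h 1) (h (-1))
  rw [pl_mul_pl] at this
  exact_mod_cast this

lemma TPos.trace_pos (h : TPos x) : 0 < x.trace := by
  have := add_pos (h 1) (h (-1))
  rw [pl_add_pl] at this
  exact_mod_cast this

lemma TPos.ne_zero (h : TPos x) : x ≠ 0 := by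
  rintro rfl
  simpa using h 1

lemma TPos.mul (hx : TPos x) (hy : TPos y) : TPos (x * y) := fun s => by
  rw [map_mul]; exact mul_pos (hx s) (hy s)

lemma TPos.add (hx : TPos x) (hy : TPos y) : TPos (x + y) := fun s => by
  rw [map_add]; exact add_pos (hx s) (hy s)

lemma TPos.sq_add (hx : TPos x) : TPos (y ^ 2 + x) := fun s => by
  rw [map_add, map_pow]; exact add_pos_of_nonneg_of_pos (sq_nonneg _) (hx s)

lemma TPos.of_mul (hx : TPos x) (hxy : TPos (x * y)) : TPos y := fun s => by
  have := hxy s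
  rw [map_mul] at this
  exact pos_of_mul_pos_right this (hx s).le

lemma tpos_sq (hx : x ≠ 0) : TPos (x ^ 2) := fun s => by
  rw [map_pow]
  exact (sq_nonneg _).lt_of_ne' (pow_ne_zero 2 fun h => hx (pl_eq_zero h))

lemma tpos_natCast {k : ℕ} (hk : 0 < k) : TPos (k : QuadraticAlgebra ℤ m n) := fun s => by
  rw [map_natCast]; exact_mod_cast hk

lemma mul_star_of_norm (h : x.norm = 1) : x * star x = 1 := by
  rw [← QuadraticAlgebra.algebraMap_norm_eq_mul_star, h, map_one]

lemma intCast_dvd_iff {k : ℤ} : (k : QuadraticAlgebra ℤ m n) ∣ x ↔ k ∣ x.re ∧ k ∣ x.im := by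
  have := QuadraticAlgebra.algebraMap_dvd_iff (r := k) (z := x)
  rwa [show (algebraMap ℤ (QuadraticAlgebra ℤ m n)) k = (k : QuadraticAlgebra ℤ m n) from rfl] at this

/-! #### Reduction of ternary forms -/

variable (m n) in
/-- A quantitative form of the Euclidean property. -/
def Box (C : ℝ) : Prop :=
  ∀ ξ p : ℤˣ → ℝ, (∀ s, 0 < p s) → C * (p 1 * p (-1)) ≤ 1 →
    ∃ x : QuadraticAlgebra ℤ m n,
      ((ξ 1 + pl 1 x) ^ 2 + p 1) * ((ξ (-1) + pl (-1) x) ^ 2 + p (-1)) < 1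

lemma Box.exists_norm_lt {C : ℕ} (hbox : Box m n C) {a g : QuadraticAlgebra ℤ m n} (ha : TPos a)
    (hg : TPos g) (h : C * g.norm ≤ a.norm ^ 2) (d : QuadraticAlgebra ℤ m n) :
    ∃ x, ∀ b, a * b = (d + x * a) ^ 2 + g → b.norm < a.norm := by
  obtain ⟨x, hx⟩ := hbox (fun s => pl s d / pl s a) (fun s => pl s g / pl s a ^ 2)
    (fun s => div_pos (hg s) (pow_pos (ha s) 2)) (by
      have h1 := pl_mul_pl g
      have h2 := pl_mul_pl a
      have h3 : (C : ℝ) * g.norm ≤ a.norm ^ 2 := by exact_mod_cast h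
      rw [← h1, ← h2] at h3
      have := ha 1
      have := ha (-1)
      rw [div_mul_div_comm, ← mul_pow, ← mul_div_assoc, div_le_one (by positivity)]
      exact h3)
  refine ⟨x, fun b hb => ?_⟩
  have key : ∀ s, (pl s d / pl s a + pl s x) ^ 2 + pl s g / pl s a ^ 2 = pl s b / pl s a := by
    intro s
    have h1 := congrArg (pl s) hb
    simp only [map_add, map_mul, map_pow] at h1
    have := (ha s).ne'
    field_simp
    linear_combination -h1
  rw [key, key, div_mul_div_comm, pl_mul_pl, pl_mul_pl, div_lt_one (by exact_mod_cast ha.norm_pos)]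
    at hx
  exact_mod_cast hx

/-- A ternary quadratic form `a x² + b y² + c z² + 2 d x y + 2 e x z + 2 f y z`. -/
structure TForm (R : Type*) where
  a : R
  b : R
  c : R
  d : R
  e : R
  f : R

/-- A totally positive definite ternary form of determinant `1` which represents `α`. -/
structure Adm (α : QuadraticAlgebra ℤ m n) (Q : TForm (QuadraticAlgebra ℤ m n)) : Prop where
  pos : TPos Q.a
  minor_pos : TPos (Q.a * Q.b - Q.d ^ 2)
  det : Q.c * (Q.a * Q.b - Q.d ^ 2) -
    (Q.a * Q.f ^ 2 - 2 * Q.d * Q.e * Q.f + Q.b * Q.e ^ 2) = 1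
  rep : ∃ x y z, Q.a * x ^ 2 + Q.b * y ^ 2 + Q.c * z ^ 2 + 2 * Q.d * x * y + 2 * Q.e * x * z +
    2 * Q.f * y * z = α

variable {α : QuadraticAlgebra ℤ m n} {Q : TForm (QuadraticAlgebra ℤ m n)}

lemma Adm.shift₁₂ (h : Adm α Q) (x : QuadraticAlgebra ℤ m n) :
    Adm α ⟨Q.a, Q.b + 2 * x * Q.d + x ^ 2 * Q.a, Q.c, Q.d + x * Q.a, Q.e, Q.f + x * Q.e⟩ := by
  obtain ⟨h1, h2, h3, u, v, w, h4⟩ := h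
  refine ⟨h1, ?_, ?_, u - x * v, v, w, ?_⟩
  · convert h2 using 1; ring
  · linear_combination h3
  · linear_combination h4

lemma Adm.shift₁₃ (h : Adm α Q) (x : QuadraticAlgebra ℤ m n) :
    Adm α ⟨Q.a, Q.b, Q.c + 2 * x * Q.e + x ^ 2 * Q.a, Q.d, Q.e + x * Q.a, Q.f + x * Q.d⟩ := by
  obtain ⟨h1, h2, h3, u, v, w, h4⟩ := h
  refine ⟨h1, h2, ?_, u - x * w, v, w, ?_⟩
  · linear_combination h3
  · linear_combination h4

lemma Adm.shift₂₃ (h : Adm α Q) (y : QuadraticAlgebra ℤ m n) :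
    Adm α ⟨Q.a, Q.b, Q.c + 2 * y * Q.f + y ^ 2 * Q.b, Q.d, Q.e + y * Q.d, Q.f + y * Q.b⟩ := by
  obtain ⟨h1, h2, h3, u, v, w, h4⟩ := h
  refine ⟨h1, h2, ?_, u, v - y * w, w, ?_⟩
  · linear_combination h3
  · linear_combination h4

lemma Adm.b_pos (h : Adm α Q) : TPos Q.b := by
  apply h.pos.of_mul
  convert h.minor_pos.sq_add (y := Q.d) using 1
  ring

lemma Adm.minor_mul (h : Adm α Q) : (Q.a * Q.b - Q.d ^ 2) * (Q.a * Q.c - Q.e ^ 2) =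
    (Q.a * Q.f - Q.d * Q.e) ^ 2 + Q.a := by
  linear_combination Q.a * h.det

lemma Adm.swap₁₂ (h : Adm α Q) : Adm α ⟨Q.b, Q.a, Q.c, Q.d, Q.f, Q.e⟩ := by
  have hb := h.b_pos
  obtain ⟨h1, h2, h3, u, v, w, h4⟩ := h
  refine ⟨hb, ?_, ?_, v, u, w, ?_⟩
  · convert h2 using 1; ring
  · linear_combination h3
  · linear_combination h4

lemma Adm.swap₂₃ (h : Adm α Q) : Adm α ⟨Q.a, Q.c, Q.b, Q.e, Q.d, Q.f⟩ := by
  have hb : TPos (Q.a * Q.c - Q.e ^ 2) := by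
    apply h.minor_pos.of_mul
    rw [h.minor_mul]
    exact h.pos.sq_add
  obtain ⟨h1, h2, h3, u, v, w, h4⟩ := h
  refine ⟨h1, hb, ?_, u, w, v, ?_⟩
  · linear_combination h3
  · linear_combination h4

/-- Every class contains a reduced form. -/
lemma exists_reduced {C : ℕ} (hbox : Box m n C) (hQ : Adm α Q) :
    ∃ Q : TForm (QuadraticAlgebra ℤ m n), Adm α Q ∧ (∀ Q', Adm α Q' → Q.a.norm ≤ Q'.a.norm) ∧
      Q.a.norm ^ 2 < C * (Q.a * Q.b - Q.d ^ 2).norm ∧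
      (Q.a * Q.b - Q.d ^ 2).norm ^ 2 < C * Q.a.norm := by
  classical
  obtain ⟨Q₁, hQ₁, hmin₁⟩ := WellFounded.has_min (InvImage.wf
    (fun Q : TForm (QuadraticAlgebra ℤ m n) => Q.a.norm.toNat) Nat.lt_wfRel.wf)
    {Q | Adm α Q} ⟨Q, hQ⟩
  have hmin₁' : ∀ Q', Adm α Q' → Q₁.a.norm ≤ Q'.a.norm := fun Q' hQ' => by
    have := hmin₁ Q' hQ'
    simp only [InvImage] at this
    have h1 := hQ'.pos.norm_pos
    have h2 : ¬ Q'.a.norm.toNat < Q₁.a.norm.toNat := this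
    omega
  obtain ⟨Q₂, ⟨hQ₂, ha⟩, hmin₂⟩ := WellFounded.has_min (InvImage.wf
    (fun Q : TForm (QuadraticAlgebra ℤ m n) => (Q.a * Q.b - Q.d ^ 2).norm.toNat) Nat.lt_wfRel.wf)
    {Q | Adm α Q ∧ Q.a.norm = Q₁.a.norm} ⟨Q₁, hQ₁, rfl⟩
  refine ⟨Q₂, hQ₂, fun Q' hQ' => ha ▸ hmin₁' Q' hQ', ?_, ?_⟩
  · by_contra! hlt
    obtain ⟨x, hx⟩ := hbox.exists_norm_lt hQ₂.pos hQ₂.minor_pos hlt Q₂.d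
    have h1 := hx (Q₂.b + 2 * x * Q₂.d + x ^ 2 * Q₂.a) (by ring)
    have h2 := hmin₁' _ (hQ₂.shift₁₂ x).swap₁₂
    rw [← ha] at h2
    exact absurd h1 (not_lt.2 h2)
  · by_contra! hlt
    obtain ⟨y, hy⟩ := hbox.exists_norm_lt hQ₂.minor_pos hQ₂.pos hlt (Q₂.a * Q₂.f - Q₂.d * Q₂.e)
    have h0 := hQ₂.shift₂₃ y
    have h1 := hy (Q₂.a * (Q₂.c + 2 * y * Q₂.f + y ^ 2 * Q₂.b) - (Q₂.e + y * Q₂.d) ^ 2) (by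
      rw [h0.minor_mul]; ring)
    have h2 := hmin₂ _ ⟨h0.swap₂₃, ha⟩
    have h3 := hQ₂.minor_pos.norm_pos
    simp only [InvImage] at h2
    have h4 : ¬ (Q₂.a * (Q₂.c + 2 * y * Q₂.f + y ^ 2 * Q₂.b) - (Q₂.e + y * Q₂.d) ^ 2).norm.toNat <
      (Q₂.a * Q₂.b - Q₂.d ^ 2).norm.toNat := h2
    omega

end RealQuad

/-! #### The Euclidean property of the two orders -/

namespace RealQuad

variable {m n : ℤ} [RealQuad m n]

lemma Box.of_range {C : ℝ} (u : (QuadraticAlgebra ℤ m n)ˣ) {e lo : ℝ} (he : 1 < e) (hlo : 0 < lo)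
    (hu : pl (-1) (u : QuadraticAlgebra ℤ m n) ^ 2 * e = pl 1 (u : QuadraticAlgebra ℤ m n) ^ 2)
    (hn : (pl 1 (u : QuadraticAlgebra ℤ m n) * pl (-1) (u : QuadraticAlgebra ℤ m n)) ^ 2 = 1)
    (H : ∀ ξ p : ℤˣ → ℝ, (∀ s, 0 < p s) → C * (p 1 * p (-1)) ≤ 1 → lo * p 1 ≤ p (-1) →
      p (-1) ≤ lo * e * p 1 → ∃ x : QuadraticAlgebra ℤ m n,
        ((ξ 1 + pl 1 x) ^ 2 + p 1) * ((ξ (-1) + pl (-1) x) ^ 2 + p (-1)) < 1) : Box m n C := by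
  intro ξ p hp hC
  obtain ⟨k, hk1, hk2⟩ := exists_mem_Ico_zpow (div_pos (div_pos (hp (-1)) (hp 1)) hlo) he
  have hv (s : ℤˣ) (w : (QuadraticAlgebra ℤ m n)ˣ) : pl s (w : QuadraticAlgebra ℤ m n) ≠ 0 :=
    fun h => w.ne_zero (pl_eq_zero h)
  have hz (s : ℤˣ) : pl s ((u ^ k : (QuadraticAlgebra ℤ m n)ˣ) : QuadraticAlgebra ℤ m n) =
      pl s (u : QuadraticAlgebra ℤ m n) ^ k := by
    have := congrArg Units.val (map_zpow (Units.map ((pl s : QuadraticAlgebra ℤ m n →+* ℝ) : QuadraticAlgebra ℤ m n →* ℝ)) u k)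
    simpa only [Units.val_zpow_eq_zpow_val, Units.coe_map, MonoidHom.coe_coe] using this
  set w := u ^ k
  set c : ℤˣ → ℝ := fun s => pl s (w : QuadraticAlgebra ℤ m n)
  have hc (s : ℤˣ) : c s ≠ 0 := hv s w
  have hcn : (c 1 * c (-1)) ^ 2 = 1 := by
    simp only [c, hz]
    rw [← mul_zpow, ← zpow_natCast, ← zpow_mul, mul_comm k, zpow_mul, zpow_natCast, hn, one_zpow]
  have hcr : c (-1) ^ 2 * e ^ k = c 1 ^ 2 := by
    simp only [c, hz]
    rw [← zpow_natCast, ← zpow_natCast, ← zpow_mul, ← zpow_mul, mul_comm k, zpow_mul, zpow_mul,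
      zpow_natCast, zpow_natCast, ← mul_zpow, hu]
  have hek : 0 < e ^ k := zpow_pos (by linarith) k
  have h1 := hp 1
  have h2 := hp (-1)
  rw [le_div_iff₀ hlo, le_div_iff₀ h1] at hk1
  rw [div_lt_iff₀ hlo, div_lt_iff₀ h1, zpow_add_one₀ (by linarith)] at hk2
  obtain ⟨x, hx⟩ := H (fun s => c s * ξ s) (fun s => c s ^ 2 * p s)
    (fun s => mul_pos (by have := hc s; positivity) (hp s)) (by
      calc C * (c 1 ^ 2 * p 1 * (c (-1) ^ 2 * p (-1))) = C * (p 1 * p (-1)) * (c 1 * c (-1)) ^ 2 := by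
            ring
        _ ≤ 1 := by rw [hcn, mul_one]; exact hC) (by
      have := mul_le_mul_of_nonneg_left hk1 (sq_nonneg (c (-1)))
      rw [← hcr]
      linarith) (by
      have := mul_le_mul_of_nonneg_left hk2.le (sq_nonneg (c (-1)))
      rw [← hcr]
      linarith)
  refine ⟨((w⁻¹ : (QuadraticAlgebra ℤ m n)ˣ) : QuadraticAlgebra ℤ m n) * x, ?_⟩
  have key (s : ℤˣ) : c s ^ 2 * ((ξ s + pl s (((w⁻¹ : (QuadraticAlgebra ℤ m n)ˣ) : QuadraticAlgebra ℤ m n) * x)) ^ 2 + p s) =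
      (c s * ξ s + pl s x) ^ 2 + c s ^ 2 * p s := by
    have h3 : c s * pl s (((w⁻¹ : (QuadraticAlgebra ℤ m n)ˣ) : QuadraticAlgebra ℤ m n) * x) = pl s x := by
      rw [← map_mul, ← mul_assoc, Units.mul_inv, one_mul]
    linear_combination (2 * c s * ξ s + c s * pl s (((w⁻¹ : (QuadraticAlgebra ℤ m n)ˣ) : QuadraticAlgebra ℤ m n) * x) + pl s x) * h3
  have h4 := hx
  simp only [← key] at h4
  calc _ = (c 1 * c (-1)) ^ 2 * _ := by rw [hcn, one_mul]
    _ < 1 := by linarith [h4]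

instance : RealQuad 1 1 where
  disc_pos := by norm_num
  not_sq k h := by
    have : k < 3 := by nlinarith
    have : -3 < k := by nlinarith
    interval_cases k <;> omega

instance : RealQuad 2 0 where
  disc_pos := by norm_num
  not_sq k h := by
    have : k < 3 := by nlinarith
    have : -3 < k := by nlinarith
    interval_cases k <;> omega

lemma pl_five (s : ℤˣ) (x : QuadraticAlgebra ℤ 1 1) :
    pl s x = x.re + x.im * ((1 + (s : ℤ) * √5) / 2) := by
  rw [pl_apply]; norm_num

lemma pl_eight (s : ℤˣ) (x : QuadraticAlgebra ℤ 2 0) :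
    pl s x = x.re + x.im * ((s : ℤ) * √2) := by
  have : √((0 ^ 2 + 4 * 2 : ℤ) : ℝ) = 2 * √2 := by
    rw [show ((0 ^ 2 + 4 * 2 : ℤ) : ℝ) = 2 ^ 2 * 2 by norm_num, Real.sqrt_mul (by norm_num),
      Real.sqrt_sq (by norm_num)]
  rw [pl_apply, this]
  push_cast
  ring

lemma prod_lt_one {N f g X Y a b t : ℝ} (hN : X * Y = N) (hf : t * X ^ 2 + Y ^ 2 / t ≤ f)
    (ha : 0 < a) (ht : 0 < t) (hb : b = t * a) (hg : a * b ≤ g) (hF : N ^ 2 + g * f + g ^ 2 < 1) :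
    (X ^ 2 + a ^ 2) * (Y ^ 2 + b ^ 2) < 1 := by
  have h1 : 0 < a * b := by rw [hb]; positivity
  have hg0 : 0 ≤ g := h1.le.trans hg
  have h0 : 0 ≤ t * X ^ 2 + Y ^ 2 / t := by positivity
  calc (X ^ 2 + a ^ 2) * (Y ^ 2 + b ^ 2) = N ^ 2 + a * b * (t * X ^ 2 + Y ^ 2 / t) + (a * b) ^ 2 := by
        rw [← hN, hb]; field_simp; ring
    _ ≤ N ^ 2 + g * f + g ^ 2 := by gcongr
    _ < 1 := hF

lemma bound_five {r t u v : ℝ} (h5 : r ^ 2 = 5) (hr : 2 < r) (ht2 : (3 - r) / 2 ≤ t) (ht1 : t ≤ 1)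
    (hu1 : -(1 / 2) ≤ u) (hu2 : u ≤ 1 / 2) (hv1 : -(1 / 2) ≤ v) (hv2 : v ≤ 1 / 2) :
    ((u + v * ((1 + r) / 2)) * (u + v * ((1 - r) / 2))) ^ 2 ≤ (5 / 16) ^ 2 ∧
      t ^ 2 * (u + v * ((1 + r) / 2)) ^ 2 + (u + v * ((1 - r) / 2)) ^ 2 ≤ 7 / 4 * t := by
  have hs1 : u ^ 2 ≤ 1 / 4 := by nlinarith
  have hs2 : v ^ 2 ≤ 1 / 4 := by nlinarith
  constructor
  · rw [show (u + v * ((1 + r) / 2)) * (u + v * ((1 - r) / 2)) = u ^ 2 + u * v - v ^ 2 by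
      linear_combination -v ^ 2 / 4 * h5]
    apply sq_le_sq'
    · linarith [sq_nonneg (u + v / 2)]
    · linarith [sq_nonneg (v - u / 2)]
  · obtain ⟨X, hX⟩ : ∃ X, X = u + v * ((1 + r) / 2) := ⟨_, rfl⟩
    obtain ⟨Y, hY⟩ : ∃ Y, Y = u + v * ((1 - r) / 2) := ⟨_, rfl⟩
    obtain ⟨l, hl⟩ : ∃ l, l = (3 - r) / 2 := ⟨_, rfl⟩
    have hl0 : 0 < l := by nlinarith
    have hl1 : l < 1 := by linarith
    have hA : X ^ 2 + Y ^ 2 ≤ 7 / 4 := by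
      rw [show X ^ 2 + Y ^ 2 = 2 * u ^ 2 + 2 * u * v + 3 * v ^ 2 by
        rw [hX, hY]; linear_combination v ^ 2 / 2 * h5]
      linarith [sq_nonneg (u - v)]
    have hB : l ^ 2 * X ^ 2 + Y ^ 2 ≤ 7 / 4 * l := by
      rw [show l ^ 2 * X ^ 2 + Y ^ 2 = (3 * u ^ 2 - 2 * u * v + 2 * v ^ 2) * l by
        rw [hX, hY, hl]
        linear_combination (u ^ 2 / 4 - 5 / 4 * u * v + r / 4 * u * v + r ^ 2 / 16 * v ^ 2 -
          r / 4 * v ^ 2 + 7 * v ^ 2 / 16) * h5]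
      gcongr
      linarith [sq_nonneg (u + v)]
    rw [← hX, ← hY]
    have h1 : 0 ≤ X ^ 2 * ((t - l) * (1 - t)) :=
      mul_nonneg (sq_nonneg X) (mul_nonneg (by linarith) (by linarith))
    have h2 := mul_nonneg (show 0 ≤ t - l by linarith) (sub_nonneg.2 hA)
    have h3 := mul_nonneg (show 0 ≤ 1 - t by linarith) (sub_nonneg.2 hB)
    have h4 : 0 ≤ (1 - l) * (7 / 4 * t - (X ^ 2 * ((1 + l) * t - l) + Y ^ 2)) := by linarith
    have h5 := nonneg_of_mul_nonneg_right h4 (by linarith)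
    linarith

lemma bound_eight {r t u v l : ℝ} (h2 : r ^ 2 = 2) (hr : 7 / 5 < r) (ht2 : r - 1 ≤ t)
    (ht1 : t ≤ 1 + r) (hl : l * (t ^ 2 + 1) = r * (t ^ 2 - 1))
    (hv1 : -(1 / 2) ≤ v) (hv2 : v ≤ 1 / 2) (hw1 : -(1 / 2) ≤ u + l * v) (hw2 : u + l * v ≤ 1 / 2) :
    ((u + v * r) * (u - v * r)) ^ 2 ≤ (1 / 2) ^ 2 ∧
      t ^ 2 * (u + v * r) ^ 2 + (u - v * r) ^ 2 ≤ 3 / 2 * t := by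
  have ht0 : 0 < t := by linarith
  have htq : t ^ 2 + 1 ≤ 2 * r * t := by nlinarith
  have hl2 : (2 - l ^ 2) * (t ^ 2 + 1) ^ 2 = 8 * t ^ 2 := by
    linear_combination (-l * (t ^ 2 + 1) - r * (t ^ 2 - 1)) * hl - (t ^ 2 - 1) ^ 2 * h2
  have hl1 : l ^ 2 ≤ 1 := by
    have h3 : (t ^ 2 + 1) ^ 2 ≤ 8 * t ^ 2 := by
      calc (t ^ 2 + 1) ^ 2 ≤ (2 * r * t) ^ 2 := by gcongr
        _ = 8 * t ^ 2 := by rw [mul_pow, mul_pow, h2]; ring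
    have h4 : 0 ≤ (1 - l ^ 2) * (t ^ 2 + 1) ^ 2 := by linarith
    linarith [nonneg_of_mul_nonneg_left h4 (by positivity)]
  obtain ⟨w, hw⟩ : ∃ w, w = u + l * v := ⟨_, rfl⟩
  rw [← hw] at hw1 hw2
  have hs1 : w ^ 2 ≤ 1 / 4 := by nlinarith
  have hs2 : v ^ 2 ≤ 1 / 4 := by nlinarith
  constructor
  · rw [show (u + v * r) * (u - v * r) = u ^ 2 - 2 * v ^ 2 by linear_combination -v ^ 2 * h2]
    apply sq_le_sq'
    · linarith [sq_nonneg u]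
    · have h5 : |l| ≤ 1 := abs_le_one_iff_mul_self_le_one.2 (by linarith)
      have h8 : |u| ≤ 1 / 2 + |v| := by
        calc |u| ≤ |w| + |l * v| := by rw [show u = w - l * v by rw [hw]; ring]; exact abs_sub _ _
          _ ≤ 1 / 2 + |v| := by
            rw [abs_mul]
            linarith [mul_le_mul_of_nonneg_right h5 (abs_nonneg v), abs_le.2 ⟨hw1, hw2⟩]
      have h9 := pow_le_pow_left₀ (abs_nonneg u) h8 2
      rw [sq_abs] at h9
      linarith [sq_nonneg (|v| - 1 / 2), sq_abs v]
  · have h3 : (t ^ 2 + 1) * (t ^ 2 * (u + v * r) ^ 2 + (u - v * r) ^ 2) =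
        (t ^ 2 + 1) ^ 2 * w ^ 2 + 8 * t ^ 2 * v ^ 2 := by
      rw [hw]
      linear_combination -2 * (t ^ 2 + 1) * u * v * hl + (t ^ 2 + 1) ^ 2 * v ^ 2 * h2 + v ^ 2 * hl2
    have h4 : 0 ≤ (2 * (2 * t) - (t ^ 2 + 1)) * (t ^ 2 + 1 - 2 * t) :=
      mul_nonneg (by nlinarith) (by linarith [sq_nonneg (t - 1)])
    have h5 := mul_le_mul_of_nonneg_left hs1 (sq_nonneg (t ^ 2 + 1))
    have h6 := mul_le_mul_of_nonneg_left hs2 (sq_nonneg t)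
    refine le_of_mul_le_mul_left (a := t ^ 2 + 1) ?_ (by positivity)
    linarith

lemma box_five : Box 1 1 6 := by
  have h5 : √5 ^ 2 = 5 := Real.sq_sqrt (by norm_num)
  have h5' : 2 < √5 := by rw [Real.lt_sqrt] <;> norm_num
  have h5'' : √5 < 9 / 4 := by rw [Real.sqrt_lt'] <;> norm_num
  set r := √5 with hr
  have hu : (⟨0, 1⟩ : QuadraticAlgebra ℤ 1 1) * ⟨-1, 1⟩ = 1 := by
    ext <;> simp [QuadraticAlgebra.re_one, QuadraticAlgebra.im_one]
  have hu' : (⟨-1, 1⟩ : QuadraticAlgebra ℤ 1 1) * ⟨0, 1⟩ = 1 := by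
    ext <;> simp [QuadraticAlgebra.re_one, QuadraticAlgebra.im_one]
  refine Box.of_range ⟨⟨0, 1⟩, ⟨-1, 1⟩, hu, hu'⟩ (e := ((3 + r) / 2) ^ 2) (lo := ((3 - r) / 2) ^ 2)
    (by nlinarith) (by nlinarith) ?_ ?_ ?_
  · simp only [pl_five, ← hr]
    push_cast
    linear_combination (r ^ 2 + 4 * r - 1) / 16 * h5
  · simp only [pl_five, ← hr]
    push_cast
    linear_combination (r ^ 2 / 16 + 3 / 16) * h5
  intro ξ p hp hC h1 h2
  have hlo : ((3 - r) / 2) ^ 2 * ((3 + r) / 2) ^ 2 = 1 := by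
    linear_combination (r ^ 2 - 13) / 16 * h5
  rw [hlo, one_mul] at h2
  obtain ⟨a, ha, hpa⟩ : ∃ a, 0 < a ∧ p 1 = a ^ 2 := ⟨√(p 1), Real.sqrt_pos.2 (hp 1),
    (Real.sq_sqrt (hp 1).le).symm⟩
  obtain ⟨b, hb, hpb⟩ : ∃ a, 0 < a ∧ p (-1) = a ^ 2 := ⟨√(p (-1)), Real.sqrt_pos.2 (hp (-1)),
    (Real.sq_sqrt (hp (-1)).le).symm⟩
  rw [hpa, hpb] at hC h1 h2 ⊢
  obtain ⟨t, rfl⟩ : ∃ t, b = t * a := ⟨b / a, by field_simp⟩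
  have ht : 0 < t := pos_of_mul_pos_left hb ha.le
  have ht1 : t ≤ 1 := by
    have : t * a ≤ 1 * a := by rw [one_mul]; exact (pow_le_pow_iff_left₀ hb.le ha.le two_ne_zero).1 h2
    exact le_of_mul_le_mul_right this ha
  have ht2 : (3 - r) / 2 ≤ t := by
    have h0 : 0 ≤ (3 - r) / 2 := by linarith
    rw [← mul_pow] at h1
    have := (pow_le_pow_iff_left₀ (by positivity) hb.le two_ne_zero).1 h1
    exact le_of_mul_le_mul_right this ha
  obtain ⟨β, hβ⟩ : ∃ β, β * r = ξ 1 - ξ (-1) := ⟨(ξ 1 - ξ (-1)) / r, by field_simp⟩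
  obtain ⟨α, hα⟩ : ∃ α, α = ξ 1 - β * ((1 + r) / 2) := ⟨_, rfl⟩
  obtain ⟨hv1, hv2⟩ := abs_le.1 (abs_sub_round β)
  obtain ⟨hu1, hu2⟩ := abs_le.1 (abs_sub_round α)
  refine ⟨⟨-round α, -round β⟩, ?_⟩
  have hX : ξ 1 + pl 1 (⟨-round α, -round β⟩ : QuadraticAlgebra ℤ 1 1) =
      (α - round α) + (β - round β) * ((1 + r) / 2) := by
    rw [pl_five, ← hr]; push_cast; linear_combination -hα
  have hY : ξ (-1) + pl (-1) (⟨-round α, -round β⟩ : QuadraticAlgebra ℤ 1 1) =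
      (α - round α) + (β - round β) * ((1 - r) / 2) := by
    rw [pl_five, ← hr]; push_cast; linear_combination hβ - hα
  rw [hX, hY]
  have h6 : √(1 / 6 : ℝ) ^ 2 = 1 / 6 := Real.sq_sqrt (by norm_num)
  have h6' : √(1 / 6 : ℝ) ≤ 41 / 100 := by rw [Real.sqrt_le_left] <;> norm_num
  have hg : a * (t * a) ≤ √(1 / 6) := Real.le_sqrt_of_sq_le (by linarith)
  obtain ⟨hN, hf⟩ := bound_five h5 h5' ht2 ht1 hu1 hu2 hv1 hv2
  refine prod_lt_one (f := 7 / 4) (t := t) rfl ?_ ha ht rfl hg ?_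
  · rw [← le_sub_iff_add_le', div_le_iff₀ ht]
    linarith
  · linarith

lemma box_eight : Box 2 0 7 := by
  have h2 : √2 ^ 2 = 2 := Real.sq_sqrt (by norm_num)
  have h2' : 7 / 5 < √2 := by rw [Real.lt_sqrt] <;> norm_num
  have h2'' : √2 < 3 / 2 := by rw [Real.sqrt_lt'] <;> norm_num
  set r := √2 with hr
  have hu : (⟨1, 1⟩ : QuadraticAlgebra ℤ 2 0) * ⟨-1, 1⟩ = 1 := by
    ext <;> simp [QuadraticAlgebra.re_one, QuadraticAlgebra.im_one]
  have hu' : (⟨-1, 1⟩ : QuadraticAlgebra ℤ 2 0) * ⟨1, 1⟩ = 1 := by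
    ext <;> simp [QuadraticAlgebra.re_one, QuadraticAlgebra.im_one]
  refine Box.of_range ⟨⟨1, 1⟩, ⟨-1, 1⟩, hu, hu'⟩ (e := (1 + r) ^ 4) (lo := (r - 1) ^ 2)
    (one_lt_pow₀ (by linarith) (by norm_num)) (by nlinarith) ?_ ?_ ?_
  · simp only [pl_eight, ← hr]
    push_cast
    linear_combination ((1 + r) ^ 2 * r ^ 2) * h2
  · simp only [pl_eight, ← hr]
    push_cast
    linear_combination r ^ 2 * h2
  intro ξ p hp hC h3 h4
  have hlo : (r - 1) ^ 2 * (1 + r) ^ 4 = (1 + r) ^ 2 := by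
    linear_combination ((1 + r) ^ 2 * r ^ 2) * h2
  rw [hlo] at h4
  obtain ⟨a, ha, hpa⟩ : ∃ a, 0 < a ∧ p 1 = a ^ 2 := ⟨√(p 1), Real.sqrt_pos.2 (hp 1),
    (Real.sq_sqrt (hp 1).le).symm⟩
  obtain ⟨b, hb, hpb⟩ : ∃ a, 0 < a ∧ p (-1) = a ^ 2 := ⟨√(p (-1)), Real.sqrt_pos.2 (hp (-1)),
    (Real.sq_sqrt (hp (-1)).le).symm⟩
  rw [hpa, hpb] at hC h3 h4 ⊢
  obtain ⟨t, rfl⟩ : ∃ t, b = t * a := ⟨b / a, by field_simp⟩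
  have ht : 0 < t := pos_of_mul_pos_left hb ha.le
  have ht1 : t ≤ 1 + r := by
    rw [← mul_pow] at h4
    have := (pow_le_pow_iff_left₀ hb.le (by positivity) two_ne_zero).1 h4
    exact le_of_mul_le_mul_right this ha
  have ht2 : r - 1 ≤ t := by
    have h0 : 0 ≤ r - 1 := by linarith
    rw [← mul_pow] at h3
    have := (pow_le_pow_iff_left₀ (by positivity) hb.le two_ne_zero).1 h3
    exact le_of_mul_le_mul_right this ha
  have htq : t ^ 2 + 1 ≤ 2 * r * t := by nlinarith
  obtain ⟨l, hl⟩ : ∃ l, l * (t ^ 2 + 1) = r * (t ^ 2 - 1) :=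
    ⟨r * (t ^ 2 - 1) / (t ^ 2 + 1), by field_simp⟩
  obtain ⟨β, hβ⟩ : ∃ β, β * r = (ξ 1 - ξ (-1)) / 2 := ⟨(ξ 1 - ξ (-1)) / 2 / r, by field_simp⟩
  obtain ⟨α, hα⟩ : ∃ α, α = (ξ 1 + ξ (-1)) / 2 := ⟨_, rfl⟩
  obtain ⟨hv1, hv2⟩ := abs_le.1 (abs_sub_round β)
  obtain ⟨hw1, hw2⟩ := abs_le.1 (abs_sub_round (α + l * (β - round β)))
  refine ⟨⟨-round (α + l * (β - round β)), -round β⟩, ?_⟩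
  obtain ⟨c, hc⟩ : ∃ c, c = round (α + l * (β - round β)) := ⟨_, rfl⟩
  rw [← hc] at hw1 hw2 ⊢
  have hX : ξ 1 + pl 1 (⟨-c, -round β⟩ : QuadraticAlgebra ℤ 2 0) =
      (α - c) + (β - round β) * r := by
    rw [pl_eight, ← hr]; push_cast; linear_combination -hβ - hα
  have hY : ξ (-1) + pl (-1) (⟨-c, -round β⟩ : QuadraticAlgebra ℤ 2 0) =
      (α - c) - (β - round β) * r := by
    rw [pl_eight, ← hr]; push_cast; linear_combination hβ - hα
  rw [hX, hY]
  have h6 : √(1 / 7 : ℝ) ^ 2 = 1 / 7 := Real.sq_sqrt (by norm_num)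
  have h6' : √(1 / 7 : ℝ) ≤ 38 / 100 := by rw [Real.sqrt_le_left] <;> norm_num
  have hg : a * (t * a) ≤ √(1 / 7) := Real.le_sqrt_of_sq_le (by linarith)
  obtain ⟨hN, hf⟩ := bound_eight h2 h2' ht2 ht1 hl hv1 hv2 (u := α - c) (by linarith) (by linarith)
  refine prod_lt_one (f := 3 / 2) (t := t) rfl ?_ ha ht rfl hg ?_
  · rw [← le_sub_iff_add_le', div_le_iff₀ ht]
    linarith
  · linarith

end RealQuad

/-! #### Reduced forms -/

namespace RealQuad

variable {m n : ℤ} [RealQuad m n] {α : QuadraticAlgebra ℤ m n} {Q : TForm (QuadraticAlgebra ℤ m n)}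

variable (m n) in
/-- Totally positive units are squares of units. -/
def UnitSq : Prop :=
  ∀ x : QuadraticAlgebra ℤ m n, TPos x → x.norm = 1 → ∃ y z, y * z = 1 ∧ x = y ^ 2

lemma Adm.scale₁₂ (h : Adm α Q) {u v : QuadraticAlgebra ℤ m n} (huv : u * v = 1) :
    Adm α ⟨Q.a * u ^ 2, Q.b * v ^ 2, Q.c, Q.d, Q.e * u, Q.f * v⟩ := by
  have hu : u ≠ 0 := left_ne_zero_of_mul_eq_one huv
  obtain ⟨h1, h2, h3, x, y, z, h4⟩ := h
  have key : Q.a * u ^ 2 * (Q.b * v ^ 2) = Q.a * Q.b := by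
    linear_combination Q.a * Q.b * (u * v + 1) * huv
  refine ⟨h1.mul (tpos_sq hu), ?_, ?_, x * v, y * u, z, ?_⟩
  · dsimp only; rwa [key]
  · dsimp only
    rw [key]
    linear_combination h3 - (Q.a * Q.f ^ 2 + Q.b * Q.e ^ 2) * (u * v + 1) * huv +
      2 * Q.d * Q.e * Q.f * huv
  · dsimp only
    linear_combination h4 + ((Q.a * x ^ 2 + Q.b * y ^ 2) * (u * v + 1) +
      2 * Q.d * x * y + 2 * Q.e * x * z + 2 * Q.f * y * z) * huv

lemma Adm.scale₂₃ (h : Adm α Q) {u v : QuadraticAlgebra ℤ m n} (huv : u * v = 1) :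
    Adm α ⟨Q.a, Q.b * u ^ 2, Q.c * v ^ 2, Q.d * u, Q.e * v, Q.f⟩ := by
  have hu : u ≠ 0 := left_ne_zero_of_mul_eq_one huv
  obtain ⟨h1, h2, h3, x, y, z, h4⟩ := h
  refine ⟨h1, ?_, ?_, x, y * v, z * u, ?_⟩
  · dsimp only
    convert h2.mul (tpos_sq hu) using 1; ring
  · dsimp only
    linear_combination h3 + ((Q.c * (Q.a * Q.b - Q.d ^ 2) - Q.b * Q.e ^ 2) * (u * v + 1) +
      2 * Q.d * Q.e * Q.f) * huv
  · dsimp only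
    linear_combination h4 + ((Q.b * y ^ 2 + Q.c * z ^ 2) * (u * v + 1) +
      2 * Q.d * x * y + 2 * Q.e * x * z + 2 * Q.f * y * z) * huv

/-- A form which takes a unit value on a basis vector splits. -/
lemma Adm.exists_split (hsq : UnitSq m n) (h : Adm α Q) (ha : Q.a.norm = 1) :
    ∃ c f, Adm α ⟨1, Q.a * Q.b - Q.d ^ 2, c, 0, 0, f⟩ := by
  obtain ⟨y, z, hyz, hy⟩ := hsq _ h.pos ha
  have h1 := h.scale₁₂ (u := z) (v := y) (by rw [mul_comm, hyz])
  have hz : Q.a * z ^ 2 = 1 := by rw [hy]; linear_combination (y * z + 1) * hyz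
  rw [hz] at h1
  have h2 := (h1.shift₁₂ (-Q.d)).shift₁₃ (-(Q.e * z))
  refine ⟨Q.c + 2 * -(Q.e * z) * (Q.e * z) + (-(Q.e * z)) ^ 2 * 1, Q.f * y + -Q.d * (Q.e * z), ?_⟩
  convert h2 using 2
  · dsimp only; rw [← hy]; ring
  · ring
  · ring
  · ring

lemma Adm.sum_three_sq (hsq : UnitSq m n) (h : Adm α Q) (ha : Q.a.norm = 1)
    (hG : (Q.a * Q.b - Q.d ^ 2).norm = 1) : ∃ x y z, α = x ^ 2 + y ^ 2 + z ^ 2 := by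
  obtain ⟨y, z, hyz, hy⟩ := hsq _ h.minor_pos hG
  obtain ⟨c, f, h1⟩ := h.exists_split hsq ha
  have h2 := (h1.scale₂₃ (u := z) (v := y) (by rw [mul_comm, hyz])).shift₂₃ (-f)
  have hz : (Q.a * Q.b - Q.d ^ 2) * z ^ 2 = 1 := by rw [hy]; linear_combination (y * z + 1) * hyz
  obtain ⟨-, -, h3, u, v, w, h4⟩ := h2
  dsimp only at h3 h4
  rw [hz] at h3 h4
  refine ⟨u, v, w, ?_⟩
  rw [← h4]
  linear_combination w ^ 2 * h3

/-- Minimality of the first coefficient of an admissible form. -/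
def Adm.Min (α : QuadraticAlgebra ℤ m n) (Q : TForm (QuadraticAlgebra ℤ m n)) : Prop :=
  ∀ Q', Adm α Q' → Q.a.norm ≤ Q'.a.norm

lemma Adm.norm_eq_one_of_minor (hsq : UnitSq m n) (h : Adm α Q) (hmin : Adm.Min α Q)
    (hG : (Q.a * Q.b - Q.d ^ 2).norm = 1) : Q.a.norm = 1 := by
  obtain ⟨y, z, hyz, hy⟩ := hsq _ h.minor_pos hG
  have hz : (Q.a * Q.b - Q.d ^ 2) * z ^ 2 = 1 := by rw [hy]; linear_combination (y * z + 1) * hyz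
  have h1 := (h.shift₂₃ (-(Q.a * Q.f - Q.d * Q.e) * z ^ 2)).shift₁₃
    (-(Q.b * Q.e - Q.d * Q.f) * z ^ 2)
  have h2 := h1.det
  dsimp only at h2
  have h3 : Q.e + -(Q.a * Q.f - Q.d * Q.e) * z ^ 2 * Q.d + -(Q.b * Q.e - Q.d * Q.f) * z ^ 2 * Q.a = 0 := by
    linear_combination -Q.e * hz
  have h4 : Q.f + -(Q.a * Q.f - Q.d * Q.e) * z ^ 2 * Q.b + -(Q.b * Q.e - Q.d * Q.f) * z ^ 2 * Q.d = 0 := by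
    linear_combination -Q.f * hz
  rw [h3, h4] at h2
  simp only [ne_eq, OfNat.ofNat_ne_zero, not_false_eq_true, zero_pow, mul_zero, add_zero,
    sub_zero] at h2
  have h5 := congrArg QuadraticAlgebra.norm h2
  rw [map_mul, hG, map_one, mul_one] at h5
  have h6 := hmin _ h1.swap₂₃.swap₁₂
  dsimp only at h6
  rw [h5] at h6
  have := h.pos.norm_pos
  omega

lemma Adm.norm_eq_one_of_dvd (h : Adm α Q) (hmin : Adm.Min α Q) (hd : Q.a ∣ Q.d)
    (hG : (Q.a * Q.b - Q.d ^ 2).norm = Q.a.norm) : Q.a.norm = 1 := by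
  obtain ⟨x, hx⟩ := hd
  have h1 := (h.shift₁₂ (-x)).swap₁₂
  have h2 := hmin _ h1
  dsimp only at h2
  have h3 : (Q.b + 2 * -x * Q.d + (-x) ^ 2 * Q.a) * Q.a = Q.a * Q.b - Q.d ^ 2 := by
    rw [hx]; ring
  have h4 := congrArg QuadraticAlgebra.norm h3
  rw [map_mul, hG] at h4
  have h5 := h.pos.norm_pos
  have h6 := mul_right_cancel₀ h5.ne' (h4.trans (one_mul _).symm)
  omega

lemma dvd_of_norm_eq {x y : QuadraticAlgebra ℤ m n} (h : x.norm = y.norm ∨ x.norm = -y.norm)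
    (hx : x.norm ≠ 0) (hyx : y ∣ x) : x ∣ y := by
  obtain ⟨w, hw⟩ := hyx
  have h1 := congrArg QuadraticAlgebra.norm hw
  rw [map_mul] at h1
  have h2 : w * star w = (w.norm : QuadraticAlgebra ℤ m n) :=
    (QuadraticAlgebra.algebraMap_norm_eq_mul_star w).symm
  have hy : y.norm ≠ 0 := by rintro h0; rw [h0, zero_mul] at h1; exact hx h1
  rcases h with h | h
  · have h3 : w.norm = 1 := mul_left_cancel₀ hy (by rw [← h1, h, mul_one])
    rw [h3, Int.cast_one] at h2
    exact ⟨star w, by rw [hw, mul_assoc, h2, mul_one]⟩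
  · have h3 : w.norm = -1 := mul_left_cancel₀ hy (by rw [← h1, h]; ring)
    rw [h3, Int.cast_neg, Int.cast_one] at h2
    exact ⟨-star w, by rw [hw]; linear_combination y * h2⟩

lemma Adm.norm_ne_of_prime (h : Adm α Q) (hmin : Adm.Min α Q) {π : QuadraticAlgebra ℤ m n} {ℓ : ℤ}
    (hℓ : Prime ℓ) (hπ : ∀ x : QuadraticAlgebra ℤ m n, ℓ ∣ x.norm → π ∣ x) (hℓπ : ℓ ∣ π.norm)
    (ha : Q.a.norm = π.norm ∨ Q.a.norm = -π.norm)
    (hG : (Q.a * Q.b - Q.d ^ 2).norm = Q.a.norm) : False := by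
  have h1 : ℓ ∣ Q.a.norm := by
    rcases ha with ha | ha <;> rw [ha]
    · exact hℓπ
    · exact hℓπ.neg_right
  have h2 : π ∣ Q.d ^ 2 := by
    have h3 := (hπ _ h1).mul_right Q.b
    have h4 := hπ (Q.a * Q.b - Q.d ^ 2) (by rwa [hG])
    simpa using dvd_sub h3 h4
  have h3 : ℓ ∣ Q.d.norm := by
    obtain ⟨w, hw⟩ := h2
    apply hℓ.dvd_of_dvd_pow (n := 2)
    rw [← map_pow, hw, map_mul]
    exact hℓπ.mul_right _
  have h4 := dvd_of_norm_eq ha h.pos.norm_pos.ne' (hπ _ h1)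
  have h5 := h.norm_eq_one_of_dvd hmin (h4.trans (hπ _ h3)) hG
  rw [h5] at h1
  exact hℓ.not_isUnit (isUnit_of_dvd_one h1)

lemma lt_of_sq_lt {A G C : ℤ} (hA : 0 < A) (hG : 0 < G) (h1 : A ^ 2 < C * G) (h2 : G ^ 2 < C * A) :
    A < C := by
  rcases le_or_gt G A with h | h
  · nlinarith
  · nlinarith

/-! #### Discriminant 5 -/

lemma unitSq_five : UnitSq 1 1 := by
  intro x hx hn
  obtain ⟨k, hk⟩ : ∃ k : ℕ, k = x.im.natAbs := ⟨_, rfl⟩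
  induction k using Nat.strong_induction_on generalizing x with
  | _ k ih =>
  have ht := hx.trace_pos
  have hn' := hn
  rw [QuadraticAlgebra.trace_def] at ht
  rw [QuadraticAlgebra.norm_def] at hn'
  simp only [one_mul] at ht hn'
  have step (c c' : QuadraticAlgebra ℤ 1 1) (hc : c * c' = 1) (hcn : (c ^ 2).norm = 1)
      (hlt : (x * c ^ 2).im.natAbs < k) : ∃ y z, y * z = 1 ∧ x = y ^ 2 := by
    obtain ⟨y, z, hyz, hy⟩ := ih _ hlt (x * c ^ 2) (hx.mul (tpos_sq (left_ne_zero_of_mul_eq_one hc)))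
      (by rw [map_mul, hn, hcn, one_mul]) rfl
    refine ⟨y * c', z * c, ?_, ?_⟩
    · linear_combination c * c' * hyz + hc
    · linear_combination c' ^ 2 * hy - x * (c * c' + 1) * hc
  rcases lt_trichotomy x.im 0 with h0 | h0 | h0
  · have e1 : (⟨0, 1⟩ : QuadraticAlgebra ℤ 1 1) ^ 2 = ⟨1, 1⟩ := by rw [sq]; ext <;> simp
    refine step ⟨0, 1⟩ ⟨-1, 1⟩ (by ext <;> simp [QuadraticAlgebra.re_one, QuadraticAlgebra.im_one]) ?_ ?_
    · rw [e1, QuadraticAlgebra.norm_def]; norm_num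
    · have e2 : (x * (⟨0, 1⟩ : QuadraticAlgebra ℤ 1 1) ^ 2).im = x.re + 2 * x.im := by
        rw [e1]; simp; ring
      have : x.re + 3 * x.im < 0 := by nlinarith
      have : 0 < x.re + x.im := by nlinarith
      rw [e2]
      omega
  · refine ⟨1, 1, one_mul 1, ?_⟩
    have : x.re = 1 := by rw [h0] at ht hn'; nlinarith
    ext <;> simp [this, h0, QuadraticAlgebra.re_one, QuadraticAlgebra.im_one]
  · have e1 : (⟨-1, 1⟩ : QuadraticAlgebra ℤ 1 1) ^ 2 = ⟨2, -1⟩ := by rw [sq]; ext <;> simp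
    refine step ⟨-1, 1⟩ ⟨0, 1⟩ (by ext <;> simp [QuadraticAlgebra.re_one, QuadraticAlgebra.im_one]) ?_ ?_
    · rw [e1, QuadraticAlgebra.norm_def]; norm_num
    · have e2 : (x * (⟨-1, 1⟩ : QuadraticAlgebra ℤ 1 1) ^ 2).im = x.im - x.re := by
        rw [e1]; simp; ring
      have : 0 < x.re := by nlinarith
      have : x.re < 2 * x.im := by nlinarith
      rw [e2]
      omega

lemma sqrt_five_dvd {x : QuadraticAlgebra ℤ 1 1} (h : 5 ∣ x.norm) : ⟨-1, 2⟩ ∣ x := by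
  rw [QuadraticAlgebra.norm_def] at h
  have h1 : (5 : ℤ) ∣ (x.re - 2 * x.im) ^ 2 := by
    rw [show (x.re - 2 * x.im) ^ 2 = x.re * x.re + 1 * x.re * x.im - 1 * x.im * x.im +
      5 * (x.im ^ 2 - x.re * x.im) by ring]
    exact dvd_add h (dvd_mul_right _ _)
  obtain ⟨k, hk⟩ := Int.Prime.dvd_pow' (by norm_num) h1
  push_cast at hk
  refine ⟨⟨-k, x.im + 2 * k⟩, ?_⟩
  ext
  · simp; linarith
  · simp; ring

lemma two_dvd_norm_five {x : QuadraticAlgebra ℤ 1 1} (h : 2 ∣ x.norm) : 2 ∣ x := by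
  rw [QuadraticAlgebra.norm_def] at h
  have h2 := intCast_dvd_iff (m := 1) (n := 1) (k := 2) (x := x)
  rw [show ((2 : ℤ) : QuadraticAlgebra ℤ 1 1) = 2 by norm_num] at h2
  rw [h2, ← even_iff_two_dvd, ← even_iff_two_dvd]
  rw [← even_iff_two_dvd] at h
  simp only [Int.even_add, Int.even_sub, Int.even_mul, Int.not_even_one] at h
  tauto

lemma Adm.sum_three_sq_five {α : QuadraticAlgebra ℤ 1 1} {Q : TForm (QuadraticAlgebra ℤ 1 1)}
    (hQ : Adm α Q) : ∃ x y z, α = x ^ 2 + y ^ 2 + z ^ 2 := by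
  obtain ⟨Q, h, hmin, h1, h2⟩ := exists_reduced (C := 6) box_five hQ
  have ha := h.pos.norm_pos
  have hG := h.minor_pos.norm_pos
  obtain ⟨A, hA⟩ : ∃ A, A = Q.a.norm := ⟨_, rfl⟩
  obtain ⟨G, hG'⟩ : ∃ G, G = (Q.a * Q.b - Q.d ^ 2).norm := ⟨_, rfl⟩
  have not_two (x : QuadraticAlgebra ℤ 1 1) : x.norm ≠ 2 := fun h0 => by
    obtain ⟨y, rfl⟩ := two_dvd_norm_five (x := x) (by rw [h0])
    rw [map_mul, show (2 : QuadraticAlgebra ℤ 1 1).norm = 4 by decide] at h0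
    omega
  have not_three (x : QuadraticAlgebra ℤ 1 1) : x.norm ≠ 3 := fun h0 => by
    rw [QuadraticAlgebra.norm_def] at h0
    have h5 : (2 * x.re + x.im) ^ 2 = 5 * x.im ^ 2 + 12 := by linear_combination 4 * h0
    have h6 := congrArg (fun t : ℤ => (t : ZMod 5)) h5
    push_cast at h6
    rw [show (5 : ZMod 5) = 0 from rfl] at h6
    generalize (2 * (x.re : ZMod 5) + x.im) = t at h6
    generalize (x.im : ZMod 5) = v at h6
    revert t v; decide
  have a2 := not_two Q.a
  have a3 := not_three Q.a
  have g2 := not_two (Q.a * Q.b - Q.d ^ 2)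
  have g3 := not_three (Q.a * Q.b - Q.d ^ 2)
  rw [← hA] at a2 a3 ha h1 h2
  rw [← hG'] at g2 g3 hG h1 h2
  push_cast at h1 h2
  have hA6 : A < 6 := lt_of_sq_lt ha hG h1 h2
  have hG6 : G < 6 := lt_of_sq_lt hG ha h2 h1
  have hcases : A = 1 ∧ G = 1 ∨ A = 4 ∧ G = 4 ∨ A = 5 ∧ G = 5 := by
    interval_cases A <;> interval_cases G <;> simp at *
  rcases hcases with ⟨rfl, rfl⟩ | ⟨rfl, rfl⟩ | ⟨rfl, rfl⟩
  · exact h.sum_three_sq unitSq_five hA.symm hG'.symm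
  · exact (h.norm_ne_of_prime hmin (π := 2) (ℓ := 2) Int.prime_two (fun x hx => two_dvd_norm_five hx)
      (by decide) (by rw [← hA]; decide) (by rw [← hA, ← hG'])).elim
  · exact (h.norm_ne_of_prime hmin (π := ⟨-1, 2⟩) (ℓ := 5) (by norm_num)
      (fun x hx => sqrt_five_dvd hx) (by decide) (by rw [← hA]; decide)
      (by rw [← hA, ← hG'])).elim

end RealQuad

/-! #### Discriminant 8 -/

namespace RealQuad

local notation "R₈" => QuadraticAlgebra ℤ 2 0

lemma unitSq_eight : UnitSq 2 0 := by
  intro x hx hn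
  obtain ⟨k, hk⟩ : ∃ k : ℕ, k = x.im.natAbs := ⟨_, rfl⟩
  induction k using Nat.strong_induction_on generalizing x with
  | _ k ih =>
  have ht := hx.trace_pos
  have hn' := hn
  rw [QuadraticAlgebra.trace_def] at ht
  rw [QuadraticAlgebra.norm_def] at hn'
  simp only [zero_mul, add_zero] at ht hn'
  have step (c c' : R₈) (hc : c * c' = 1) (hcn : (c ^ 2).norm = 1)
      (hlt : (x * c ^ 2).im.natAbs < k) : ∃ y z, y * z = 1 ∧ x = y ^ 2 := by
    obtain ⟨y, z, hyz, hy⟩ := ih _ hlt (x * c ^ 2) (hx.mul (tpos_sq (left_ne_zero_of_mul_eq_one hc)))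
      (by rw [map_mul, hn, hcn, one_mul]) rfl
    refine ⟨y * c', z * c, ?_, ?_⟩
    · linear_combination c * c' * hyz + hc
    · linear_combination c' ^ 2 * hy - x * (c * c' + 1) * hc
  rcases lt_trichotomy x.im 0 with h0 | h0 | h0
  · have e1 : (⟨1, 1⟩ : R₈) ^ 2 = ⟨3, 2⟩ := by rw [sq]; ext <;> simp
    refine step ⟨1, 1⟩ ⟨-1, 1⟩ (by ext <;> simp [QuadraticAlgebra.re_one, QuadraticAlgebra.im_one]) ?_ ?_
    · rw [e1, QuadraticAlgebra.norm_def]; norm_num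
    · have e2 : (x * (⟨1, 1⟩ : R₈) ^ 2).im = 2 * x.re + 3 * x.im := by
        rw [e1]; simp; ring
      have : x.re + 2 * x.im < 0 := by nlinarith
      have : 0 < x.re + x.im := by nlinarith
      rw [e2]
      omega
  · refine ⟨1, 1, one_mul 1, ?_⟩
    have : x.re = 1 := by rw [h0] at hn'; nlinarith
    ext <;> simp [this, h0, QuadraticAlgebra.re_one, QuadraticAlgebra.im_one]
  · have e1 : (⟨-1, 1⟩ : R₈) ^ 2 = ⟨3, -2⟩ := by rw [sq]; ext <;> simp
    refine step ⟨-1, 1⟩ ⟨1, 1⟩ (by ext <;> simp [QuadraticAlgebra.re_one, QuadraticAlgebra.im_one]) ?_ ?_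
    · rw [e1, QuadraticAlgebra.norm_def]; norm_num
    · have e2 : (x * (⟨-1, 1⟩ : R₈) ^ 2).im = 3 * x.im - 2 * x.re := by
        rw [e1]; simp; ring
      have : x.im < x.re := by nlinarith
      have : x.re < 2 * x.im := by nlinarith
      rw [e2]
      omega

/-- Reduction modulo the prime above `2`. -/
def parity : R₈ →+* ZMod 2 where
  toFun x := x.re
  map_zero' := by simp
  map_one' := by simp [QuadraticAlgebra.re_one]
  map_add' x y := by simp
  map_mul' x y := by
    have : (2 : ZMod 2) = 0 := rfl
    simp [this]

lemma parity_apply (x : R₈) : parity x = (x.re : ZMod 2) := rfl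

lemma sqrt_two_dvd {x : R₈} (h : parity x = 0) : (⟨0, 1⟩ : R₈) ∣ x := by
  rw [parity_apply, ZMod.intCast_zmod_eq_zero_iff_dvd] at h
  obtain ⟨k, hk⟩ := h
  refine ⟨⟨x.im, k⟩, ?_⟩
  ext
  · simp; exact hk
  · simp

lemma parity_eq_zero_of_norm {x : R₈} (h : 2 ∣ x.norm) : parity x = 0 := by
  have h1 : ((x.norm : ℤ) : ZMod 2) = 0 := by rwa [ZMod.intCast_zmod_eq_zero_iff_dvd]
  rw [QuadraticAlgebra.norm_def] at h1
  push_cast at h1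
  rw [show (2 : ZMod 2) = 0 from rfl] at h1
  simpa [parity_apply] using h1

lemma parity_eq_one_of_norm {x : R₈} (h : x.norm = 1) : parity x = 1 := by
  have h1 : ((x.norm : ℤ) : ZMod 2) = 1 := by rw [h]; rfl
  rw [QuadraticAlgebra.norm_def] at h1
  push_cast at h1
  rw [show (2 : ZMod 2) = 0 from rfl] at h1
  simp only [zero_mul, add_zero, sub_zero] at h1
  rw [parity_apply]
  generalize (x.re : ZMod 2) = t at h1
  revert t; decide

lemma sqrt_two_mul : (⟨0, 1⟩ : R₈) * ⟨0, 1⟩ = 2 := by decide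

/-- The values of the form `x² + (2 + √2) p² + 2 p s + (2 - √2) s²`. -/
def RepEight (α : R₈) : Prop :=
  ∃ x p s : R₈, α = x ^ 2 + (2 + ⟨0, 1⟩) * p ^ 2 + 2 * p * s + (2 - ⟨0, 1⟩) * s ^ 2

lemma RepEight.of_sum {α : R₈} (h : ∃ x y z, α = x ^ 2 + y ^ 2 + z ^ 2) : RepEight α := by
  obtain ⟨x, y, z, h⟩ := h
  have key (x y z : R₈) (h : α = x ^ 2 + y ^ 2 + z ^ 2) (hp : parity y = parity z) :
      RepEight α := by
    obtain ⟨k, hk⟩ := sqrt_two_dvd (x := y + z) (by rw [map_add, hp, CharTwo.add_self_eq_zero])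
    obtain ⟨r, hr⟩ : ∃ r : R₈, r = ⟨0, 1⟩ := ⟨_, rfl⟩
    have hrr : r * r = 2 := by rw [hr]; exact sqrt_two_mul
    rw [← hr] at hk
    refine ⟨x, k - z, r * z - (k - z), ?_⟩
    rw [← hr, h, show y = r * k - z by linear_combination hk]
    linear_combination (k ^ 2 - (2 - r) * z ^ 2 - 2 * (k - z) * z) * hrr
  have : parity y = parity z ∨ parity x = parity z ∨ parity x = parity y := by
    generalize parity x = a
    generalize parity y = b
    generalize parity z = c
    revert a b c; decide
  rcases this with h1 | h1 | h1
  · exact key x y z h h1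
  · exact key y x z (by rw [h]; ring) h1
  · exact key z x y (by rw [h]; ring) h1

lemma dvd_of_norm_four {x : R₈} (h : x.norm = 4) : ∃ y, x = 2 * y ∧ y.norm = 1 := by
  obtain ⟨y, rfl⟩ := sqrt_two_dvd (parity_eq_zero_of_norm (x := x) (by rw [h]; norm_num))
  rw [map_mul, show (⟨0, 1⟩ : R₈).norm = -2 by decide] at h
  obtain ⟨z, rfl⟩ := sqrt_two_dvd (parity_eq_zero_of_norm (x := y) ⟨-1, by linarith⟩)
  refine ⟨z, by rw [← mul_assoc, sqrt_two_mul], ?_⟩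
  rw [map_mul, show (⟨0, 1⟩ : R₈).norm = -2 by decide] at h
  linarith

lemma Adm.repEight_of_norm_two {α : R₈} {Q : TForm R₈} (h : Adm α Q) (ha : Q.a.norm = 1)
    (hG : (Q.a * Q.b - Q.d ^ 2).norm = 2) : RepEight α := by
  obtain ⟨c, f, h1⟩ := h.exists_split unitSq_eight ha
  have hGpos := h.minor_pos
  generalize Q.a * Q.b - Q.d ^ 2 = G at *
  obtain ⟨r, hr⟩ : ∃ r : R₈, r = ⟨0, 1⟩ := ⟨_, rfl⟩
  have hrr : r * r = 2 := by rw [hr]; exact sqrt_two_mul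
  have hpr : parity r = 0 := by rw [hr]; rfl
  obtain ⟨w, hw⟩ := sqrt_two_dvd (parity_eq_zero_of_norm (x := G) ⟨1, by rw [hG]; norm_num⟩)
  rw [← hr] at hw
  have hG2 : G = (2 + r) * (w * (r - 1)) := by linear_combination hw - w * hrr
  have hn : (2 + r).norm = 2 := by rw [hr]; decide
  have ht : TPos (2 + r) := TPos.of_norm_trace (by rw [hn]; norm_num) (by rw [hr]; decide)
  have hx1 : TPos (w * (r - 1)) := ht.of_mul (by rwa [← hG2])
  have hx2 : (w * (r - 1)).norm = 1 := by
    have := hG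
    rw [hG2, map_mul, hn] at this
    linarith
  obtain ⟨y, z, hyz, hy⟩ := unitSq_eight _ hx1 hx2
  have hz : G * z ^ 2 = 2 + r := by
    rw [hG2, hy]; linear_combination (2 + r) * (y * z + 1) * hyz
  have h2 := h1.scale₂₃ (u := z) (v := y) (by rw [mul_comm, hyz])
  dsimp only at h2
  rw [hz, zero_mul, zero_mul] at h2
  have hf : parity f = 0 ∨ parity f = 1 := by
    generalize parity f = t
    revert t; decide
  rcases hf with hf | hf
  · exfalso
    obtain ⟨k, hk⟩ := sqrt_two_dvd hf
    rw [← hr] at hk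
    have h3 := (h2.shift₂₃ (-(k * (r - 1)))).det
    dsimp only at h3
    have h4 : f + -(k * (r - 1)) * (2 + r) = 0 := by linear_combination hk - k * hrr
    rw [h4] at h3
    simp only [ne_eq, OfNat.ofNat_ne_zero, not_false_eq_true, zero_pow, mul_zero, add_zero,
      sub_zero, one_mul] at h3
    have h5 := congrArg QuadraticAlgebra.norm h3
    rw [map_mul, hn, map_one] at h5
    omega
  · obtain ⟨k, hk⟩ := sqrt_two_dvd (x := f - 1) (by rw [map_sub, hf, map_one, sub_self])
    rw [← hr] at hk
    have h3 := h2.shift₂₃ (-(k * (r - 1)))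
    have h4 : f + -(k * (r - 1)) * (2 + r) = 1 := by linear_combination hk - k * hrr
    dsimp only at h3
    rw [h4] at h3
    obtain ⟨-, -, h5, u, v, w, h6⟩ := h3
    dsimp only at h5 h6
    generalize c * y ^ 2 + 2 * -(k * (r - 1)) * f + (-(k * (r - 1))) ^ 2 * (2 + r) = c' at h5 h6
    have hc : c' = 2 - r := by
      apply mul_left_cancel₀ ht.ne_zero
      linear_combination h5 + hrr
    refine ⟨u, v, w, ?_⟩
    rw [← hr, ← h6, hc]
    ring

lemma Adm.norm_eq_one_of_norm_four {α : R₈} {Q : TForm R₈} (h : Adm α Q) (hmin : Adm.Min α Q)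
    (ha : Q.a.norm = 4) (hG : (Q.a * Q.b - Q.d ^ 2).norm = 4) : False := by
  obtain ⟨r, hr⟩ : ∃ r : R₈, r = ⟨0, 1⟩ := ⟨_, rfl⟩
  have hrr : r * r = 2 := by rw [hr]; exact sqrt_two_mul
  have hpr : parity r = 0 := by rw [hr]; rfl
  have hr0 : r ≠ 0 := by rw [hr]; decide
  have h20 : (2 : R₈) ≠ 0 := by decide
  have hp2 : parity 2 = 0 := rfl
  have two_cases (t : ZMod 2) : t = 0 ∨ t = 1 := by revert t; decide
  obtain ⟨a, haa, ha1⟩ := dvd_of_norm_four ha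
  obtain ⟨g, hgg, hg1⟩ := dvd_of_norm_four hG
  have hga := mul_star_of_norm hg1
  have hp_a := parity_eq_one_of_norm ha1
  have hp_g := parity_eq_one_of_norm hg1
  obtain ⟨d, hd⟩ : r ∣ Q.d := by
    rw [hr]; apply sqrt_two_dvd
    have := congrArg parity hgg
    simp only [map_sub, map_mul, map_pow, haa, hp2, zero_mul, zero_sub, neg_eq_zero] at this
    exact pow_eq_zero_iff two_ne_zero |>.1 this
  rcases two_cases (parity d) with h0 | hd1
  · obtain ⟨k, hk⟩ := sqrt_two_dvd h0
    rw [← hr] at hk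
    have h1 : Q.a ∣ Q.d := by
      refine ⟨star a * k, ?_⟩
      linear_combination hd + r * hk + k * hrr - star a * k * haa - 2 * k * mul_star_of_norm ha1
    have := h.norm_eq_one_of_dvd hmin h1 (hG.trans ha.symm)
    omega
  have key := h.minor_mul
  obtain ⟨o, ho⟩ : r ∣ Q.a * Q.f - Q.d * Q.e := by
    rw [hr]; apply sqrt_two_dvd
    have := congrArg parity key
    have hpa : parity Q.a = 0 := by rw [haa, map_mul, hp2, zero_mul]
    rw [hgg, map_mul, map_mul, hp2, zero_mul, zero_mul, map_add, map_pow, hpa, add_zero] at this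
    exact pow_eq_zero_iff two_ne_zero |>.1 this.symm
  rcases two_cases (parity o) with h0 | ho1
  · obtain ⟨k, hk⟩ := sqrt_two_dvd h0
    rw [← hr] at hk
    have h1 := h.shift₂₃ (-(star g * k))
    have h2 := h1.minor_mul
    dsimp only at h2
    have h3 : Q.a * (Q.f + -(star g * k) * Q.b) - Q.d * (Q.e + -(star g * k) * Q.d) = 0 := by
      linear_combination ho + r * hk + k * hrr - star g * k * hgg - 2 * k * hga
    rw [h3] at h2
    have h4 := congrArg QuadraticAlgebra.norm h2
    rw [map_mul, hG, zero_pow two_ne_zero, zero_add, ha] at h4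
    have h5 := h1.swap₂₃.norm_eq_one_of_minor unitSq_eight hmin (by
      dsimp only
      omega)
    dsimp only at h5
    omega
  · have h1 : o = r * a * Q.f - d * Q.e := by
      apply mul_left_cancel₀ hr0
      linear_combination -ho + Q.f * haa - Q.e * hd - a * Q.f * hrr
    have he : parity Q.e = 1 := by
      have := congrArg parity h1
      simp only [map_sub, map_mul, hpr, ho1, hd1] at this
      rcases two_cases (parity Q.e) with h | h
      · simp [h] at this
      · exact h
    have h2 : g * (Q.a * Q.c - Q.e ^ 2) = o ^ 2 + a := by
      apply mul_left_cancel₀ h20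
      linear_combination key - (Q.a * Q.c - Q.e ^ 2) * hgg + haa +
        (Q.a * Q.f - Q.d * Q.e + r * o) * ho + o ^ 2 * hrr
    have h3 := congrArg parity h2
    simp only [map_sub, map_mul, map_add, map_pow, haa, hp2, hp_g, hp_a, he, ho1] at h3
    exact absurd h3 (by generalize parity Q.c = t; revert t; decide)

lemma Adm.repEight {α : R₈} {Q : TForm R₈} (hQ : Adm α Q) : RepEight α := by
  obtain ⟨Q, h, hmin, h1, h2⟩ := exists_reduced (C := 7) box_eight hQ
  have ha := h.pos.norm_pos
  have hG := h.minor_pos.norm_pos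
  obtain ⟨A, hA⟩ : ∃ A, A = Q.a.norm := ⟨_, rfl⟩
  obtain ⟨G, hG'⟩ : ∃ G, G = (Q.a * Q.b - Q.d ^ 2).norm := ⟨_, rfl⟩
  have h8 (x : R₈) : x.norm ≠ 3 ∧ x.norm ≠ 5 ∧ x.norm ≠ 6 := by
    rw [QuadraticAlgebra.norm_def]
    have key (N : ZMod 16) (h0 : ((x.re * x.re + 0 * x.re * x.im - 2 * x.im * x.im : ℤ) : ZMod 16) = N) :
        N ≠ 3 ∧ N ≠ 5 ∧ N ≠ 6 := by
      push_cast at h0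
      rw [← h0]
      generalize (x.re : ZMod 16) = u
      generalize (x.im : ZMod 16) = v
      revert u v; decide
    refine ⟨fun h => (key 3 ?_).1 rfl, fun h => (key 5 ?_).2.1 rfl, fun h => (key 6 ?_).2.2 rfl⟩ <;>
    · rw [h]; rfl
  obtain ⟨a3, a5, a6⟩ := h8 Q.a
  obtain ⟨g3, g5, g6⟩ := h8 (Q.a * Q.b - Q.d ^ 2)
  rw [← hA] at a3 a5 a6 ha h1 h2
  rw [← hG'] at g3 g5 g6 hG h1 h2
  push_cast at h1 h2
  have hA6 : A < 7 := lt_of_sq_lt ha hG h1 h2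
  have hG6 : G < 7 := lt_of_sq_lt hG ha h2 h1
  have hcases : A = 1 ∧ G = 1 ∨ A = 1 ∧ G = 2 ∨ A = 2 ∧ G = 1 ∨ A = 2 ∧ G = 2 ∨ A = 4 ∧ G = 4 := by
    interval_cases A <;> interval_cases G <;> simp at *
  rcases hcases with ⟨rfl, rfl⟩ | ⟨rfl, rfl⟩ | ⟨rfl, rfl⟩ | ⟨rfl, rfl⟩ | ⟨rfl, rfl⟩
  · exact RepEight.of_sum (h.sum_three_sq unitSq_eight hA.symm hG'.symm)
  · exact h.repEight_of_norm_two hA.symm hG'.symm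
  · have := h.norm_eq_one_of_minor unitSq_eight hmin hG'.symm
    omega
  · exact (h.norm_ne_of_prime hmin (π := ⟨0, 1⟩) (ℓ := 2) Int.prime_two
      (fun x hx => sqrt_two_dvd (parity_eq_zero_of_norm hx)) (by decide) (by rw [← hA]; decide)
      (by rw [← hA, ← hG'])).elim
  · exact (h.norm_eq_one_of_norm_four hmin hA.symm hG'.symm).elim

end RealQuad

/-! #### Existence of ternary forms representing a given element -/

namespace RealQuad

variable {m n : ℤ} [RealQuad m n] {α : QuadraticAlgebra ℤ m n}

/-- A sufficient local condition for `α` to be represented by a form of determinant `1`. -/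
lemma exists_adm_of_dvd (hα : TPos α) {N : ℕ} (hN : 0 < N) {s : ℤ}
    (h1 : α.norm ∣ 1 + s ^ 2 * N) {z : QuadraticAlgebra ℤ m n}
    (h2 : (N : QuadraticAlgebra ℤ m n) ∣ z ^ 2 + α) : ∃ Q, Adm α Q := by
  obtain ⟨k, hk⟩ := h1
  obtain ⟨w, hw⟩ := h2
  set b : QuadraticAlgebra ℤ m n := star α * k
  have hb : α * b = 1 + (s : QuadraticAlgebra ℤ m n) ^ 2 * N := by
    have h3 := congrArg (algebraMap ℤ (QuadraticAlgebra ℤ m n)) hk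
    rw [map_mul, QuadraticAlgebra.algebraMap_norm_eq_mul_star] at h3
    simp only [algebraMap_int_eq, eq_intCast] at h3
    push_cast at h3
    rw [h3]; ring
  have hbp : TPos b := by
    apply hα.of_mul
    rw [hb]
    intro s'
    simp only [map_add, map_one, map_mul, map_pow, map_natCast, map_intCast]
    positivity
  refine ⟨⟨N, b ^ 2 * w - b * s ^ 2, α, z * b, 0, s⟩, tpos_natCast hN, ?_, ?_, 0, 0, 1, ?_⟩
  · convert hbp using 1
    linear_combination b * hb - b ^ 2 * hw
  · linear_combination α * (b * hb - b ^ 2 * hw) + hb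
  · ring

lemma Adm.sq_mul {Q : TForm (QuadraticAlgebra ℤ m n)} (h : Adm α Q)
    (c : QuadraticAlgebra ℤ m n) : Adm (c ^ 2 * α) Q := by
  obtain ⟨h1, h2, h3, u, v, w, h4⟩ := h
  exact ⟨h1, h2, h3, c * u, c * v, c * w, by linear_combination c ^ 2 * h4⟩

section Lift

variable {F : Type*} [Field F]

lemma isSquare_mul_of_not_isSquare [Fintype F] {x y : F} (hx : ¬ IsSquare x) (hy : ¬ IsSquare y) :
    IsSquare (x * y) := by
  classical
  have hx0 : x ≠ 0 := by rintro rfl; exact hx .zero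
  have hy0 : y ≠ 0 := by rintro rfl; exact hy .zero
  have h := quadraticChar_neg_one_iff_not_isSquare.2 hx
  have h' := quadraticChar_neg_one_iff_not_isSquare.2 hy
  rw [← quadraticChar_one_iff_isSquare (mul_ne_zero hx0 hy0), map_mul, h, h']
  norm_num

lemma exists_sq_of_inert [Fintype F] {m n p r c : F}
    (hD : ¬ IsSquare (n ^ 2 + 4 * m)) (hc : p ^ 2 + n * p * r - m * r ^ 2 = c ^ 2) :
    ∃ a b : F, a ^ 2 + m * b ^ 2 = p ∧ 2 * a * b + n * b ^ 2 = r := by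
  by_cases hr : r = 0
  · subst hr
    by_cases hp : IsSquare p
    · obtain ⟨w, rfl⟩ := hp
      exact ⟨w, 0, by ring, by ring⟩
    · obtain ⟨y, hy⟩ := isSquare_mul_of_not_isSquare hp hD
      have hD0 : n ^ 2 + 4 * m ≠ 0 := by intro h; rw [h] at hD; exact hD .zero
      refine ⟨-n * (y / (n ^ 2 + 4 * m)), 2 * (y / (n ^ 2 + 4 * m)), ?_, by ring⟩
      field_simp
      linear_combination -(n ^ 2 + 4 * m) * hy
  · have key (c' τ : F) (h : 2 * p + n * r + 2 * c' = τ * τ) (hτ : τ ≠ 0) (hc' : c' ^ 2 = c ^ 2) :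
        ∃ a b : F, a ^ 2 + m * b ^ 2 = p ∧ 2 * a * b + n * b ^ 2 = r := by
      refine ⟨(p + c') / τ, r / τ, ?_, ?_⟩
      · field_simp
        linear_combination p * h + hc' - hc
      · field_simp
        linear_combination h
    have hprod : (2 * p + n * r + 2 * c) * (2 * p + n * r + 2 * -c) = (n ^ 2 + 4 * m) * r ^ 2 := by
      linear_combination 4 * hc
    have hns : ¬ IsSquare ((n ^ 2 + 4 * m) * r ^ 2) := by
      rintro ⟨y, hy⟩
      exact hD ⟨y / r, by field_simp; linear_combination hy⟩
    by_cases h3 : IsSquare (2 * p + n * r + 2 * c)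
    · obtain ⟨τ, hτ⟩ := h3
      refine key c τ hτ ?_ rfl
      rintro rfl
      apply hns
      rw [← hprod, hτ]; simp
    · by_cases h4 : IsSquare (2 * p + n * r + 2 * -c)
      · obtain ⟨τ, hτ⟩ := h4
        refine key (-c) τ hτ ?_ (by ring)
        rintro rfl
        apply hns
        rw [← hprod, hτ]; simp
      · exact (hns (hprod ▸ isSquare_mul_of_not_isSquare h3 h4)).elim

lemma exists_sq_of_split {m n p r φ₁ φ₂ t₁ t₂ : F} (hne : φ₁ ≠ φ₂) (hs : φ₁ + φ₂ = n)
    (hp : φ₁ * φ₂ = -m) (h1 : p + r * φ₁ = t₁ ^ 2) (h2 : p + r * φ₂ = t₂ ^ 2) :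
    ∃ a b : F, a ^ 2 + m * b ^ 2 = p ∧ 2 * a * b + n * b ^ 2 = r := by
  have hne' : φ₁ - φ₂ ≠ 0 := sub_ne_zero.2 hne
  subst hs
  obtain rfl : m = -(φ₁ * φ₂) := by rw [hp, neg_neg]
  have hr : r = (t₁ ^ 2 - t₂ ^ 2) / (φ₁ - φ₂) := by
    field_simp; linear_combination h1 - h2
  obtain rfl : p = t₁ ^ 2 - r * φ₁ := by linear_combination h1
  subst hr
  refine ⟨t₁ - (t₁ - t₂) / (φ₁ - φ₂) * φ₁, (t₁ - t₂) / (φ₁ - φ₂), ?_, ?_⟩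
  · field_simp; ring
  · field_simp; ring

end Lift

lemma exists_dvd_sq_sub {ℓ : ℕ} {x : QuadraticAlgebra ℤ m n}
    (h : ∃ a b : ZMod ℓ, a ^ 2 + m * b ^ 2 = x.re ∧ 2 * a * b + n * b ^ 2 = x.im) :
    ∃ z : QuadraticAlgebra ℤ m n, (ℓ : QuadraticAlgebra ℤ m n) ∣ z ^ 2 - x := by
  obtain ⟨a, b, h1, h2⟩ := h
  obtain ⟨a, rfl⟩ := ZMod.intCast_surjective a
  obtain ⟨b, rfl⟩ := ZMod.intCast_surjective b
  refine ⟨⟨a, b⟩, ?_⟩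
  rw [← Int.cast_natCast, intCast_dvd_iff, pow_two]
  simp only [QuadraticAlgebra.re_sub, QuadraticAlgebra.im_sub, QuadraticAlgebra.re_mul,
    QuadraticAlgebra.im_mul, ← ZMod.intCast_zmod_eq_zero_iff_dvd]
  push_cast
  constructor
  · linear_combination h1
  · linear_combination h2

lemma exists_dvd_sq_sub_mul {ℓ₁ ℓ₂ : ℕ} (hco : ℓ₁.Coprime ℓ₂) {x : QuadraticAlgebra ℤ m n}
    (h1 : ∃ z : QuadraticAlgebra ℤ m n, (ℓ₁ : QuadraticAlgebra ℤ m n) ∣ z ^ 2 - x)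
    (h2 : ∃ z : QuadraticAlgebra ℤ m n, (ℓ₂ : QuadraticAlgebra ℤ m n) ∣ z ^ 2 - x) :
    ∃ z : QuadraticAlgebra ℤ m n, ((ℓ₁ * ℓ₂ : ℕ) : QuadraticAlgebra ℤ m n) ∣ z ^ 2 - x := by
  obtain ⟨z₁, w₁, h1⟩ := h1
  obtain ⟨z₂, w₂, h2⟩ := h2
  obtain ⟨u, v, huv⟩ := Int.isCoprime_iff_gcd_eq_one.2 (by exact_mod_cast hco : Int.gcd ℓ₁ ℓ₂ = 1)
  have huv' := congrArg (Int.cast : ℤ → QuadraticAlgebra ℤ m n) huv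
  push_cast at huv'
  have hc : IsCoprime (ℓ₁ : QuadraticAlgebra ℤ m n) ℓ₂ := ⟨u, v, huv'⟩
  refine ⟨u * ℓ₁ * z₂ + v * ℓ₂ * z₁, ?_⟩
  push_cast
  apply hc.mul_dvd
  · refine ⟨w₁ + u * (z₂ - z₁) * (u * ℓ₁ * z₂ + v * ℓ₂ * z₁ + z₁), ?_⟩
    linear_combination h1 + z₁ * (u * ℓ₁ * z₂ + v * ℓ₂ * z₁ + z₁) * huv'
  · refine ⟨w₂ + v * (z₁ - z₂) * (u * ℓ₁ * z₂ + v * ℓ₂ * z₁ + z₂), ?_⟩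
    linear_combination h2 + z₂ * (u * ℓ₁ * z₂ + v * ℓ₂ * z₁ + z₂) * huv'

end RealQuad

/-! #### Primes with prescribed residues and Jacobi symbols -/

lemma exists_prime_modEq_modEq {A B a b : ℕ} (hAB : A.Coprime B) (hA : A ≠ 0) (hB : B ≠ 0)
    (ha : a.Coprime A) (hb : b.Coprime B) (X : ℕ) :
    ∃ p > X, p.Prime ∧ p ≡ a [MOD A] ∧ p ≡ b [MOD B] := by
  obtain ⟨c, hc1, hc2⟩ := Nat.chineseRemainder hAB a b
  have hc : c.Coprime (A * B) := by
    apply Nat.Coprime.mul_right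
    · rw [Nat.Coprime, hc1.gcd_eq]; exact ha
    · rw [Nat.Coprime, hc2.gcd_eq]; exact hb
  obtain ⟨p, hp1, hp2, hp3⟩ := Nat.forall_exists_prime_gt_and_modEq X (mul_ne_zero hA hB) hc
  exact ⟨p, hp1, hp2, (Nat.ModEq.of_mul_right _ hp3).trans hc1,
    (Nat.ModEq.of_mul_left _ hp3).trans hc2⟩

lemma Nat.ModEq.dvd_add_one {p A : ℕ} (hA : A ≠ 0) (h : p ≡ A - 1 [MOD A]) : A ∣ p + 1 := by
  have h1 := h.add_right 1
  rw [Nat.sub_add_cancel (Nat.one_le_iff_ne_zero.2 hA)] at h1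
  exact (Nat.modEq_zero_iff_dvd.1 (h1.trans (Nat.modEq_zero_iff_dvd.2 dvd_rfl)))

lemma Nat.coprime_sub_one_self {A : ℕ} (hA : A ≠ 0) : (A - 1).Coprime A :=
  (Nat.coprime_self_sub_left (Nat.one_le_iff_ne_zero.2 hA)).2 (Nat.coprime_one_left A)

lemma jacobiSym_eq_one_of_dvd_add_one {m b : ℕ} (hm : m ≠ 0) (h : 4 * m ∣ b + 1) :
    jacobiSym m b = 1 := by
  obtain ⟨c, hc⟩ := h
  have hbo : Odd b := by
    rw [Nat.odd_iff]
    have : b + 1 = 2 * (2 * m * c) := by rw [hc]; ring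
    omega
  have hc0 : c ≠ 0 := by rintro rfl; simp at hc
  have hmod : b % (4 * m) = 4 * m - 1 := by
    obtain ⟨c, rfl⟩ := Nat.exists_eq_succ_of_ne_zero hc0
    have : b = (4 * m - 1) + 4 * m * c := by
      rw [Nat.mul_succ] at hc; omega
    rw [this, Nat.add_mul_mod_self_left, Nat.mod_eq_of_lt (by omega)]
  have hodd : Odd (4 * m - 1) := by rw [Nat.odd_iff]; omega
  rw [jacobiSym.mod_right _ hbo, Int.natAbs_natCast, hmod]
  have h1 : jacobiSym ((4 * m : ℕ) : ℤ) (4 * m - 1) = 1 := by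
    rw [jacobiSym.mod_left' (a₂ := 1), jacobiSym.one_left]
    refine (Int.modEq_iff_dvd.2 ?_).symm
    exact ⟨1, by push_cast [Nat.cast_sub (show 1 ≤ 4 * m by omega)]; ring⟩
  have h2 : jacobiSym ((4 * m : ℕ) : ℤ) (4 * m - 1) = jacobiSym (2 : ℤ) (4 * m - 1) ^ 2 *
      jacobiSym (m : ℤ) (4 * m - 1) := by
    rw [← jacobiSym.pow_left, ← jacobiSym.mul_left]; push_cast; norm_num
  rw [jacobiSym.sq_one, one_mul] at h2
  · rw [← h2, h1]
  · have := (Nat.coprime_two_left (n := 4 * m - 1)).2 hodd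
    exact_mod_cast this

lemma exists_jacobiSym_eq_neg_one {M : ℕ} (hM : M ≠ 0) (hsq : ¬ IsSquare M) :
    ∃ b : ℕ, b % 4 = 3 ∧ b.Coprime M ∧ jacobiSym M b = -1 := by
  obtain ⟨a, c, hac, ha⟩ := Nat.sq_mul_squarefree M
  have ha1 : a ≠ 1 := by rintro rfl; exact hsq ⟨c, by rw [← hac]; ring⟩
  have hc0 : c ≠ 0 := by rintro rfl; apply hM; rw [← hac]; simp
  set p := a.minFac
  have hp : p.Prime := Nat.minFac_prime ha1
  obtain ⟨e, he⟩ : p ∣ a := Nat.minFac_dvd a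
  have hpe : ¬ p ∣ e := by
    rintro ⟨f, rfl⟩
    exact hp.not_isUnit (ha p ⟨f, by rw [he]; ring⟩)
  obtain ⟨j, d, hd, hcd⟩ := Nat.exists_eq_pow_mul_and_not_dvd hc0 p hp.ne_one
  set n := d ^ 2 * e
  have hMn : M = p ^ (2 * j + 1) * n := by rw [← hac, he, hcd]; simp only [n]; ring
  have hpn : ¬ p ∣ n := fun h => by
    rcases hp.dvd_mul.1 h with h | h
    · exact hd (hp.dvd_of_dvd_pow h)
    · exact hpe h
  have hn0 : n ≠ 0 := by intro h; exact hpn (h ▸ dvd_zero p)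
  have hcop : p.Coprime n := (Nat.Prime.coprime_iff_not_dvd hp).2 hpn
  clear_value n p
  have key (b : ℕ) (h3 : b % 4 = 3) (h4 : 4 * n ∣ b + 1) (hbp : jacobiSym p b = -1) :
      ∃ b : ℕ, b % 4 = 3 ∧ b.Coprime M ∧ jacobiSym M b = -1 := by
    refine ⟨b, h3, ?_, ?_⟩
    · rw [hMn]
      apply Nat.Coprime.mul_right
      · apply Nat.Coprime.pow_right
        rw [Nat.coprime_comm]
        by_contra h
        have : NeZero b := ⟨by rintro rfl; simp at h3⟩
        rw [jacobiSym.eq_zero_iff_not_coprime.2 (by exact_mod_cast h)] at hbp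
        norm_num at hbp
      · have h5 : n ∣ b + 1 := (Dvd.intro_left 4 rfl).trans h4
        rw [Nat.coprime_comm, Nat.Coprime, ← Nat.dvd_one]
        exact (Nat.dvd_add_right (Nat.gcd_dvd_right n b)).1 ((Nat.gcd_dvd_left n b).trans h5)
    · rw [hMn]
      push_cast
      rw [jacobiSym.mul_left, jacobiSym.pow_left, hbp, jacobiSym_eq_one_of_dvd_add_one hn0 h4,
        Odd.neg_one_pow ⟨j, rfl⟩, mul_one]
  rcases hp.eq_two_or_odd' with h2 | h2
  · have hno : n.Coprime 8 := by
      have := hcop.symm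
      rw [h2] at this
      exact Nat.Coprime.pow_right 3 this
    obtain ⟨b, hb1, hb2⟩ := Nat.chineseRemainder hno (n - 1) 3
    have hb8 : b % 8 = 3 := hb2
    refine key b (by omega) ?_ ?_
    · apply Nat.Coprime.mul_dvd_of_dvd_of_dvd
      · exact (Nat.Coprime.coprime_dvd_right (by norm_num : 4 ∣ 8) hno).symm
      · omega
      · exact hb1.dvd_add_one hn0
    · rw [h2]
      have hodd : Odd b := by rw [Nat.odd_iff]; omega
      rw [show ((2 : ℕ) : ℤ) = 2 from rfl, jacobiSym.at_two hodd]
      have : (b : ZMod 8) = 3 := by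
        have := (ZMod.natCast_eq_natCast_iff' b 3 8).2 (by omega)
        exact_mod_cast this
      rw [this]; decide
  · have := Fact.mk hp
    have hp2 : p.Coprime 2 := hp.coprime_iff_not_dvd.2 (by
      intro h; have := (Nat.prime_dvd_prime_iff_eq hp Nat.prime_two).1 h
      subst this; exact absurd h2 (by decide))
    have hco : (4 * n).Coprime p :=
      (Nat.Coprime.mul_right (hp2.pow_right 2) hcop).symm
    have h4n : 4 * n ≠ 0 := by omega
    have hpm : p % 4 = 1 ∨ p % 4 = 3 := by have := Nat.odd_iff.1 h2; omega
    have hmod {b t : ℕ} (h : b ≡ 4 * n - 1 [MOD 4 * n]) : 4 * n ∣ b + 1 ∧ b % 4 = 3 := by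
      have := h.dvd_add_one h4n
      refine ⟨this, ?_⟩
      have : 4 ∣ b + 1 := (Dvd.intro n rfl).trans this
      omega
    rcases hpm with hp4 | hp4
    · obtain ⟨t, ht⟩ := FiniteField.exists_nonsquare (F := ZMod p) (by
        rw [ZMod.ringChar_zmod_n]; rintro rfl; exact absurd h2 (by decide))
      obtain ⟨t, rfl⟩ := ZMod.natCast_zmod_surjective t
      obtain ⟨b, hb1, hb2⟩ := Nat.chineseRemainder hco (4 * n - 1) t
      obtain ⟨h4, h3⟩ := hmod (t := t) hb1
      refine key b h3 h4 ?_
      rw [jacobiSym.quadratic_reciprocity_one_mod_four hp4 (by rw [Nat.odd_iff]; omega),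
        ← jacobiSym.legendreSym.to_jacobiSym, legendreSym.eq_neg_one_iff]
      rw [← (ZMod.natCast_eq_natCast_iff b t p).2 hb2] at ht
      exact_mod_cast ht
    · obtain ⟨b, hb1, hb2⟩ := Nat.chineseRemainder hco (4 * n - 1) 1
      obtain ⟨h4, h3⟩ := hmod (t := 1) hb1
      refine key b h3 h4 ?_
      rw [jacobiSym.quadratic_reciprocity_three_mod_four hp4 h3, jacobiSym.mod_left' (a₂ := 1),
        jacobiSym.one_left]
      exact_mod_cast hb2

namespace RealQuad

section

variable {m n : ℤ} [RealQuad m n] {α : QuadraticAlgebra ℤ m n}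

lemma TPos.exists_norm_eq (hα : TPos α) : ∃ M : ℕ, α.norm = M ∧ M ≠ 0 := by
  have := hα.norm_pos
  exact ⟨α.norm.toNat, by omega, by omega⟩

lemma exists_dvd_sq_add_of_inert {ℓ : ℕ} (hℓ : ℓ.Prime) (hD : jacobiSym (n ^ 2 + 4 * m) ℓ = -1)
    (hα : jacobiSym α.norm ℓ = 1) :
    ∃ z : QuadraticAlgebra ℤ m n, (ℓ : QuadraticAlgebra ℤ m n) ∣ z ^ 2 + α := by
  have := Fact.mk hℓ
  obtain ⟨c, hc⟩ := ZMod.isSquare_of_jacobiSym_eq_one hα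
  have hD' := ZMod.nonsquare_of_jacobiSym_eq_neg_one hD
  rw [QuadraticAlgebra.norm_def] at hc
  push_cast at hc hD'
  obtain ⟨z, hz⟩ := exists_dvd_sq_sub (m := m) (n := n) (ℓ := ℓ) (x := -α)
    (exists_sq_of_inert (c := c) hD' (by
      simp only [QuadraticAlgebra.re_neg, QuadraticAlgebra.im_neg]
      push_cast
      linear_combination hc))
  exact ⟨z, by rwa [sub_neg_eq_add] at hz⟩

end

lemma disc_five_eq : ((1 : ℤ) ^ 2 + 4 * 1) = 5 := by norm_num

lemma disc_eight_eq : ((0 : ℤ) ^ 2 + 4 * 2) = 2 ^ 3 := by norm_num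

lemma jacobiSym_five_of_modEq {ℓ : ℕ} (hℓ : Odd ℓ) (h : ℓ ≡ 2 [MOD 5]) : jacobiSym 5 ℓ = -1 := by
  have h1 := jacobiSym.quadratic_reciprocity_one_mod_four (a := 5) (b := ℓ) (by norm_num) hℓ
  push_cast at h1
  rw [h1, jacobiSym.mod_left' (a₂ := 2)]
  · decide +kernel
  · exact_mod_cast h

lemma jacobiSym_two_of_mod_eight {ℓ : ℕ} (h : ℓ % 8 = 3 ∨ ℓ % 8 = 5) : jacobiSym 2 ℓ = -1 := by
  rw [jacobiSym.at_two (Nat.odd_iff.2 (by omega)), ← ZMod.natCast_mod ℓ 8]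
  rcases h with h | h <;> rw [h] <;> decide

lemma exists_adm_five_of_not_dvd {α : QuadraticAlgebra ℤ 1 1} (hα : TPos α)
    (h : ¬ (5 : ℤ) ∣ α.norm) : ∃ Q, Adm α Q := by
  obtain ⟨M, hM, hM0⟩ := hα.exists_norm_eq
  rw [hM] at h
  have h5 : (4 * M).Coprime 5 := by
    rw [Nat.coprime_comm, Nat.Prime.coprime_iff_not_dvd Nat.prime_five]
    omega
  obtain ⟨ℓ, hℓ0, hℓ, h1, h2⟩ := exists_prime_modEq_modEq h5 (by omega) (by norm_num)
    (Nat.coprime_sub_one_self (A := 4 * M) (by omega)) (b := 2) (by norm_num) 2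
  have hdvd := h1.dvd_add_one (by omega)
  obtain ⟨z, hz⟩ := exists_dvd_sq_add_of_inert (α := α) hℓ
    (by rw [disc_five_eq]; exact jacobiSym_five_of_modEq (hℓ.odd_of_ne_two (by omega)) h2)
    (by rw [hM]; exact jacobiSym_eq_one_of_dvd_add_one hM0 hdvd)
  refine exists_adm_of_dvd hα hℓ.pos (s := 1) ?_ hz
  rw [hM, one_pow, one_mul, add_comm]
  exact_mod_cast (Dvd.intro_left 4 rfl).trans hdvd

lemma exists_adm_eight_of_not_dvd {α : QuadraticAlgebra ℤ 2 0} (hα : TPos α)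
    (h : ¬ (2 : ℤ) ∣ α.norm) : ∃ Q, Adm α Q := by
  obtain ⟨M, hM, hM0⟩ := hα.exists_norm_eq
  rw [hM] at h
  have h2 : M.Coprime 2 := by
    rw [Nat.coprime_comm, Nat.Prime.coprime_iff_not_dvd Nat.prime_two]
    omega
  obtain ⟨ℓ, hℓ0, hℓ, h1, h2⟩ := exists_prime_modEq_modEq (h2.pow_right 3) (by omega) (by norm_num)
    (Nat.coprime_sub_one_self (A := M) (by omega)) (b := 3) (by norm_num) 2
  have h8 : ℓ % 8 = 3 := h2
  have hM' := h1.dvd_add_one (by omega)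
  have hdvd : 4 * M ∣ ℓ + 1 := by
    apply Nat.Coprime.mul_dvd_of_dvd_of_dvd _ _ hM'
    · exact (Nat.Coprime.pow_right 2 ‹M.Coprime 2›).symm
    · omega
  obtain ⟨z, hz⟩ := exists_dvd_sq_add_of_inert (α := α) hℓ
    (by rw [disc_eight_eq, jacobiSym.pow_left, jacobiSym_two_of_mod_eight (Or.inl h8)]; rfl)
    (by rw [hM]; exact jacobiSym_eq_one_of_dvd_add_one hM0 hdvd)
  refine exists_adm_of_dvd hα hℓ.pos (s := 1) ?_ hz
  rw [hM, one_pow, one_mul, add_comm]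
  exact_mod_cast hM'

lemma _root_.Nat.exists_mul_modEq_sub_one {A x : ℕ} (hA : A ≠ 0) (hx : x.Coprime A) :
    ∃ y : ℕ, y.Coprime A ∧ ∀ z, z ≡ y [MOD A] → x * z ≡ A - 1 [MOD A] := by
  have : NeZero A := ⟨hA⟩
  set u := ZMod.unitOfCoprime x hx
  have hy : (((-u⁻¹ : (ZMod A)ˣ) : ZMod A).val : ZMod A) = ((-u⁻¹ : (ZMod A)ˣ) : ZMod A) := by
    rw [ZMod.natCast_val, ZMod.cast_id]
  refine ⟨((-u⁻¹ : (ZMod A)ˣ) : ZMod A).val, ZMod.val_coe_unit_coprime _, fun z hz => ?_⟩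
  rw [← ZMod.natCast_eq_natCast_iff] at hz ⊢
  rw [Nat.cast_mul, hz, hy, ← ZMod.coe_unitOfCoprime x hx, Units.val_neg, mul_neg, Units.mul_inv,
    Nat.cast_sub (Nat.one_le_iff_ne_zero.2 hA)]
  simp

lemma exists_adm_five_of_not_isSquare {α : QuadraticAlgebra ℤ 1 1} (hα : TPos α) {M : ℕ}
    (hM : α.norm = 5 * M) (h : ¬ 5 ∣ M) (hsq : ¬ IsSquare M) : ∃ Q, Adm α Q := by
  have hM0 : M ≠ 0 := by rintro rfl; exact hsq .zero
  obtain ⟨b, hb4, hbM, hb⟩ := exists_jacobiSym_eq_neg_one hM0 hsq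
  have h5 : (4 * M).Coprime 5 := by
    rw [Nat.coprime_comm, Nat.Prime.coprime_iff_not_dvd Nat.prime_five]
    omega
  have hbo : Odd b := Nat.odd_iff.2 (by omega)
  have hb4M : b.Coprime (4 * M) :=
    Nat.Coprime.mul_right (Nat.Coprime.pow_right 2 (Nat.coprime_two_right.2 hbo)) hbM
  obtain ⟨ℓ₁, hℓ₁2, hℓ₁, h1, h2⟩ := exists_prime_modEq_modEq h5 (by omega) (by norm_num)
    hb4M (b := 2) (by norm_num) 2
  have hℓ₁M : ℓ₁.Coprime (4 * M) := by rw [Nat.Coprime, h1.gcd_eq]; exact hb4M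
  obtain ⟨y, hy1, hy2⟩ := Nat.exists_mul_modEq_sub_one (by omega) hℓ₁M
  obtain ⟨ℓ₂, hℓ₂2, hℓ₂, h3, h4⟩ := exists_prime_modEq_modEq h5 (by omega) (by norm_num)
    hy1 (b := 2) (by norm_num) ℓ₁
  have hodd₁ := hℓ₁.odd_of_ne_two (by omega)
  have hodd₂ := hℓ₂.odd_of_ne_two (by omega)
  have hdvd := (hy2 _ h3).dvd_add_one (by omega)
  have hJ₁ : jacobiSym M ℓ₁ = -1 := by
    rw [← hb, jacobiSym.mod_right _ hodd₁, jacobiSym.mod_right _ hbo, Int.natAbs_natCast,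
      show ℓ₁ % (4 * M) = b % (4 * M) from h1]
  have hJ₂ : jacobiSym M ℓ₂ = -1 := by
    have := jacobiSym_eq_one_of_dvd_add_one hM0 hdvd
    rw [jacobiSym.mul_right' _ hℓ₁.ne_zero hℓ₂.ne_zero, hJ₁] at this
    linarith
  obtain hc : ℓ₁.Coprime ℓ₂ := (Nat.coprime_primes hℓ₁ hℓ₂).2 (by omega)
  have lift {ℓ : ℕ} (hℓ : ℓ.Prime) (hodd : Odd ℓ) (h2 : ℓ ≡ 2 [MOD 5])
      (hJ : jacobiSym M ℓ = -1) := exists_dvd_sq_add_of_inert (α := α) hℓ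
    (by rw [disc_five_eq]; exact jacobiSym_five_of_modEq hodd h2)
    (by rw [hM, jacobiSym.mul_left, hJ, jacobiSym_five_of_modEq hodd h2]; norm_num)
  obtain ⟨z, hz⟩ := exists_dvd_sq_sub_mul (x := -α) hc
    (by simpa only [sub_neg_eq_add] using lift hℓ₁ hodd₁ h2 hJ₁)
    (by simpa only [sub_neg_eq_add] using lift hℓ₂ hodd₂ h4 hJ₂)
  rw [sub_neg_eq_add] at hz
  refine exists_adm_of_dvd hα (Nat.mul_pos hℓ₁.pos hℓ₂.pos) (s := 1) ?_ hz
  rw [hM, one_pow, one_mul, add_comm]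
  have h6 : 5 ∣ ℓ₁ * ℓ₂ + 1 := by
    have : ℓ₁ * ℓ₂ ≡ 2 * 2 [MOD 5] := h2.mul h4
    have : (ℓ₁ * ℓ₂) % 5 = 4 := this
    omega
  have h7 : 5 * M ∣ ℓ₁ * ℓ₂ + 1 := (Nat.Coprime.coprime_dvd_left (Dvd.intro_left 4 rfl)
    h5).symm.mul_dvd_of_dvd_of_dvd h6 ((Dvd.intro_left 4 rfl).trans hdvd)
  exact_mod_cast h7

lemma exists_adm_eight_of_not_isSquare {α : QuadraticAlgebra ℤ 2 0} (hα : TPos α) {M : ℕ}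
    (hM : α.norm = 2 * M) (h : ¬ 2 ∣ M) (hsq : ¬ IsSquare M) : ∃ Q, Adm α Q := by
  have hM0 : M ≠ 0 := by rintro rfl; exact hsq .zero
  obtain ⟨b, hb4, hbM, hb⟩ := exists_jacobiSym_eq_neg_one hM0 hsq
  have h2M : M.Coprime 2 := by
    rw [Nat.coprime_comm, Nat.Prime.coprime_iff_not_dvd Nat.prime_two]
    omega
  have h8 : M.Coprime 8 := h2M.pow_right 3
  have hbo : Odd b := Nat.odd_iff.2 (by omega)
  obtain ⟨ℓ₁, hℓ₁2, hℓ₁, h1, h2⟩ := exists_prime_modEq_modEq h8 (by omega) (by norm_num)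
    hbM (b := 3) (by norm_num) 2
  have hℓ₁M : ℓ₁.Coprime M := by rw [Nat.Coprime, h1.gcd_eq]; exact hbM
  obtain ⟨y, hy1, hy2⟩ := Nat.exists_mul_modEq_sub_one (by omega) hℓ₁M
  obtain ⟨ℓ₂, hℓ₂2, hℓ₂, h3, h4⟩ := exists_prime_modEq_modEq h8 (by omega) (by norm_num)
    hy1 (b := 5) (by norm_num) ℓ₁
  have hm₁ : ℓ₁ % 8 = 3 := h2
  have hm₂ : ℓ₂ % 8 = 5 := h4
  have hodd₁ := hℓ₁.odd_of_ne_two (by omega)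
  have hodd₂ := hℓ₂.odd_of_ne_two (by omega)
  have h6 : 8 ∣ ℓ₁ * ℓ₂ + 1 := by
    have : ℓ₁ * ℓ₂ ≡ 3 * 5 [MOD 8] := h2.mul h4
    have : (ℓ₁ * ℓ₂) % 8 = 7 := this
    omega
  have hdvd₈ : 8 * M ∣ ℓ₁ * ℓ₂ + 1 :=
    h8.symm.mul_dvd_of_dvd_of_dvd h6 ((hy2 _ h3).dvd_add_one (by omega))
  have hdvd : 4 * M ∣ ℓ₁ * ℓ₂ + 1 := (mul_dvd_mul_right (by norm_num) M).trans hdvd₈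
  have hJ₁ : jacobiSym M ℓ₁ = -1 := by
    have : ℓ₁ ≡ b [MOD 4 * M] := (Nat.modEq_and_modEq_iff_modEq_mul
      (Nat.Coprime.pow_right 2 h2M).symm).1 ⟨show ℓ₁ % 4 = b % 4 by omega, h1⟩
    rw [← hb, jacobiSym.mod_right _ hodd₁, jacobiSym.mod_right _ hbo, Int.natAbs_natCast,
      show ℓ₁ % (4 * M) = b % (4 * M) from this]
  have hJ₂ : jacobiSym M ℓ₂ = -1 := by
    have := jacobiSym_eq_one_of_dvd_add_one hM0 hdvd
    rw [jacobiSym.mul_right' _ hℓ₁.ne_zero hℓ₂.ne_zero, hJ₁] at this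
    linarith
  obtain hc : ℓ₁.Coprime ℓ₂ := (Nat.coprime_primes hℓ₁ hℓ₂).2 (by omega)
  have lift {ℓ : ℕ} (hℓ : ℓ.Prime) (h2 : ℓ % 8 = 3 ∨ ℓ % 8 = 5)
      (hJ : jacobiSym M ℓ = -1) := exists_dvd_sq_add_of_inert (α := α) hℓ
    (by rw [disc_eight_eq, jacobiSym.pow_left, jacobiSym_two_of_mod_eight h2]; rfl)
    (by rw [hM, jacobiSym.mul_left, hJ, jacobiSym_two_of_mod_eight h2]; norm_num)
  obtain ⟨z, hz⟩ := exists_dvd_sq_sub_mul (x := -α) hc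
    (by simpa only [sub_neg_eq_add] using lift hℓ₁ (Or.inl hm₁) hJ₁)
    (by simpa only [sub_neg_eq_add] using lift hℓ₂ (Or.inr hm₂) hJ₂)
  rw [sub_neg_eq_add] at hz
  refine exists_adm_of_dvd hα (Nat.mul_pos hℓ₁.pos hℓ₂.pos) (s := 1) ?_ hz
  rw [hM, one_pow, one_mul, add_comm]
  have h7 : 2 * M ∣ ℓ₁ * ℓ₂ + 1 := (mul_dvd_mul_right (by norm_num) M).trans hdvd
  exact_mod_cast h7

end RealQuad

/-- If `ℓ ≡ 7 (mod 16)` then `2 + √2` is not a square modulo `ℓ`. -/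
lemma two_add_sqrt_two_not_isSquare {ℓ : ℕ} [Fact ℓ.Prime] (hℓ : ℓ % 16 = 7) {ρ : ZMod ℓ}
    (hρ : ρ ^ 2 = 2) : ¬ IsSquare (2 + ρ) := by
  rintro ⟨t, ht⟩
  set v : ℕ → ZMod ℓ := fun k => (Polynomial.dickson 1 (1 : ZMod ℓ) k).eval t with hv
  have h0 : v 0 = 2 := by
    simp only [hv, Polynomial.dickson_zero]
    norm_num
  have h1 : v 1 = t := by simp only [hv, Polynomial.dickson_one, Polynomial.eval_X]
  have hrec (k : ℕ) : v (k + 2) = t * v (k + 1) - v k := by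
    simp only [hv, Polynomial.dickson_add_two]
    simp
  have h2 : v 2 = ρ := by rw [hrec, h1, h0]; linear_combination -ht
  have h3 : v 3 = t * ρ - t := by rw [hrec, h2, h1]
  have h4 : v 4 = 0 := by rw [hrec, h3, h2]; linear_combination (1 - ρ) * ht + hρ
  have h5 : v 5 = -(t * ρ - t) := by rw [hrec, h4, h3]; ring
  have h6 : v 6 = -ρ := by rw [hrec, h5, h4]; linear_combination (ρ - 1) * ht - hρ
  have h7 : v 7 = -t := by rw [hrec, h6, h5]; ring
  have h8 : v 8 = -v 0 := by rw [hrec, h7, h6, h0]; linear_combination ht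
  have h9 : v 9 = -v 1 := by rw [hrec, h8, h7, h1, h0]; ring
  have hper (k : ℕ) : v (k + 8) = -v k ∧ v (k + 9) = -v (k + 1) := by
    induction k with
    | zero => exact ⟨h8, h9⟩
    | succ k ih =>
      refine ⟨by rw [show k + 1 + 8 = k + 9 by ring, ih.2], ?_⟩
      rw [show k + 1 + 9 = k + 8 + 2 by ring, hrec, show k + 8 + 1 = k + 9 by ring, ih.1, ih.2,
        hrec]
      ring
  have hper' (j : ℕ) : v (16 * j + 7) = -t := by
    induction j with
    | zero => exact h7
    | succ j ih =>
      rw [show 16 * (j + 1) + 7 = 16 * j + 7 + 8 + 8 by ring, (hper _).1, (hper _).1, neg_neg, ih]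
  have hvℓ : v ℓ = t := by
    simp only [hv, Polynomial.dickson_one_one_zmod_p, Polynomial.eval_pow, Polynomial.eval_X,
      ZMod.pow_card]
  have hvℓ' : v ℓ = -t :=
    (congrArg v (show ℓ = 16 * (ℓ / 16) + 7 by omega)).trans (hper' (ℓ / 16))
  have h2ne : (2 : ZMod ℓ) ≠ 0 := by
    intro h
    have := (ZMod.natCast_eq_zero_iff 2 ℓ).1 (by exact_mod_cast h)
    have := Nat.le_of_dvd two_pos this
    omega
  have ht0 : t = 0 := by
    have : 2 * t = 0 := by linear_combination hvℓ' - hvℓ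
    exact (mul_eq_zero.1 this).resolve_left h2ne
  apply h2ne
  rw [ht0] at ht
  linear_combination (2 - ρ) * ht + hρ

namespace RealQuad

section

variable {m n : ℤ} [RealQuad m n] {α δ κ : QuadraticAlgebra ℤ m n}

lemma exists_adm_of_norm_sq (hα : TPos α) (h : α = δ * κ) {k : ℕ} (hκ : κ.norm = k ^ 2) {ℓ : ℕ}
    (hℓ : ℓ.Prime) {s : ℤ} (hs : α.norm ∣ 1 + s ^ 2 * ℓ)
    (hδ : ∃ z : QuadraticAlgebra ℤ m n, (ℓ : QuadraticAlgebra ℤ m n) ∣ z ^ 2 - -δ)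
    (hg : jacobiSym (2 * k + κ.trace) ℓ = 1) : ∃ Q, Adm α Q := by
  have := Fact.mk hℓ
  obtain ⟨γ, hγ⟩ := ZMod.isSquare_of_jacobiSym_eq_one hg
  have hγ0 : γ ≠ 0 := by
    rintro rfl
    rw [mul_zero] at hγ
    rw [← jacobiSym.legendreSym.to_jacobiSym, (legendreSym.eq_zero_iff ℓ _).2 hγ] at hg
    norm_num at hg
  obtain ⟨u, hu⟩ := ZMod.intCast_surjective γ⁻¹
  have hug : (ℓ : ℤ) ∣ u ^ 2 * (2 * k + κ.trace) - 1 := by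
    rw [← ZMod.intCast_zmod_eq_zero_iff_dvd]
    rw [Int.cast_sub, Int.cast_mul, hγ, Int.cast_pow, hu]
    field_simp
    simp
  obtain ⟨e, he⟩ := hug
  obtain ⟨z, w, hz⟩ := hδ
  have hμ : (κ + k) ^ 2 = (2 * k + (κ.trace : QuadraticAlgebra ℤ m n)) * κ := by
    have h1 := QuadraticAlgebra.algebraMap_trace_eq_add_star (z := κ)
    have h2 := QuadraticAlgebra.algebraMap_norm_eq_mul_star (z := κ)
    rw [hκ] at h2
    simp only [algebraMap_int_eq, eq_intCast] at h1 h2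
    push_cast at h2
    linear_combination h2 - κ * h1
  have he' := congrArg (Int.cast : ℤ → QuadraticAlgebra ℤ m n) he
  push_cast at he'
  refine exists_adm_of_dvd hα hℓ.pos hs (z := z * (κ + k) * u)
    ⟨w * (κ + k) ^ 2 * u ^ 2 - δ * κ * e, ?_⟩
  linear_combination (κ + k) ^ 2 * u ^ 2 * hz - δ * u ^ 2 * hμ - δ * κ * he' + h

end

lemma exists_dvd_sq_add_five {ℓ : ℕ} (hℓ : ℓ.Prime) (h : ℓ ≡ 1 [MOD 5]) :
    ∃ z : QuadraticAlgebra ℤ 1 1, (ℓ : QuadraticAlgebra ℤ 1 1) ∣ z ^ 2 - -⟨2, 1⟩ := by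
  have := Fact.mk hℓ
  have := Fact.mk Nat.prime_five
  have hℓ5 : ℓ % 5 = 1 := h
  obtain ⟨u, hu⟩ := exists_prime_orderOf_dvd_card 5 (G := (ZMod ℓ)ˣ) (by
    rw [ZMod.card_units]; omega)
  obtain ⟨w, hw⟩ : ∃ w : ZMod ℓ, w = u := ⟨_, rfl⟩
  have hw5 : w ^ 5 = 1 := by
    rw [hw, ← Units.val_pow_eq_pow_val, ← hu, pow_orderOf_eq_one, Units.val_one]
  have hw1 : w - 1 ≠ 0 := by
    intro h
    have : u = 1 := Units.ext (by rw [← hw, Units.val_one]; linear_combination h)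
    rw [this, orderOf_one] at hu
    norm_num at hu
  have hsum : 1 + w + w ^ 2 + w ^ 3 + w ^ 4 = 0 := by
    apply mul_left_cancel₀ hw1
    linear_combination hw5
  have h5 : (5 : ZMod ℓ) ≠ 0 := by
    intro h
    have := (ZMod.natCast_eq_zero_iff 5 ℓ).1 (by exact_mod_cast h)
    rw [Nat.prime_dvd_prime_iff_eq hℓ Nat.prime_five] at this
    omega
  apply exists_dvd_sq_sub
  apply exists_sq_of_split (φ₁ := -(w ^ 2 + w ^ 3)) (φ₂ := -(w + w ^ 4)) (t₁ := w - w ^ 4)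
    (t₂ := w ^ 2 - w ^ 3)
  · intro heq
    apply h5
    have h1 : -(w ^ 2 + w ^ 3) + -(w + w ^ 4) = 1 := by linear_combination -hsum
    have h2 : (w ^ 2 + w ^ 3) * (w + w ^ 4) = -1 := by
      linear_combination hsum + (w + w ^ 2) * hw5
    linear_combination (-(w ^ 2 + w ^ 3) - -(w + w ^ 4)) * heq -
      (-(w ^ 2 + w ^ 3) + -(w + w ^ 4) + 1) * h1 + 4 * h2
  · push_cast; linear_combination -hsum
  · push_cast; linear_combination hsum + (w + w ^ 2) * hw5
  · simp only [QuadraticAlgebra.re_neg, QuadraticAlgebra.im_neg]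
    push_cast
    linear_combination (2 - w ^ 3) * hw5
  · simp only [QuadraticAlgebra.re_neg, QuadraticAlgebra.im_neg]
    push_cast
    linear_combination (2 - w) * hw5

lemma exists_dvd_sq_add_eight {ℓ : ℕ} (hℓ : ℓ.Prime) (h : ℓ % 16 = 7) :
    ∃ z : QuadraticAlgebra ℤ 2 0, (ℓ : QuadraticAlgebra ℤ 2 0) ∣ z ^ 2 - -⟨2, 1⟩ := by
  have := Fact.mk hℓ
  obtain ⟨ρ, hρ⟩ := (ZMod.exists_sq_eq_two_iff (p := ℓ) (by omega)).2 (Or.inr (by omega))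
  have hm1 : ¬ IsSquare (-1 : ZMod ℓ) := by
    rw [ZMod.exists_sq_eq_neg_one_iff]; omega
  have key (σ : ZMod ℓ) (hσ : σ ^ 2 = 2) : ∃ t, -2 + -1 * σ = t ^ 2 := by
    obtain ⟨t, ht⟩ := isSquare_mul_of_not_isSquare hm1 (two_add_sqrt_two_not_isSquare h hσ)
    exact ⟨t, by linear_combination ht⟩
  obtain ⟨t₁, ht₁⟩ := key ρ (by rw [hρ]; ring)
  obtain ⟨t₂, ht₂⟩ := key (-ρ) (by rw [hρ]; ring)
  have h8 : (2 ^ 3 : ZMod ℓ) ≠ 0 := by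
    apply pow_ne_zero
    intro h
    have := (ZMod.natCast_eq_zero_iff 2 ℓ).1 (by exact_mod_cast h)
    have := Nat.le_of_dvd two_pos this
    omega
  apply exists_dvd_sq_sub
  apply exists_sq_of_split (φ₁ := ρ) (φ₂ := -ρ) (t₁ := t₁) (t₂ := t₂)
  · intro heq
    apply h8
    linear_combination 2 * ρ * heq + 4 * hρ
  · simp
  · push_cast; linear_combination hρ
  · simp only [QuadraticAlgebra.re_neg, QuadraticAlgebra.im_neg]
    push_cast
    exact ht₁
  · simp only [QuadraticAlgebra.re_neg, QuadraticAlgebra.im_neg]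
    push_cast
    exact ht₂

lemma TPos.exists_trace_eq {m n : ℤ} [RealQuad m n] {κ : QuadraticAlgebra ℤ m n} (hκ : TPos κ)
    (k : ℕ) : ∃ g : ℕ, 2 * k + κ.trace = g ∧ g ≠ 0 := by
  have := hκ.trace_pos
  exact ⟨(2 * k + κ.trace).toNat, by omega, by omega⟩

lemma exists_adm_five_of_norm_sq {α κ : QuadraticAlgebra ℤ 1 1} (hα : TPos α)
    (h : α = ⟨2, 1⟩ * κ) {k : ℕ} (hκ : κ.norm = k ^ 2) (hk : ¬ 5 ∣ k) : ∃ Q, Adm α Q := by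
  have hκp : TPos κ := (TPos.of_norm_trace (by decide) (by decide) :
    TPos (⟨2, 1⟩ : QuadraticAlgebra ℤ 1 1)).of_mul (h ▸ hα)
  obtain ⟨g, hg, hg0⟩ := hκp.exists_trace_eq k
  obtain ⟨e, g₀, hg₀, rfl⟩ := Nat.exists_eq_pow_mul_and_not_dvd hg0 5 (by norm_num)
  have hk0 : k ≠ 0 := by rintro rfl; simp at hk
  have hg00 : g₀ ≠ 0 := by rintro rfl; simp at hg₀
  have hA : 4 * (g₀ * k ^ 2) ≠ 0 := by positivity
  have h5 : (4 * (g₀ * k ^ 2)).Coprime 5 := by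
    rw [Nat.coprime_comm, Nat.Prime.coprime_iff_not_dvd Nat.prime_five]
    intro h
    rcases Nat.prime_five.dvd_mul.1 h with h | h
    · revert h; decide
    rcases Nat.prime_five.dvd_mul.1 h with h | h
    · exact hg₀ h
    · exact hk (Nat.prime_five.dvd_of_dvd_pow h)
  obtain ⟨ℓ, hℓ2, hℓ, h1, h2⟩ := exists_prime_modEq_modEq h5 hA (by norm_num)
    (Nat.coprime_sub_one_self hA) (b := 1) (by norm_num) 2
  have hk5 : (k ^ 2).Coprime 5 := by
    rw [Nat.coprime_comm]
    exact Nat.Coprime.pow_right 2 ((Nat.Prime.coprime_iff_not_dvd Nat.prime_five).2 hk)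
  obtain ⟨s, hs1, hs2⟩ := Nat.chineseRemainder hk5 1 2
  have hodd := hℓ.odd_of_ne_two (by omega)
  have hdvd := h1.dvd_add_one hA
  refine exists_adm_of_norm_sq hα h hκ hℓ (s := s) ?_ (exists_dvd_sq_add_five hℓ h2) ?_
  · have h3 : (⟨2, 1⟩ : QuadraticAlgebra ℤ 1 1).norm = 5 := by decide
    rw [h, map_mul, hκ, h3]
    have h4 : k ^ 2 ∣ 1 + s ^ 2 * ℓ := by
      have h5 : k ^ 2 ∣ 1 + 1 ^ 2 * ℓ := by
        rw [one_pow, one_mul, add_comm]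
        exact Dvd.dvd.trans ⟨4 * g₀, by ring⟩ hdvd
      rw [← Nat.modEq_zero_iff_dvd] at h5 ⊢
      exact (((hs1.pow 2).mul_right ℓ).add_left 1).trans h5
    have h6 : 5 ∣ 1 + s ^ 2 * ℓ := by
      rw [← Nat.modEq_zero_iff_dvd]
      exact (((hs2.pow 2).mul h2).add_left 1).trans rfl
    exact_mod_cast hk5.symm.mul_dvd_of_dvd_of_dvd h6 h4
  · rw [hg, Nat.cast_mul, Nat.cast_pow, jacobiSym.mul_left, jacobiSym.pow_left,
      jacobiSym_eq_one_of_dvd_add_one hg00 (Dvd.dvd.trans ⟨k ^ 2, by ring⟩ hdvd)]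
    have h1 := jacobiSym.quadratic_reciprocity_one_mod_four (a := 5) (b := ℓ) (by norm_num) hodd
    rw [h1, jacobiSym.mod_left' (a₂ := 1) (by exact_mod_cast h2), jacobiSym.one_left]
    simp

lemma exists_adm_eight_of_norm_sq {α κ : QuadraticAlgebra ℤ 2 0} (hα : TPos α)
    (h : α = ⟨2, 1⟩ * κ) {k : ℕ} (hκ : κ.norm = k ^ 2) (hk : ¬ 2 ∣ k) : ∃ Q, Adm α Q := by
  have hκp : TPos κ := (TPos.of_norm_trace (by decide) (by decide) :
    TPos (⟨2, 1⟩ : QuadraticAlgebra ℤ 2 0)).of_mul (h ▸ hα)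
  obtain ⟨g, hg, hg0⟩ := hκp.exists_trace_eq k
  obtain ⟨e, g₀, hg₀, rfl⟩ := Nat.exists_eq_pow_mul_and_not_dvd hg0 2 (by norm_num)
  have hk0 : k ≠ 0 := by rintro rfl; simp at hk
  have hg00 : g₀ ≠ 0 := by rintro rfl; simp at hg₀
  have hA : g₀ * k ^ 2 ≠ 0 := by positivity
  have h2A : Nat.Coprime 2 (g₀ * k ^ 2) := by
    rw [Nat.Prime.coprime_iff_not_dvd Nat.prime_two]
    intro h
    rcases Nat.prime_two.dvd_mul.1 h with h | h
    · exact hg₀ h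
    · exact hk (Nat.prime_two.dvd_of_dvd_pow h)
  obtain ⟨ℓ, hℓ2, hℓ, h1, h2⟩ := exists_prime_modEq_modEq (h2A.symm.pow_right 4) hA (by norm_num)
    (Nat.coprime_sub_one_self hA) (b := 7) (by norm_num) 2
  have h7 : ℓ % 16 = 7 := h2
  have hodd := hℓ.odd_of_ne_two (by omega)
  have hdvd : 4 * (g₀ * k ^ 2) ∣ ℓ + 1 := (h2A.pow_left 2).mul_dvd_of_dvd_of_dvd (by omega)
    (h1.dvd_add_one hA)
  refine exists_adm_of_norm_sq hα h hκ hℓ (s := 1) ?_ (exists_dvd_sq_add_eight hℓ h2) ?_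
  · have h3 : (⟨2, 1⟩ : QuadraticAlgebra ℤ 2 0).norm = 2 := by decide
    rw [h, map_mul, hκ, h3, one_pow, one_mul, add_comm]
    have h4 : 2 * k ^ 2 ∣ ℓ + 1 := Dvd.dvd.trans ⟨2 * g₀, by ring⟩ hdvd
    exact_mod_cast h4
  · rw [hg, Nat.cast_mul, Nat.cast_pow, jacobiSym.mul_left, jacobiSym.pow_left,
      jacobiSym_eq_one_of_dvd_add_one hg00 (Dvd.dvd.trans ⟨k ^ 2, by ring⟩ hdvd)]
    rw [Nat.cast_ofNat, jacobiSym.at_two hodd, ← ZMod.natCast_mod ℓ 8,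
      show ℓ % 8 = 7 by omega]
    have : ZMod.χ₈ ((7 : ℕ) : ZMod 8) = 1 := by decide
    rw [this]; simp

lemma exists_adm_five {α : QuadraticAlgebra ℤ 1 1} (hα : TPos α) : ∃ Q, Adm α Q := by
  induction hN : α.norm.toNat using Nat.strong_induction_on generalizing α with
  | _ N ih =>
  subst hN
  have hpos := hα.norm_pos
  by_cases h5 : (5 : ℤ) ∣ α.norm
  swap
  · exact exists_adm_five_of_not_dvd hα h5
  obtain ⟨x, hx⟩ := sqrt_five_dvd h5
  have hn5 : (⟨-1, 2⟩ : QuadraticAlgebra ℤ 1 1).norm = -5 := by decide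
  have hαn : α.norm = -5 * x.norm := by rw [hx, map_mul, hn5]
  by_cases h25 : (5 : ℤ) ∣ x.norm
  · obtain ⟨y, hy⟩ := sqrt_five_dvd h25
    have hαy : α = ⟨-1, 2⟩ ^ 2 * y := by rw [hx, hy]; ring
    have hyn : x.norm = -5 * y.norm := by rw [hy, map_mul, hn5]
    have hyp : TPos y := (tpos_sq (by decide : (⟨-1, 2⟩ : QuadraticAlgebra ℤ 1 1) ≠ 0)).of_mul
      (hαy ▸ hα)
    have := hyp.norm_pos
    obtain ⟨Q, hQ⟩ := ih _ (by omega) hyp rfl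
    exact ⟨Q, hαy ▸ hQ.sq_mul _⟩
  · obtain ⟨M, hM⟩ : ∃ M : ℕ, (M : ℤ) = -x.norm := ⟨(-x.norm).toNat, by omega⟩
    have hαM : α.norm = 5 * M := by omega
    have hM5 : ¬ 5 ∣ M := by omega
    by_cases hsq : IsSquare M
    · obtain ⟨k, rfl⟩ := hsq
      have h1 : (⟨2, 1⟩ * ⟨-1, 1⟩ : QuadraticAlgebra ℤ 1 1) = ⟨-1, 2⟩ := by decide
      have h2 : (⟨-1, 1⟩ : QuadraticAlgebra ℤ 1 1).norm = -1 := by decide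
      refine exists_adm_five_of_norm_sq hα (κ := ⟨-1, 1⟩ * x) (k := k) ?_ ?_ ?_
      · rw [hx, ← mul_assoc, h1]
      · rw [map_mul, h2, neg_one_mul, ← hM]; push_cast; ring
      · exact fun h => hM5 (h.mul_right k)
    · exact exists_adm_five_of_not_isSquare hα hαM hM5 hsq

lemma exists_adm_eight {α : QuadraticAlgebra ℤ 2 0} (hα : TPos α) : ∃ Q, Adm α Q := by
  induction hN : α.norm.toNat using Nat.strong_induction_on generalizing α with
  | _ N ih =>
  subst hN
  have hpos := hα.norm_pos
  by_cases h2 : (2 : ℤ) ∣ α.norm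
  swap
  · exact exists_adm_eight_of_not_dvd hα h2
  obtain ⟨x, hx⟩ := sqrt_two_dvd (parity_eq_zero_of_norm h2)
  have hn2 : (⟨0, 1⟩ : QuadraticAlgebra ℤ 2 0).norm = -2 := by decide
  have hαn : α.norm = -2 * x.norm := by rw [hx, map_mul, hn2]
  by_cases h4 : (2 : ℤ) ∣ x.norm
  · obtain ⟨y, hy⟩ := sqrt_two_dvd (parity_eq_zero_of_norm h4)
    have hαy : α = ⟨0, 1⟩ ^ 2 * y := by rw [hx, hy]; ring
    have hyn : x.norm = -2 * y.norm := by rw [hy, map_mul, hn2]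
    have hyp : TPos y := (tpos_sq (by decide : (⟨0, 1⟩ : QuadraticAlgebra ℤ 2 0) ≠ 0)).of_mul
      (hαy ▸ hα)
    have := hyp.norm_pos
    obtain ⟨Q, hQ⟩ := ih _ (by omega) hyp rfl
    exact ⟨Q, hαy ▸ hQ.sq_mul _⟩
  · obtain ⟨M, hM⟩ : ∃ M : ℕ, (M : ℤ) = -x.norm := ⟨(-x.norm).toNat, by omega⟩
    have hαM : α.norm = 2 * M := by omega
    have hM2 : ¬ 2 ∣ M := by omega
    by_cases hsq : IsSquare M
    · obtain ⟨k, rfl⟩ := hsq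
      have h1 : (⟨2, 1⟩ * ⟨-1, 1⟩ : QuadraticAlgebra ℤ 2 0) = ⟨0, 1⟩ := by decide
      have h2 : (⟨-1, 1⟩ : QuadraticAlgebra ℤ 2 0).norm = -1 := by decide
      refine exists_adm_eight_of_norm_sq hα (κ := ⟨-1, 1⟩ * x) (k := k) ?_ ?_ ?_
      · rw [hx, ← mul_assoc, h1]
      · rw [map_mul, h2, neg_one_mul, ← hM]; push_cast; ring
      · exact fun h => hM2 (h.mul_right k)
    · exact exists_adm_eight_of_not_isSquare hα hαM hM2 hsq

end RealQuad

/-! #### The universal forms for `q = 5` and `q = 8` -/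

namespace RealQuad

lemma exists_ringHom_Kq {q : ℕ} [NeZero q] (hq : 3 ≤ q) {m n : ℤ} [RealQuad m n] {u : 𝓞 (Kq q)}
    (hu : u ^ 2 = m + n * u) (hη : ∀ a, ∃ x y : ℤ, eta q a = x + y * u) (s t : (ZMod q)ˣ)
    (hsum : emb s u + emb t u = n) (hprod : emb s u * emb t u = -m) :
    ∃ f : QuadraticAlgebra ℤ m n →+* 𝓞 (Kq q), f ⟨0, 1⟩ = u ∧
      ∀ α, TotallyPositive (Kq q) α → ∃ x, TPos x ∧ f x = α := by
  let f : QuadraticAlgebra ℤ m n →+* 𝓞 (Kq q) :=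
    (QuadraticAlgebra.lift ⟨u, by simp only [zsmul_eq_mul, mul_one, ← sq, hu]⟩).toRingHom
  have hf (x : QuadraticAlgebra ℤ m n) : f x = x.re + x.im * u := by
    simp [f, QuadraticAlgebra.lift]
  refine ⟨f, by rw [hf]; simp, fun α hα => ?_⟩
  obtain ⟨x, rfl⟩ : ∃ x, f x = α := by
    refine eta_induction hq (p := fun α => ∃ x, f x = α) ⟨1, map_one f⟩ (fun a => ?_) ?_ ?_ α
    · obtain ⟨x, y, h⟩ := hη a
      exact ⟨⟨x, y⟩, by rw [hf, h]⟩
    · rintro _ _ ⟨x, rfl⟩ ⟨y, rfl⟩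
      exact ⟨x + y, map_add f x y⟩
    · rintro _ ⟨x, rfl⟩
      exact ⟨-x, map_neg f x⟩
  rw [totallyPositive_iff hq] at hα
  have h1 := hα s
  have h2 := hα t
  rw [hf] at h1 h2
  simp only [map_add, map_mul, map_intCast] at h1 h2
  refine ⟨x, TPos.of_norm_trace ?_ ?_, rfl⟩
  · have : (x.norm : ℝ) = (x.re + x.im * emb s u) * (x.re + x.im * emb t u) := by
      rw [QuadraticAlgebra.norm_def]
      push_cast
      linear_combination -(x.re * x.im : ℝ) * hsum - (x.im ^ 2 : ℝ) * hprod
    have h3 := mul_pos h1 h2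
    rw [← this] at h3
    exact_mod_cast h3
  · have : (x.trace : ℝ) = (x.re + x.im * emb s u) + (x.re + x.im * emb t u) := by
      rw [QuadraticAlgebra.trace_def]
      push_cast
      linear_combination -(x.im : ℝ) * hsum
    have h3 := add_pos h1 h2
    rw [← this] at h3
    exact_mod_cast h3

end RealQuad

lemma existsUniversalTernary_five : ExistsUniversalTernary (Kq 5) := by
  have h1 := eta_sq (q := 5) 1
  have h2 := eta_sq (q := 5) 2
  have h4 : eta 5 (2 * 2) = eta 5 1 := by rw [← eta_neg]; rfl
  rw [mul_one] at h1
  rw [h4] at h2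
  have hd1 : 0 < dcos 5 1 := by
    have := dcos_natCast (q := 5) 1
    rw [Nat.cast_one] at this
    rw [this]
    apply mul_pos two_pos
    apply Real.cos_pos_of_mem_Ioo
    constructor <;> push_cast <;> linarith [Real.pi_pos]
  have hd2 : dcos 5 2 < 0 := by
    have := dcos_natCast (q := 5) 2
    rw [Nat.cast_ofNat] at this
    rw [this]
    apply mul_neg_of_pos_of_neg two_pos
    apply Real.cos_neg_of_pi_div_two_lt_of_lt <;> push_cast <;> linarith [Real.pi_pos]
  have hne : eta 5 1 - eta 5 2 ≠ 0 := by
    intro h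
    have h3 := congrArg (emb (1 : (ZMod 5)ˣ)) h
    rw [map_sub, emb_eta, emb_eta, map_zero, Units.val_one, one_mul, one_mul] at h3
    linarith
  have hsum : eta 5 1 + eta 5 2 = -1 := by
    apply mul_left_cancel₀ hne
    linear_combination h1 - h2
  have hsum' : dcos 5 1 + dcos 5 2 = -1 := by
    have h3 := congrArg (emb (1 : (ZMod 5)ˣ)) hsum
    rwa [map_add, emb_eta, emb_eta, map_neg, map_one, Units.val_one, one_mul, one_mul] at h3
  have hprod' : dcos 5 1 * dcos 5 2 = -1 := by
    rw [dcos_mul, ← dcos_neg (1 + 2), show (-(1 + 2) : ZMod 5) = 2 from rfl, ← dcos_neg (1 - 2),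
      show (-(1 - 2) : ZMod 5) = 1 from rfl, ← hsum', add_comm]
  have hη (a : ZMod 5) : ∃ x y : ℤ, eta 5 a = x + y * (1 + eta 5 1) := by
    have key : ∀ a : ZMod 5, a = 0 ∨ a = 1 ∨ a = -1 ∨ a = 2 ∨ a = -2 := by decide
    rcases key a with rfl | rfl | rfl | rfl | rfl
    · exact ⟨2, 0, by rw [eta_zero]; push_cast; ring⟩
    · exact ⟨-1, 1, by push_cast; ring⟩
    · exact ⟨-1, 1, by rw [eta_neg]; push_cast; ring⟩
    · exact ⟨0, -1, by push_cast; linear_combination hsum⟩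
    · exact ⟨0, -1, by rw [eta_neg]; push_cast; linear_combination hsum⟩
  obtain ⟨f, -, hf⟩ := RealQuad.exists_ringHom_Kq (q := 5) (by norm_num) (m := 1) (n := 1)
    (u := 1 + eta 5 1) (by push_cast; linear_combination h1 + hsum) hη 1
    (ZMod.unitOfCoprime 2 (by norm_num))
    (by
      simp only [map_add, map_one, emb_eta, Units.val_one, ZMod.coe_unitOfCoprime,
        Nat.cast_ofNat, mul_one]
      push_cast
      linear_combination hsum')
    (by
      simp only [map_add, map_one, emb_eta, Units.val_one, ZMod.coe_unitOfCoprime,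
        Nat.cast_ofNat, mul_one]
      push_cast
      linear_combination hsum' + hprod')
  have heval (v : Fin 3 → 𝓞 (Kq 5)) : evalQF 1 v = v 0 ^ 2 + v 1 ^ 2 + v 2 ^ 2 := by
    simp [evalQF, Matrix.one_apply, Fin.sum_univ_three]
    ring
  refine ⟨1, Matrix.transpose_one, fun v hv σ => ?_, fun α hα => ?_⟩
  · obtain ⟨i, hi⟩ := Function.ne_iff.1 hv
    have hσ : σ (v i) ≠ 0 := by
      rw [map_ne_zero]
      exact RingOfIntegers.coe_ne_zero_iff.2 hi
    rw [heval]
    push_cast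
    simp only [map_add, map_pow]
    fin_cases i <;> simp only [Fin.zero_eta, Fin.mk_one, Fin.reduceFinMk] at hσ <;> positivity
  · obtain ⟨x, hx, rfl⟩ := hf α hα
    obtain ⟨Q, hQ⟩ := RealQuad.exists_adm_five hx
    obtain ⟨y₁, y₂, y₃, rfl⟩ := hQ.sum_three_sq_five
    exact ⟨![f y₁, f y₂, f y₃], by rw [heval]; simp⟩

lemma existsUniversalTernary_eight : ExistsUniversalTernary (Kq 8) := by
  have hd2 : dcos 8 2 = 0 := by
    have := dcos_natCast (q := 8) 2
    rw [Nat.cast_ofNat] at this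
    rw [this, show 2 * Real.pi * (2 : ℕ) / (8 : ℕ) = Real.pi / 2 by push_cast; ring,
      Real.cos_pi_div_two, mul_zero]
  have h2 : eta 8 2 = 0 := by
    apply emb_injective (1 : (ZMod 8)ˣ)
    rw [emb_eta, Units.val_one, one_mul, hd2, map_zero]
  have h1 : eta 8 1 ^ 2 = 2 := by rw [eta_sq, mul_one, h2, zero_add]
  have h4 : eta 8 4 = -2 := by
    have := eta_sq (q := 8) 2
    rw [h2, show (2 * 2 : ZMod 8) = 4 from rfl] at this
    linear_combination -this
  have h3 : eta 8 3 = -eta 8 1 := by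
    have := eta_mul (q := 8) 2 1
    rw [h2, show (2 + 1 : ZMod 8) = 3 from rfl, show (2 - 1 : ZMod 8) = 1 from rfl] at this
    linear_combination -this
  have hη (a : ZMod 8) : ∃ x y : ℤ, eta 8 a = x + y * eta 8 1 := by
    have key : ∀ a : ZMod 8, a = 0 ∨ a = 1 ∨ a = -1 ∨ a = 2 ∨ a = -2 ∨ a = 3 ∨ a = -3 ∨ a = 4 := by
      decide
    rcases key a with rfl | rfl | rfl | rfl | rfl | rfl | rfl | rfl
    · exact ⟨2, 0, by rw [eta_zero]; push_cast; ring⟩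
    · exact ⟨0, 1, by push_cast; ring⟩
    · exact ⟨0, 1, by rw [eta_neg]; push_cast; ring⟩
    · exact ⟨0, 0, by rw [h2]; push_cast; ring⟩
    · exact ⟨0, 0, by rw [eta_neg, h2]; push_cast; ring⟩
    · exact ⟨0, -1, by rw [h3]; push_cast; ring⟩
    · exact ⟨0, -1, by rw [eta_neg, h3]; push_cast; ring⟩
    · exact ⟨-2, 0, by rw [h4]; push_cast; ring⟩
  have hd3 : dcos 8 3 = -dcos 8 1 := by
    have h := congrArg (emb (1 : (ZMod 8)ˣ)) h3
    rwa [map_neg, emb_eta, emb_eta, Units.val_one, one_mul, one_mul] at h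
  have hd1 : dcos 8 1 ^ 2 = 2 := by
    have h := congrArg (emb (1 : (ZMod 8)ˣ)) h1
    rwa [map_pow, emb_eta, Units.val_one, one_mul, map_ofNat] at h
  obtain ⟨f, hfu, hf⟩ := RealQuad.exists_ringHom_Kq (q := 8) (by norm_num) (m := 2) (n := 0)
    (u := eta 8 1) (by rw [h1]; push_cast; ring) hη 1 (ZMod.unitOfCoprime 3 (by norm_num))
    (by
      simp only [emb_eta, Units.val_one, ZMod.coe_unitOfCoprime, Nat.cast_ofNat, mul_one, hd3]
      push_cast
      ring)
    (by
      simp only [emb_eta, Units.val_one, ZMod.coe_unitOfCoprime, Nat.cast_ofNat, mul_one, hd3]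
      push_cast
      linear_combination -hd1)
  set r := eta 8 1
  have heval (v : Fin 3 → 𝓞 (Kq 8)) : evalQF !![1, 0, 0; 0, 2 + r, 1; 0, 1, 2 - r] v =
      v 0 ^ 2 + (2 + r) * v 1 ^ 2 + 2 * v 1 * v 2 + (2 - r) * v 2 ^ 2 := by
    simp [evalQF, Fin.sum_univ_three]
    ring
  refine ⟨!![1, 0, 0; 0, 2 + r, 1; 0, 1, 2 - r], ?_, fun v hv σ => ?_, fun α hα => ?_⟩
  · ext i j
    fin_cases i <;> fin_cases j <;> rfl
  · have hr : σ r ^ 2 = 2 := by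
      have h := congrArg (fun x : 𝓞 (Kq 8) => σ x) h1
      push_cast at h
      simpa only [map_pow, map_ofNat] using h
    have hr2 : 0 < 2 + σ r := by nlinarith
    have hσ (i : Fin 3) (h : σ (v i) = 0) : v i = 0 :=
      RingOfIntegers.coe_eq_zero_iff.1 ((map_eq_zero σ).1 h)
    rw [heval]
    push_cast
    simp only [map_add, map_pow, map_mul, map_sub, map_ofNat]
    have hsq : (2 + σ r) * (σ (v 0) ^ 2 + (2 + σ r) * σ (v 1) ^ 2 + 2 * σ (v 1) * σ (v 2) +
        (2 - σ r) * σ (v 2) ^ 2) =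
        (2 + σ r) * σ (v 0) ^ 2 + ((2 + σ r) * σ (v 1) + σ (v 2)) ^ 2 + σ (v 2) ^ 2 := by
      linear_combination -σ (v 2) ^ 2 * hr
    refine pos_of_mul_pos_right (a := 2 + σ r) ?_ hr2.le
    rw [hsq]
    by_contra! hle
    have p0 : 0 ≤ (2 + σ r) * σ (v 0) ^ 2 := by positivity
    have p1 := sq_nonneg ((2 + σ r) * σ (v 1) + σ (v 2))
    have p2 := sq_nonneg (σ (v 2))
    have z2 : σ (v 2) = 0 := pow_eq_zero_iff two_ne_zero |>.1 (by linarith)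
    have z1 : (2 + σ r) * σ (v 1) + σ (v 2) = 0 := pow_eq_zero_iff two_ne_zero |>.1 (by linarith)
    have z0 : (2 + σ r) * σ (v 0) ^ 2 = 0 := by linarith
    rw [z2, add_zero] at z1
    have z0' := pow_eq_zero_iff two_ne_zero |>.1 ((mul_eq_zero.1 z0).resolve_left hr2.ne')
    apply hv
    ext i : 1
    fin_cases i
    · exact hσ 0 z0'
    · exact hσ 1 ((mul_eq_zero.1 z1).resolve_left hr2.ne')
    · exact hσ 2 z2
  · obtain ⟨x, hx, rfl⟩ := hf α hα
    obtain ⟨Q, hQ⟩ := RealQuad.exists_adm_eight hx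
    obtain ⟨y, p, s, rfl⟩ := hQ.repEight
    refine ⟨![f y, f p, f s], ?_⟩
    have hf2 : f 2 = 2 := (congrArg f (by decide : (2 : QuadraticAlgebra ℤ 2 0) = 1 + 1)).trans
      (by rw [map_add, map_one, one_add_one_eq_two])
    rw [heval]
    simp [hfu, hf2]

/-- Let `q ≥ 5` be an odd prime or a power of two. A classical totally positive definite
ternary quadratic form universal over `𝓞_{K_q}` exists if and only if `q = 5` or `q = 8`. -/
theorem stmt3 (q : ℕ) (hq5 : 5 ≤ q)
    (hq : (Nat.Prime q ∧ Odd q) ∨ ∃ m : ℕ, q = 2 ^ m) :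
    ExistsUniversalTernary ↥(Kq q) ↔ (q = 5 ∨ q = 8) := by
  have : NeZero q := ⟨by omega⟩
  constructor
  · intro h
    by_contra! hne
    obtain ⟨B, hB⟩ := exists_univTernary (by omega) h
    rcases hq with ⟨hp, -⟩ | ⟨m, rfl⟩
    · have h6 : q ≠ 6 := by rintro rfl; norm_num at hp
      have hP : BigPrime q := ⟨hp, by omega⟩
      by_cases h7 : q = 7
      · subst h7
        exact hP.not_univTernary_seven hB
      · exact hP.not_univTernary h7 hB
    · have hm : 4 ≤ m := by
        by_contra! hm
        interval_cases m <;> simp at hq5 hne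
      obtain ⟨k, rfl⟩ := Nat.exists_eq_add_of_le hm
      exact TwoPow.not_univTernary (n := 2 ^ k) ⟨by rw [pow_add]; norm_num, 3 + k, by ring⟩ hB
  · rintro (rfl | rfl)
    · exact existsUniversalTernary_five
    · exact existsUniversalTernary_eight
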